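/- arXiv:1706.08118 — 5 statements merged into one kernel-verified Lean document; each statement's English description precedes it below -/
import Mathlib

section
/- Let h be a dimension function with h ≺ x^d (i.e. lim_{x→0⁺} x^d/h(x) = 0), and let (ψ_k)_{k∈ℕ} be a sequence of non-zero linear maps ψ_k : (ℝ^d)^{m_k} → ℝ with m_k ≥ 2. Then there exists a compact set E ⊆ ℝ^d with ℋ^h(E) > 0 such that for every k and every choice of pairwise distinct points x₁, …, x_{m_k} ∈ E, ψ_k(x₁, …, x_{m_k}) ≠ 0. -/
open MeasureTheory Filter Set

/-- A dimension function: vanishes at 0, positive on positives, increasing,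
right-continuous. -/
def IsDimFun (h : ℝ → ℝ) : Prop :=
  h 0 = 0 ∧ (∀ t > 0, 0 < h t) ∧ MonotoneOn h (Set.Ici 0) ∧
    ∀ t ∈ Set.Ici (0 : ℝ), ContinuousWithinAt h (Set.Ici t) t

/-- The Hausdorff measure associated to a gauge (dimension) function `h`. -/
noncomputable def gaugeMeasure {X : Type*} [EMetricSpace X] [MeasurableSpace X]
    [BorelSpace X] (h : ℝ → ℝ) : Measure X :=
  Measure.mkMetric fun r => ENNReal.ofReal (h r.toReal)

/-- `Prec h₂ h₁` means `h₂ ≺ h₁`, i.e. `lim_{x→0⁺} h₁ x / h₂ x = 0`. -/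
def Prec (h₂ h₁ : ℝ → ℝ) : Prop :=
  Tendsto (fun x => h₁ x / h₂ x) (nhdsWithin 0 (Set.Ioi 0)) (nhds 0)

theorem IsDimFun.exists_gt_ofReal_le {h : ℝ → ℝ} (hdim : IsDimFun h) {t : ℝ} (ht : 0 ≤ t) {b : ℝ}
    (htb : t < b) {ε : ENNReal} (hε : 0 < ε) :
    ∃ r, t < r ∧ r ≤ b ∧ ENNReal.ofReal (h r) ≤ ENNReal.ofReal (h t) + ε := by
  have hc : Tendsto (fun r => ENNReal.ofReal (h r)) (nhdsWithin t (Ioi t))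
      (nhds (ENNReal.ofReal (h t))) :=
    (ENNReal.continuous_ofReal.tendsto _).comp
      ((hdim.2.2.2 t ht).mono_left (nhdsWithin_mono _ Ioi_subset_Ici_self))
  have h1 : ∀ᶠ r in nhdsWithin t (Ioi t), ENNReal.ofReal (h r) ≤ ENNReal.ofReal (h t) + ε :=
    hc.eventually_le_const (ENNReal.lt_add_right ENNReal.ofReal_ne_top hε.ne')
  have h2 : ∀ᶠ r in nhdsWithin t (Ioi t), r ∈ Ioc t b := Ioc_mem_nhdsGT htb
  obtain ⟨r, hr1, hr2⟩ := (h1.and h2).exists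
  exact ⟨r, hr2.1, hr2.2, hr1⟩

/-- A mass distribution principle for a decreasing sequence of compact sets, each carrying a
measure obeying the same growth bound on balls. -/
theorem gaugeMeasure_iInter_pos {X : Type*} [MetricSpace X] [MeasurableSpace X]
    [BorelSpace X] {h : ℝ → ℝ} (hdim : IsDimFun h) (E : ℕ → Set X) (hE : Antitone E)
    (hEc : ∀ n, IsCompact (E n)) (ν : ℕ → Measure X) (hν : ∀ n, ν n (E n)ᶜ = 0)
    {c C : ENNReal} (hc : 0 < c) (hC : C ≠ ⊤) (hmass : ∀ n, c ≤ ν n univ)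
    (hball : ∀ n p r, 0 < r → r ≤ 1 → ν n (Metric.ball p r) ≤ C * ENNReal.ofReal (h r)) :
    0 < gaugeMeasure h (⋂ n, E n) := by
  have hcC : 0 < c / C := ENNReal.div_pos hc.ne' hC
  refine hcC.trans_le ?_
  rw [gaugeMeasure, Measure.mkMetric_apply]
  refine le_iSup₂_of_le (2⁻¹ : ENNReal) (by simp) ?_
  refine le_iInf fun t => le_iInf fun hcov => le_iInf fun hdiam => ?_
  refine ENNReal.div_le_of_le_mul' ?_
  set S : ENNReal := ∑' n, ⨆ _ : (t n).Nonempty, ENNReal.ofReal (h (Metric.ediam (t n)).toReal)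
  have key : ∀ ε : NNReal, 0 < ε → c ≤ C * (S + ε) := by
    intro ε hε
    obtain ⟨ε', hε', hsum⟩ := ENNReal.exists_pos_sum_of_countable'
      (ENNReal.coe_ne_zero.mpr hε.ne') ℕ
    have hU : ∀ n, ∃ U : Set X, IsOpen U ∧ t n ⊆ U ∧ ∀ k, ν k U ≤
        C * ((⨆ _ : (t n).Nonempty, ENNReal.ofReal (h (Metric.ediam (t n)).toReal)) + ε' n) := by
      intro n
      rcases (t n).eq_empty_or_nonempty with he | hne
      · exact ⟨∅, isOpen_empty, he.subset, fun k => by simp⟩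
      · obtain ⟨p, hp⟩ := hne
        have hfin : Metric.ediam (t n) ≠ ⊤ := ne_top_of_le_ne_top (by simp) (hdiam n)
        have hlt : (Metric.ediam (t n)).toReal < 1 := by
          have := ENNReal.toReal_mono (by simp) (hdiam n)
          norm_num at this
          linarith
        obtain ⟨r, hr1, hr2, hr3⟩ := hdim.exists_gt_ofReal_le ENNReal.toReal_nonneg hlt (hε' n)
        refine ⟨Metric.ball p r, Metric.isOpen_ball, fun x hx => ?_, fun k => ?_⟩
        · refine lt_of_le_of_lt ?_ hr1
          rw [dist_edist]
          exact ENNReal.toReal_mono hfin (Metric.edist_le_ediam_of_mem hx hp)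
        · refine (hball k p r (ENNReal.toReal_nonneg.trans_lt hr1) hr2).trans ?_
          rw [iSup_pos ⟨p, hp⟩]
          gcongr
    choose U hUo hUt hUν using hU
    have hcov' : (⋂ n, E n) ⊆ ⋃ n, U n := hcov.trans (iUnion_mono hUt)
    have hopen : IsOpen (⋃ n, U n) := isOpen_iUnion hUo
    obtain ⟨k, hk⟩ := exists_subset_nhds_of_isCompact (hE.directed_ge) hEc
      (U := ⋃ n, U n) (fun x hx => hopen.mem_nhds (hcov' hx))
    calc c ≤ ν k univ := hmass k
      _ ≤ ν k (E k) + ν k (E k)ᶜ := by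
        rw [← union_compl_self (E k)]; exact measure_union_le _ _
      _ = ν k (E k) := by rw [hν, add_zero]
      _ ≤ ν k (⋃ n, U n) := measure_mono hk
      _ ≤ ∑' n, ν k (U n) := measure_iUnion_le _
      _ ≤ ∑' n, C * ((⨆ _ : (t n).Nonempty,
            ENNReal.ofReal (h (Metric.ediam (t n)).toReal)) + ε' n) :=
        ENNReal.tsum_le_tsum fun n => hUν n k
      _ = C * (S + ∑' n, ε' n) := by rw [ENNReal.tsum_mul_left, ENNReal.tsum_add]
      _ ≤ C * (S + ε) := by gcongr
  have hlim : Tendsto (fun ε : NNReal => C * (S + ε)) (nhdsWithin 0 (Ioi 0)) (nhds (C * S)) := by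
    have h0 : Tendsto (fun ε : NNReal => C * (S + (ε : ENNReal))) (nhds 0)
        (nhds (C * (S + (0 : NNReal)))) := by
      refine ENNReal.Tendsto.const_mul ?_ (Or.inr hC)
      exact tendsto_const_nhds.add (ENNReal.tendsto_coe.mpr tendsto_id)
    simpa using h0.mono_left nhdsWithin_le_nhds
  exact ge_of_tendsto hlim (eventually_nhdsWithin_of_forall fun ε hε => key ε hε)

theorem integral_fourier_haar (n : ℤ) :
    ∫ t : UnitAddCircle, fourier n t ∂AddCircle.haarAddCircle = if n = 0 then 1 else 0 := by
  have h := congrFun (fourierCoeff_fourier (T := 1) n) 0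
  simp only [fourierCoeff, neg_zero, fourier_zero, one_smul] at h
  rw [h]
  simp [Pi.single_apply, eq_comm]

/-- Equidistribution of dilated linear forms along a single Fourier mode. -/
theorem tendsto_integral_fourier_comp {V : Type*} [NormedAddCommGroup V] [NormedSpace ℝ V]
    [FiniteDimensional ℝ V] [MeasurableSpace V] [BorelSpace V] (μ : Measure V)
    [μ.IsAddHaarMeasure] (f : V → ℂ) (l : StrongDual ℝ V) (hl : l ≠ 0) (n : ℤ) :
    Tendsto (fun N : ℕ => ∫ y, fourier n ((N * l y : ℝ) : UnitAddCircle) * f y ∂μ) atTop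
      (nhds ((∫ t : UnitAddCircle, fourier n t ∂AddCircle.haarAddCircle) * ∫ y, f y ∂μ)) := by
  rw [integral_fourier_haar]
  split_ifs with hn
  · subst hn
    simp
  · rw [zero_mul]
    have hw : Tendsto (fun N : ℕ => (-(n * N : ℝ)) • l) atTop (cocompact (StrongDual ℝ V)) := by
      rw [← Metric.cobounded_eq_cocompact, ← tendsto_norm_atTop_iff_cobounded]
      have : ∀ N : ℕ, ‖(-(n * N : ℝ)) • l‖ = (N : ℝ) * (|(n : ℝ)| * ‖l‖) := by
        intro N
        rw [norm_smul, Real.norm_eq_abs, abs_neg, abs_mul, Nat.abs_cast]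
        ring
      simp only [this]
      have hpos : 0 < |(n : ℝ)| * ‖l‖ :=
        mul_pos (abs_pos.mpr (Int.cast_ne_zero.mpr hn)) (norm_pos_iff.mpr hl)
      exact tendsto_natCast_atTop_atTop.atTop_mul_const hpos
    refine ((tendsto_integral_exp_smul_cocompact f μ).comp hw).congr fun N => ?_
    refine integral_congr_ae (Eventually.of_forall fun y => ?_)
    simp only [Circle.smul_def, Real.fourierChar_apply, smul_eq_mul, fourier_coe_apply]
    congr 2
    simp
    ring

theorem tendsto_integral_circle_comp_complex {V : Type*} [NormedAddCommGroup V] [NormedSpace ℝ V]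
    [FiniteDimensional ℝ V] [MeasurableSpace V] [BorelSpace V] (μ : Measure V)
    [μ.IsAddHaarMeasure] (f : V → ℂ) (hf : Integrable f μ) (l : StrongDual ℝ V) (hl : l ≠ 0)
    (φ : C(UnitAddCircle, ℂ)) :
    Tendsto (fun N : ℕ => ∫ y, φ ((N * l y : ℝ) : UnitAddCircle) * f y ∂μ) atTop
      (nhds ((∫ t, φ t ∂AddCircle.haarAddCircle) * ∫ y, f y ∂μ)) := by
  have hint : ∀ (χ : C(UnitAddCircle, ℂ)) (N : ℕ),
      Integrable (fun y => χ ((N * l y : ℝ) : UnitAddCircle) * f y) μ := by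
    intro χ N
    refine hf.bdd_mul (c := ‖χ‖) ?_ (Eventually.of_forall fun y => χ.norm_coe_le_norm _)
    refine Continuous.aestronglyMeasurable ?_
    exact χ.continuous.comp ((AddCircle.continuous_mk' 1).comp (by fun_prop))
  have hcirc : ∀ χ : C(UnitAddCircle, ℂ), Integrable χ AddCircle.haarAddCircle := fun χ =>
    χ.continuous.integrable_of_hasCompactSupport (HasCompactSupport.of_compactSpace _)
  have hspan : ∀ χ ∈ Submodule.span ℂ (range (fourier (T := 1))),
      Tendsto (fun N : ℕ => ∫ y, χ ((N * l y : ℝ) : UnitAddCircle) * f y ∂μ) atTop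
      (nhds ((∫ t, χ t ∂AddCircle.haarAddCircle) * ∫ y, f y ∂μ)) := by
    intro χ hχ
    induction hχ using Submodule.span_induction with
    | mem x h =>
      obtain ⟨n, rfl⟩ := h
      exact tendsto_integral_fourier_comp μ f l hl n
    | zero => simp
    | add x y _ _ hx hy =>
      simp only [ContinuousMap.add_apply, add_mul]
      rw [integral_add (hcirc x) (hcirc y), add_mul]
      refine (hx.add hy).congr fun N => ?_
      rw [integral_add (hint x N) (hint y N)]
    | smul a x _ hx =>
      simp only [ContinuousMap.smul_apply, smul_eq_mul, mul_assoc]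
      rw [integral_const_mul, mul_assoc]
      refine (hx.const_mul a).congr fun N => ?_
      rw [integral_const_mul]
  set I := ∫ y, ‖f y‖ ∂μ with hI
  have hI0 : 0 ≤ I := integral_nonneg fun y => norm_nonneg _
  have hb1 : ∀ (χ : C(UnitAddCircle, ℂ)) (N : ℕ),
      ‖∫ y, χ ((N * l y : ℝ) : UnitAddCircle) * f y ∂μ‖ ≤ ‖χ‖ * I := by
    intro χ N
    rw [hI, ← integral_const_mul]
    refine norm_integral_le_of_norm_le (hf.norm.const_mul _) (Eventually.of_forall fun y => ?_)
    rw [norm_mul]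
    gcongr
    exact χ.norm_coe_le_norm _
  have hb2 : ∀ χ : C(UnitAddCircle, ℂ),
      ‖(∫ t, χ t ∂AddCircle.haarAddCircle) * ∫ y, f y ∂μ‖ ≤ ‖χ‖ * I := by
    intro χ
    rw [norm_mul]
    gcongr
    · simpa using norm_integral_le_of_norm_le_const (μ := AddCircle.haarAddCircle)
        (Eventually.of_forall fun t => χ.norm_coe_le_norm t)
    · exact norm_integral_le_integral_norm _
  rw [Metric.tendsto_atTop]
  intro ε hε
  have hφ : φ ∈ closure (Submodule.span ℂ (range (fourier (T := 1))) : Set C(UnitAddCircle, ℂ)) := by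
    rw [← Submodule.topologicalClosure_coe, span_fourier_closure_eq_top]
    trivial
  obtain ⟨χ, hχ, hd⟩ := Metric.mem_closure_iff.mp hφ (ε / (4 * (I + 1))) (by positivity)
  obtain ⟨N₀, hN₀⟩ := Metric.tendsto_atTop.mp (hspan χ hχ) (ε / 4) (by positivity)
  refine ⟨N₀, fun N hN => ?_⟩
  have h3 := hN₀ N hN
  have h1 := hb1 (φ - χ) N
  have h2 := hb2 (φ - χ)
  have hsmall : ‖φ - χ‖ * I ≤ ε / 4 := by
    rw [dist_eq_norm] at hd
    calc ‖φ - χ‖ * I ≤ ε / (4 * (I + 1)) * (I + 1) := by gcongr; linarith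
      _ = ε / 4 := by field_simp
  simp only [ContinuousMap.sub_apply, sub_mul] at h1 h2
  rw [integral_sub (hint φ N) (hint χ N)] at h1
  rw [integral_sub (hcirc φ) (hcirc χ), sub_mul] at h2
  rw [dist_eq_norm] at h3 ⊢
  have htri : ∀ a b c e : ℂ, ‖a - b‖ ≤ ‖a - c‖ + ‖c - e‖ + ‖b - e‖ := by
    intro a b c e
    rw [norm_sub_rev b e]
    exact (norm_sub_le_norm_sub_add_norm_sub a e b).trans
      (add_le_add_left (norm_sub_le_norm_sub_add_norm_sub a c e) _)
  refine (htri _ _ _ _).trans_lt ((add_lt_add_of_lt_of_le (add_lt_add_of_le_of_lt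
    (h1.trans hsmall) h3) (h2.trans hsmall)).trans ?_)
  linarith

/-- Riemann-Lebesgue equidistribution: a periodic observable of a rapidly dilated linear form
averages out against an integrable function. -/
theorem tendsto_integral_circle_comp {V : Type*} [NormedAddCommGroup V] [NormedSpace ℝ V]
    [FiniteDimensional ℝ V] [MeasurableSpace V] [BorelSpace V] (μ : Measure V)
    [μ.IsAddHaarMeasure] (f : V → ℝ) (hf : Integrable f μ) (l : StrongDual ℝ V) (hl : l ≠ 0)
    (φ : C(UnitAddCircle, ℝ)) :
    Tendsto (fun N : ℕ => ∫ y, φ ((N * l y : ℝ) : UnitAddCircle) * f y ∂μ) atTop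
      (nhds ((∫ t, φ t ∂AddCircle.haarAddCircle) * ∫ y, f y ∂μ)) := by
  have h := tendsto_integral_circle_comp_complex μ (fun y => (f y : ℂ)) hf.ofReal l hl
    ⟨fun t => (φ t : ℂ), by fun_prop⟩
  simp only [ContinuousMap.coe_mk, ← Complex.ofReal_mul, integral_complex_ofReal] at h
  exact Complex.continuous_re.continuousAt.tendsto.comp h

/-- A normalised continuous bump on the circle. -/
theorem exists_circle_bump (c : UnitAddCircle) {ε : ℝ} (hε : 0 < ε) :
    ∃ φ : C(UnitAddCircle, ℝ), (∀ t, 0 ≤ φ t) ∧ (∀ t, φ t ≠ 0 → ‖t - c‖ ≤ ε) ∧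
      ∫ t, φ t ∂AddCircle.haarAddCircle = 1 := by
  have hcont : Continuous fun t : UnitAddCircle => max 0 (ε - ‖t - c‖) := by fun_prop
  have hpos : 0 < ∫ t : UnitAddCircle, max 0 (ε - ‖t - c‖) ∂AddCircle.haarAddCircle := by
    refine hcont.integral_pos_of_hasCompactSupport_nonneg_nonzero (x := c)
      (HasCompactSupport.of_compactSpace _) (fun t => le_max_left _ _) ?_
    simp [hε.le, hε.ne']
  refine ⟨⟨fun t => max 0 (ε - ‖t - c‖) / ∫ t : UnitAddCircle, max 0 (ε - ‖t - c‖)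
    ∂AddCircle.haarAddCircle, by fun_prop⟩, fun t => ?_, fun t ht => ?_, ?_⟩
  · exact div_nonneg (le_max_left _ _) hpos.le
  · contrapose! ht
    have : max 0 (ε - ‖t - c‖) = 0 := max_eq_left (by linarith)
    simp [this]
  · simp only [ContinuousMap.coe_mk]
    rw [integral_div, div_self hpos.ne']

section Weight

variable {V : Type*} [NormedAddCommGroup V] [NormedSpace ℝ V] {ι : Type*} [Fintype ι]

/-- The density equal to `φ i (N * l i y)` for `y ∈ Q i`, and to `1` off all the `Q i`. -/
noncomputable def slabWeight (Q : ι → Set V) (l : ι → StrongDual ℝ V)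
    (φ : ι → C(UnitAddCircle, ℝ)) (N : ℕ) (y : V) : ℝ :=
  1 + ∑ i, (Q i).indicator (fun y => φ i ((N * l i y : ℝ) : UnitAddCircle) - 1) y

variable {Q : ι → Set V} {l : ι → StrongDual ℝ V} {φ : ι → C(UnitAddCircle, ℝ)}

theorem slabWeight_of_mem (hQ : Pairwise fun i j => Disjoint (Q i) (Q j)) (N : ℕ) {y : V} {i : ι}
    (hy : y ∈ Q i) : slabWeight Q l φ N y = φ i ((N * l i y : ℝ) : UnitAddCircle) := by
  rw [slabWeight, Finset.sum_eq_single i, indicator_of_mem hy]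
  · ring
  · intro j _ hj
    exact indicator_of_notMem (fun h => disjoint_left.mp (hQ hj) h hy) _
  · simp

theorem slabWeight_of_forall_notMem (N : ℕ) {y : V} (hy : ∀ i, y ∉ Q i) :
    slabWeight Q l φ N y = 1 := by
  rw [slabWeight, Finset.sum_eq_zero fun i _ => indicator_of_notMem (hy i) _, add_zero]

theorem slabWeight_nonneg (hQ : Pairwise fun i j => Disjoint (Q i) (Q j))
    (hφ : ∀ i t, 0 ≤ φ i t) (N : ℕ) (y : V) : 0 ≤ slabWeight Q l φ N y := by
  by_cases hy : ∃ i, y ∈ Q i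
  · obtain ⟨i, hi⟩ := hy
    rw [slabWeight_of_mem hQ N hi]
    exact hφ i _
  · push Not at hy
    rw [slabWeight_of_forall_notMem N hy]
    exact zero_le_one

theorem slabWeight_le (hQ : Pairwise fun i j => Disjoint (Q i) (Q j)) (N : ℕ) (y : V) :
    slabWeight Q l φ N y ≤ 1 + ∑ i, ‖φ i‖ := by
  have h0 : 0 ≤ ∑ i, ‖φ i‖ := Finset.sum_nonneg fun i _ => norm_nonneg _
  by_cases hy : ∃ i, y ∈ Q i
  · obtain ⟨i, hi⟩ := hy
    rw [slabWeight_of_mem hQ N hi]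
    have h1 : ‖φ i‖ ≤ ∑ i, ‖φ i‖ :=
      Finset.single_le_sum (f := fun i => ‖φ i‖) (fun i _ => norm_nonneg _) (Finset.mem_univ i)
    have h2 := (le_abs_self _).trans ((φ i).norm_coe_le_norm ((N * l i y : ℝ) : UnitAddCircle))
    linarith
  · push Not at hy
    rw [slabWeight_of_forall_notMem N hy]
    linarith

variable [MeasurableSpace V] [BorelSpace V]

theorem measurable_slabWeight (hQo : ∀ i, IsOpen (Q i)) (N : ℕ) :
    Measurable (slabWeight Q l φ N) := by
  refine measurable_const.add (Finset.measurable_fun_sum _ fun i _ => ?_)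
  refine Measurable.indicator ?_ (hQo i).measurableSet
  refine Measurable.sub_const (Continuous.measurable ?_) 1
  exact (φ i).continuous.comp ((AddCircle.continuous_mk' 1).comp (by fun_prop))

/-- Multiplying by `slabWeight` hardly changes the integral over a fixed set, once the dilation
is large. -/
theorem tendsto_setIntegral_mul_slabWeight [FiniteDimensional ℝ V] (μ : Measure V)
    [μ.IsAddHaarMeasure] (hQo : ∀ i, IsOpen (Q i))
    (hφ : ∀ i, l i ≠ 0 → ∫ t, φ i t ∂AddCircle.haarAddCircle = 1) (hφ0 : ∀ i, l i = 0 → φ i = 1)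
    {g : V → ℝ} (hg : Integrable g μ) {S : Set V} (hS : MeasurableSet S) :
    Tendsto (fun N : ℕ => ∫ y in S, g y * slabWeight Q l φ N y ∂μ) atTop
      (nhds (∫ y in S, g y ∂μ)) := by
  set f : ι → V → ℝ := fun i => (S ∩ Q i).indicator g
  have hfi : ∀ i, Integrable (f i) μ := fun i => hg.indicator (hS.inter (hQo i).measurableSet)
  have hint : ∀ i (N : ℕ),
      Integrable (fun y => φ i ((N * l i y : ℝ) : UnitAddCircle) * f i y) μ := by
    intro i N
    refine (hfi i).bdd_mul (c := ‖φ i‖) ?_ (Eventually.of_forall fun y => (φ i).norm_coe_le_norm _)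
    refine Continuous.aestronglyMeasurable ?_
    exact (φ i).continuous.comp ((AddCircle.continuous_mk' 1).comp (by fun_prop))
  have hsub : ∀ i (N : ℕ), Integrable
      (fun y => φ i ((N * l i y : ℝ) : UnitAddCircle) * f i y - f i y) μ := fun i N =>
    (hint i N).sub (hfi i)
  have hpt : ∀ N y, S.indicator (fun y => g y * slabWeight Q l φ N y) y =
      S.indicator g y + ∑ i, (φ i ((N * l i y : ℝ) : UnitAddCircle) * f i y - f i y) := by
    intro N y
    by_cases hy : y ∈ S
    · rw [indicator_of_mem hy, indicator_of_mem hy, slabWeight, mul_add, mul_one, Finset.mul_sum]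
      congr 1
      refine Finset.sum_congr rfl fun i _ => ?_
      by_cases hi : y ∈ Q i
      · rw [indicator_of_mem hi, show f i y = g y from indicator_of_mem (show y ∈ S ∩ Q i from ⟨hy, hi⟩) g]
        ring
      · rw [indicator_of_notMem hi,
          show f i y = 0 from indicator_of_notMem (fun h => hi h.2) g]
        ring
    · rw [indicator_of_notMem hy, indicator_of_notMem hy, Finset.sum_eq_zero, add_zero]
      intro i _
      rw [show f i y = 0 from indicator_of_notMem (fun h => hy h.1) g]
      ring
  have heq : ∀ N : ℕ, ∫ y in S, g y * slabWeight Q l φ N y ∂μ = ∫ y in S, g y ∂μ +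
      ∑ i, (∫ y, φ i ((N * l i y : ℝ) : UnitAddCircle) * f i y ∂μ - ∫ y, f i y ∂μ) := by
    intro N
    rw [← integral_indicator hS]
    simp only [hpt]
    rw [integral_add (hg.indicator hS)
      (integrable_finsetSum _ fun i _ => hsub i N), integral_indicator hS,
      integral_finsetSum _ fun i _ => hsub i N]
    congr 1
    exact Finset.sum_congr rfl fun i _ => integral_sub (hint i N) (hfi i)
  simp only [heq]
  have hlim : ∀ i, Tendsto (fun N : ℕ =>
      ∫ y, φ i ((N * l i y : ℝ) : UnitAddCircle) * f i y ∂μ - ∫ y, f i y ∂μ) atTop (nhds 0) := by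
    intro i
    by_cases hi : l i = 0
    · simp [hφ0 i hi]
    · have := (tendsto_integral_circle_comp μ (f i) (hfi i) (l i) hi (φ i)).sub_const
        (∫ y, f i y ∂μ)
      simpa [hφ i hi] using this
  simpa using (tendsto_finsetSum Finset.univ fun i _ => hlim i).const_add (∫ y in S, g y ∂μ)

/-- One step of the construction: given a bounded density `g`, there are a closed set `F` avoiding
one linear pattern between the pairwise disjoint open sets `Q i`, and a new bounded density
supported in `F`, whose mass on each of the prescribed sets `B j z` has hardly increased. -/
theorem exists_density_avoiding [FiniteDimensional ℝ V] (μ : Measure V) [μ.IsAddHaarMeasure]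
    (hQ : Pairwise fun i j => Disjoint (Q i) (Q j)) (hQo : ∀ i, IsOpen (Q i))
    {i₀ : ι} (hl : l i₀ ≠ 0) {κ : Type*} (T : ℕ → Finset κ) (B : ℕ → κ → Set V)
    (hB : ∀ j z, MeasurableSet (B j z)) (H b : ℕ → ℝ) (hH : ∀ j, 0 < H j)
    (hBb : ∀ j z, μ.real (B j z) ≤ b j) (hBf : ∀ j z, μ (B j z) ≠ ⊤)
    (hbH : Tendsto (fun j => b j / H j) atTop (nhds 0))
    {g : V → ℝ} (hg : Integrable g μ) (hg0 : ∀ y, 0 ≤ g y) {M : ℝ} (hgM : ∀ y, g y ≤ M)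
    {ε : ℝ} (hε : 0 < ε) :
    ∃ (F : Set V) (g' : V → ℝ), IsClosed F ∧ Integrable g' μ ∧ (∀ y, 0 ≤ g' y) ∧
      (∃ M', ∀ y, g' y ≤ M') ∧ (∀ y, g' y ≠ 0 → g y ≠ 0 ∧ y ∈ F) ∧
      (∀ x : ι → V, (∀ i, x i ∈ Q i) → (∀ i, x i ∈ F) → ∑ i, l i (x i) ≠ 0) ∧
      (∀ j, ∀ z ∈ T j, ∫ y in B j z, g' y ∂μ ≤ ∫ y in B j z, g y ∂μ + ε * H j) ∧
      ∫ y, g y ∂μ - ε ≤ ∫ y, g' y ∂μ := by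
  classical
  set c : ι → UnitAddCircle := fun i => if i = i₀ then ((1 / 2 : ℝ) : UnitAddCircle) else 0 with hc
  set η : ℝ := 1 / (4 * Fintype.card ι) with hη
  have hcard : (0 : ℝ) < Fintype.card ι := by exact_mod_cast Fintype.card_pos_iff.mpr ⟨i₀⟩
  have hη0 : 0 < η := by positivity
  have hφex : ∀ i, ∃ φ : C(UnitAddCircle, ℝ), (∀ t, 0 ≤ φ t) ∧
      (l i ≠ 0 → ∀ t, φ t ≠ 0 → ‖t - c i‖ ≤ η) ∧
      (l i ≠ 0 → ∫ t, φ t ∂AddCircle.haarAddCircle = 1) ∧ (l i = 0 → φ = 1) := by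
    intro i
    by_cases hi : l i = 0
    · exact ⟨1, fun t => zero_le_one, fun h => absurd hi h, fun h => absurd hi h, fun _ => rfl⟩
    · obtain ⟨φ, h1, h2, h3⟩ := exists_circle_bump (c i) hη0
      exact ⟨φ, h1, fun _ => h2, fun _ => h3, fun h => absurd h hi⟩
  choose φ hφ0 hφs hφ1 hφt using hφex
  set D : ℝ := 1 + ∑ i, ‖φ i‖ with hD
  have hM0 : 0 ≤ M := (hg0 0).trans (hgM 0)
  have hD0 : 0 ≤ D := add_nonneg zero_le_one (Finset.sum_nonneg fun i _ => norm_nonneg _)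
  have hwM : ∀ N y, g y * slabWeight Q l φ N y ≤ M * D := fun N y =>
    mul_le_mul (hgM y) (slabWeight_le hQ N y) (slabWeight_nonneg hQ hφ0 N y) hM0
  have hw0 : ∀ N y, 0 ≤ g y * slabWeight Q l φ N y := fun N y =>
    mul_nonneg (hg0 y) (slabWeight_nonneg hQ hφ0 N y)
  have hwi : ∀ N, Integrable (fun y => g y * slabWeight Q l φ N y) μ := by
    intro N
    refine hg.mul_bdd (c := D) (measurable_slabWeight hQo N).aestronglyMeasurable
      (Eventually.of_forall fun y => ?_)
    rw [Real.norm_of_nonneg (slabWeight_nonneg hQ hφ0 N y)]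
    exact slabWeight_le hQ N y
  have htail : ∀ᶠ j in atTop, M * D * b j ≤ ε * H j := by
    have h0 := hbH.const_mul (M * D)
    rw [mul_zero] at h0
    filter_upwards [h0.eventually_le_const hε] with j hj
    rwa [← mul_div_assoc, div_le_iff₀ (hH j)] at hj
  obtain ⟨J, hJ⟩ := eventually_atTop.mp htail
  have hconv := fun (S : Set V) (hS : MeasurableSet S) =>
    tendsto_setIntegral_mul_slabWeight μ hQo hφ1 hφt hg hS
  have hev1 : ∀ᶠ N in atTop, ∀ j ∈ Finset.range J, ∀ z ∈ T j,
      ∫ y in B j z, g y * slabWeight Q l φ N y ∂μ ≤ ∫ y in B j z, g y ∂μ + ε * H j := by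
    rw [Filter.eventually_all_finset]
    intro j _
    rw [Filter.eventually_all_finset]
    intro z _
    exact (hconv _ (hB j z)).eventually_le_const (lt_add_of_pos_right _ (mul_pos hε (hH j)))
  have hev2 : ∀ᶠ N in atTop, ∫ y, g y ∂μ - ε ≤ ∫ y, g y * slabWeight Q l φ N y ∂μ := by
    have := hconv univ MeasurableSet.univ
    simp only [setIntegral_univ] at this
    exact this.eventually_const_le (sub_lt_self _ hε)
  obtain ⟨N, hN1, hN2⟩ := (hev1.and hev2).exists
  refine ⟨⋂ i, (Q i)ᶜ ∪ {y | ‖((N * l i y : ℝ) : UnitAddCircle) - c i‖ ≤ η},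
    fun y => g y * slabWeight Q l φ N y, ?_, hwi N, hw0 N, ⟨M * D, hwM N⟩, ?_, ?_, ?_, hN2⟩
  · refine isClosed_iInter fun i => (hQo i).isClosed_compl.union (isClosed_le ?_ continuous_const)
    have hcont : Continuous fun y : V => ((N * l i y : ℝ) : UnitAddCircle) :=
      (AddCircle.continuous_mk' 1).comp (by fun_prop)
    exact (hcont.sub continuous_const).norm
  · intro y hy
    refine ⟨left_ne_zero_of_mul hy, mem_iInter.mpr fun i => ?_⟩
    by_cases hi : y ∈ Q i
    · right
      have hy' := right_ne_zero_of_mul hy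
      rw [slabWeight_of_mem hQ N hi] at hy'
      by_cases hli : l i = 0
      · have hne : i ≠ i₀ := fun h => hl (h ▸ hli)
        simp [hli, hc, hne, hη0.le]
      · exact hφs i hli _ hy'
    · exact Or.inl hi
  · intro x hxQ hxF hsum
    have hclose : ∀ i, ‖((N * l i (x i) : ℝ) : UnitAddCircle) - c i‖ ≤ η := by
      intro i
      exact (mem_iInter.mp (hxF i) i).resolve_left fun h => h (hxQ i)
    have hs1 : ∑ i, ((N * l i (x i) : ℝ) : UnitAddCircle) = 0 := by
      have h1 : ((∑ i, (N * l i (x i) : ℝ) : ℝ) : UnitAddCircle) =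
          ∑ i, ((N * l i (x i) : ℝ) : UnitAddCircle) :=
        map_sum (QuotientAddGroup.mk' (AddSubgroup.zmultiples (1 : ℝ))) _ _
      rw [← h1, ← Finset.mul_sum, hsum, mul_zero, AddCircle.coe_zero]
    have hs2 : ∑ i, c i = ((1 / 2 : ℝ) : UnitAddCircle) := by simp [hc]
    have h3 : ‖∑ i, (((N * l i (x i) : ℝ) : UnitAddCircle) - c i)‖ ≤ ∑ _i : ι, η :=
      norm_sum_le_of_le _ fun i _ => hclose i
    rw [Finset.sum_sub_distrib, hs1, hs2, zero_sub, norm_neg, AddCircle.norm_half_period_eq,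
      Finset.sum_const, Finset.card_univ, nsmul_eq_mul, hη] at h3
    have h4 : (Fintype.card ι : ℝ) * (1 / (4 * Fintype.card ι)) = 1 / 4 := by field_simp
    rw [h4] at h3
    norm_num at h3
  · intro j z hz
    rcases lt_or_ge j J with hj | hj
    · exact hN1 j (Finset.mem_range.mpr hj) z hz
    · have h1 : ∫ y in B j z, g y * slabWeight Q l φ N y ∂μ ≤ ∫ y in B j z, M * D ∂μ :=
        integral_mono (hwi N).integrableOn (integrableOn_const (hBf j z)) (hwM N)
      rw [setIntegral_const, smul_eq_mul] at h1
      have h2 : μ.real (B j z) * (M * D) ≤ M * D * b j := by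
        rw [mul_comm]
        exact mul_le_mul_of_nonneg_left (hBb j z) (mul_nonneg hM0 hD0)
      have h3 : 0 ≤ ∫ y in B j z, g y ∂μ := integral_nonneg hg0
      linarith [hJ j hj]

end Weight

/-- Iterating density refinements: if every bounded density can be refined, at arbitrarily small
cost, so as to live on a closed set with any of countably many properties, then there is a
compact set of positive gauge measure contained in a closed set with each of these properties. -/
theorem exists_isCompact_gaugeMeasure_pos {V : Type*} [NormedAddCommGroup V] [NormedSpace ℝ V]
    [FiniteDimensional ℝ V] [MeasurableSpace V] [BorelSpace V] (μ : Measure V)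
    [μ.IsAddHaarMeasure] {h : ℝ → ℝ} (hdim : IsDimFun h)
    (hprec : Prec h (fun x : ℝ => x ^ Module.finrank ℝ V)) (A : ℕ → Set V → Prop)
    (hA : ∀ (n : ℕ) (T : ℕ → Finset V) (B : ℕ → V → Set V), (∀ j z, MeasurableSet (B j z)) →
      ∀ H b : ℕ → ℝ, (∀ j, 0 < H j) → (∀ j z, μ.real (B j z) ≤ b j) → (∀ j z, μ (B j z) ≠ ⊤) →
      Tendsto (fun j => b j / H j) atTop (nhds 0) →
      ∀ g : V → ℝ, Integrable g μ → (∀ y, 0 ≤ g y) → (∃ M, ∀ y, g y ≤ M) → ∀ ε : ℝ, 0 < ε →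
      ∃ (F : Set V) (g' : V → ℝ), IsClosed F ∧ Integrable g' μ ∧ (∀ y, 0 ≤ g' y) ∧
        (∃ M', ∀ y, g' y ≤ M') ∧ (∀ y, g' y ≠ 0 → g y ≠ 0 ∧ y ∈ F) ∧ A n F ∧
        (∀ j, ∀ z ∈ T j, ∫ y in B j z, g' y ∂μ ≤ ∫ y in B j z, g y ∂μ + ε * H j) ∧
        ∫ y, g y ∂μ - ε ≤ ∫ y, g' y ∂μ) :
    ∃ E : Set V, IsCompact E ∧ 0 < gaugeMeasure h E ∧ ∀ n, ∃ F, A n F ∧ E ⊆ F := by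
  classical
  have hproper : ProperSpace V := FiniteDimensional.proper ℝ V
  set K : Set V := Metric.closedBall 0 1
  have hK : IsCompact K := isCompact_closedBall 0 1
  have hhalf : ∀ j : ℕ, (0 : ℝ) < (1 / 2) ^ j := fun j => by positivity
  have hnet : ∀ j : ℕ, ∃ T : Finset V, K ⊆ ⋃ z ∈ T, Metric.ball z ((1 / 2 : ℝ) ^ j) := by
    intro j
    obtain ⟨T, -, hT, hKT⟩ := hK.finite_cover_balls (hhalf j)
    exact ⟨hT.toFinset, by simpa using hKT⟩
  choose T hT using hnet
  set B : ℕ → V → Set V := fun j z => Metric.closedBall z (3 * (1 / 2 : ℝ) ^ j) with hBdef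
  set H : ℕ → ℝ := fun j => h ((1 / 2 : ℝ) ^ (j + 1)) with hHdef
  set v : ℝ := μ.real (Metric.ball 0 1) with hv
  set b : ℕ → ℝ := fun j => (3 * (1 / 2 : ℝ) ^ j) ^ Module.finrank ℝ V * v with hbdef
  have hB : ∀ j z, MeasurableSet (B j z) := fun j z => measurableSet_closedBall
  have hH : ∀ j, 0 < H j := fun j => hdim.2.1 _ (hhalf _)
  have hBf : ∀ j z, μ (B j z) ≠ ⊤ := fun j z => (isCompact_closedBall _ _).measure_ne_top
  have hBb : ∀ j z, μ.real (B j z) ≤ b j := by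
    intro j z
    have h3 : 0 ≤ 3 * (1 / 2 : ℝ) ^ j := by positivity
    rw [hBdef, measureReal_def, Measure.addHaar_closedBall μ z h3, ENNReal.toReal_mul,
      ENNReal.toReal_ofReal (by positivity)]
    rfl
  have hbH : Tendsto (fun j => b j / H j) atTop (nhds 0) := by
    have h1 : Tendsto (fun j : ℕ => (1 / 2 : ℝ) ^ (j + 1)) atTop (nhdsWithin 0 (Ioi 0)) := by
      refine tendsto_nhdsWithin_iff.mpr ⟨?_, Eventually.of_forall fun j => hhalf (j + 1)⟩
      exact (tendsto_pow_atTop_nhds_zero_of_lt_one (by norm_num) (by norm_num)).comp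
        (tendsto_add_atTop_nat 1)
    have h2 := (hprec.comp h1).const_mul (6 ^ Module.finrank ℝ V * v)
    rw [mul_zero] at h2
    refine h2.congr fun j => ?_
    have h3 : (3 * (1 / 2 : ℝ) ^ j) = 6 * (1 / 2 : ℝ) ^ (j + 1) := by ring
    simp only [Function.comp_apply, hbdef, hHdef]
    rw [h3, mul_pow]
    ring
  set c : ℝ := μ.real K with hc
  have hc0 : 0 < c := ENNReal.toReal_pos (Metric.measure_closedBall_pos μ 0 one_pos).ne'
    hK.measure_ne_top
  set ε : ℕ → ℝ := fun n => c / 4 * (1 / 2) ^ n with hεdef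
  have hε : ∀ n, 0 < ε n := fun n => mul_pos (by positivity) (hhalf n)
  have hεsum : ∀ n, ∑ i ∈ Finset.range n, ε i ≤ c / 2 := by
    intro n
    have h1 := sum_geometric_two_le n
    rw [hεdef, ← Finset.mul_sum]
    nlinarith
  obtain ⟨C₀, hC₀⟩ := hbH.bddAbove_range
  have hbC : ∀ j, b j ≤ C₀ * H j := fun j =>
    (div_le_iff₀ (hH j)).mp (hC₀ (mem_range_self j))
  let P : (V → ℝ) → Prop := fun g => Integrable g μ ∧ (∀ y, 0 ≤ g y) ∧ ∃ M, ∀ y, g y ≤ M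
  have hstep : ∀ (n : ℕ) (g : {g // P g}), ∃ (F : Set V) (g' : {g // P g}), IsClosed F ∧
      (∀ y, g'.1 y ≠ 0 → g.1 y ≠ 0 ∧ y ∈ F) ∧ A n F ∧
      (∀ j, ∀ z ∈ T j, ∫ y in B j z, g'.1 y ∂μ ≤ ∫ y in B j z, g.1 y ∂μ + ε n * H j) ∧
      ∫ y, g.1 y ∂μ - ε n ≤ ∫ y, g'.1 y ∂μ := by
    rintro n ⟨g, hg1, hg2, hg3⟩
    obtain ⟨F, g', h1, h2, h3, h4, h5⟩ :=
      hA n T B hB H b hH hBb hBf hbH g hg1 hg2 hg3 (ε n) (hε n)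
    exact ⟨F, ⟨g', h2, h3, h4⟩, h1, h5⟩
  choose F next hFc hsupp hFA hball hmass using hstep
  have hg₀ : P (K.indicator 1) :=
    ⟨(integrable_indicator_iff hK.measurableSet).mpr
      (integrableOn_const (C := (1 : ℝ)) hK.measure_ne_top),
      fun y => indicator_nonneg (fun _ _ => zero_le_one) y,
      1, fun y => indicator_le_self' (fun _ _ => zero_le_one) y⟩
  let G : ℕ → {g // P g} := fun n => Nat.rec ⟨_, hg₀⟩ next n
  set E : ℕ → Set V := fun n => K ∩ ⋂ i ∈ Finset.range n, F i (G i) with hE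
  have hGE : ∀ n y, (G n).1 y ≠ 0 → y ∈ E n := by
    intro n
    induction n with
    | zero =>
      intro y hy
      simpa [hE] using mem_of_indicator_ne_zero (s := K) (f := (1 : V → ℝ)) hy
    | succ n ih =>
      intro y hy
      obtain ⟨h1, h2⟩ := hsupp n (G n) y hy
      obtain ⟨h3, h4⟩ := ih y h1
      refine ⟨h3, ?_⟩
      simp only [Finset.mem_range, mem_iInter] at h4 ⊢
      intro i hi
      rcases Nat.lt_succ_iff_lt_or_eq.mp hi with hi | rfl
      · exact h4 i hi
      · exact h2
  have hGball : ∀ n j, ∀ z ∈ T j,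
      ∫ y in B j z, (G n).1 y ∂μ ≤ b j + (∑ i ∈ Finset.range n, ε i) * H j := by
    intro n j z hz
    induction n with
    | zero =>
      have h1 : ∫ y in B j z, K.indicator 1 y ∂μ ≤ ∫ y in B j z, (1 : ℝ) ∂μ :=
        integral_mono hg₀.1.integrableOn (integrableOn_const (hBf j z))
          fun y => indicator_le_self' (fun _ _ => zero_le_one) y
      rw [setIntegral_const, smul_eq_mul, mul_one] at h1
      rw [Finset.sum_range_zero, zero_mul, add_zero]
      exact h1.trans (hBb j z)
    | succ n ih =>
      rw [Finset.sum_range_succ]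
      have := hball n (G n) j z hz
      change ∫ y in B j z, (next n (G n)).1 y ∂μ ≤ _
      linarith
  have hGmass : ∀ n, c - ∑ i ∈ Finset.range n, ε i ≤ ∫ y, (G n).1 y ∂μ := by
    intro n
    induction n with
    | zero =>
      change _ ≤ ∫ y, K.indicator 1 y ∂μ
      rw [integral_indicator_one hK.measurableSet]
      simp [hc]
    | succ n ih =>
      rw [Finset.sum_range_succ]
      have := hmass n (G n)
      change _ ≤ ∫ y, (next n (G n)).1 y ∂μ
      linarith
  set ν : ℕ → Measure V := fun n => μ.withDensity fun y => ENNReal.ofReal ((G n).1 y) with hν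
  have hνapply : ∀ n S, MeasurableSet S → ν n S = ENNReal.ofReal (∫ y in S, (G n).1 y ∂μ) := by
    intro n S hS
    rw [hν, withDensity_apply _ hS, ofReal_integral_eq_lintegral_ofReal
      (G n).2.1.integrableOn (Eventually.of_forall (G n).2.2.1)]
  have hEclosed : ∀ n, IsClosed (⋂ i ∈ Finset.range n, F i (G i)) := fun n =>
    isClosed_biInter fun i _ => hFc i (G i)
  have hEc : ∀ n, IsCompact (E n) := fun n => hK.inter_right (hEclosed n)
  have hEanti : Antitone E := fun a a' haa =>
    inter_subset_inter_right _ (biInter_subset_biInter_left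
      (Finset.coe_subset.mpr (Finset.range_mono haa)))
  have hνE : ∀ n, ν n (E n)ᶜ = 0 := by
    intro n
    rw [hνapply n _ (hEc n).measurableSet.compl, setIntegral_eq_zero_of_forall_eq_zero,
      ENNReal.ofReal_zero]
    intro y hy
    by_contra h0
    exact hy (hGE n y h0)
  refine ⟨⋂ n, E n, (hEc 0).of_isClosed_subset (isClosed_iInter fun n => (hEc n).isClosed)
    (iInter_subset E 0), ?_, fun n => ⟨F n (G n), hFA n (G n), ?_⟩⟩
  · refine gaugeMeasure_iInter_pos hdim E hEanti hEc ν hνE (c := ENNReal.ofReal (c / 2))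
      (C := ENNReal.ofReal (C₀ + c / 2)) (by simpa using hc0) ENNReal.ofReal_ne_top ?_ ?_
    · intro n
      rw [hνapply n univ MeasurableSet.univ, setIntegral_univ]
      exact ENNReal.ofReal_le_ofReal (by linarith [hGmass n, hεsum n])
    · intro n p r hr0 hr1
      by_cases hdisj : ∃ q ∈ K, q ∈ Metric.ball p r
      · obtain ⟨q, hqK, hqp⟩ := hdisj
        obtain ⟨j, hj1, hj2⟩ := exists_nat_pow_near_of_lt_one hr0 hr1
          (by norm_num : (0 : ℝ) < 1 / 2) (by norm_num)
        obtain ⟨z, hz, hqz⟩ := mem_iUnion₂.mp (hT j hqK)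
        have hsub : Metric.ball p r ⊆ B j z := by
          intro x hx
          rw [hBdef, Metric.mem_closedBall]
          rw [Metric.mem_ball] at hx hqp hqz
          have h1 := dist_triangle4 x p q z
          rw [dist_comm p q] at h1
          linarith
        have hHr : H j ≤ h r := hdim.2.2.1 (hhalf _).le hr0.le hj1.le
        have hC : 0 ≤ C₀ + c / 2 := by
          have h1 : 0 ≤ C₀ * H j := measureReal_nonneg.trans ((hBb j z).trans (hbC j))
          have h2 : 0 ≤ C₀ := nonneg_of_mul_nonneg_left h1 (hH j)
          positivity
        calc ν n (Metric.ball p r) ≤ ν n (B j z) := measure_mono hsub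
          _ = ENNReal.ofReal (∫ y in B j z, (G n).1 y ∂μ) := hνapply n _ (hB j z)
          _ ≤ ENNReal.ofReal ((C₀ + c / 2) * h r) := by
            refine ENNReal.ofReal_le_ofReal ((hGball n j z hz).trans ?_)
            calc b j + (∑ i ∈ Finset.range n, ε i) * H j ≤ C₀ * H j + c / 2 * H j :=
                  add_le_add (hbC j) (mul_le_mul_of_nonneg_right (hεsum n) (hH j).le)
              _ = (C₀ + c / 2) * H j := by ring
              _ ≤ (C₀ + c / 2) * h r := mul_le_mul_of_nonneg_left hHr hC
          _ = ENNReal.ofReal (C₀ + c / 2) * ENNReal.ofReal (h r) := ENNReal.ofReal_mul hC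
      · push Not at hdisj
        have hsub : Metric.ball p r ⊆ (E n)ᶜ := fun x hx hxE => hdisj x hxE.1 hx
        rw [measure_mono_null hsub (hνE n)]
        exact zero_le
  · intro y hy
    have := (mem_iInter.mp hy (n + 1)).2
    simp only [Finset.mem_range, mem_iInter] at this
    exact this n (Nat.lt_succ_self n)

/-- Distinct points have pairwise disjoint neighbourhoods in the countable basis. -/
theorem exists_countableBasis_disjoint {X : Type*} [TopologicalSpace X] [T2Space X]
    [SecondCountableTopology X] {ι : Type*} [Finite ι] {x : ι → X} (hx : Function.Injective x) :
    ∃ Q : ι → TopologicalSpace.countableBasis X, (∀ i, x i ∈ (Q i : Set X)) ∧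
      Pairwise fun i j => Disjoint (Q i : Set X) (Q j) := by
  obtain ⟨U, hU, hUd⟩ := (finite_range x).t2_separation
  have hQ : ∀ i, ∃ Q ∈ TopologicalSpace.countableBasis X, x i ∈ Q ∧ Q ⊆ U (x i) := fun i =>
    (TopologicalSpace.isBasis_countableBasis X).exists_subset_of_mem_open (hU _).1 (hU _).2
  choose Q hQb hxQ hQU using hQ
  exact ⟨fun i => ⟨Q i, hQb i⟩, hxQ, fun i j hij =>
    (hUd (mem_range_self i) (mem_range_self j) (hx.ne hij)).mono (hQU i) (hQU j)⟩

/-- The components of a linear form on a finite power. -/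
noncomputable def componentForm {V : Type*} [NormedAddCommGroup V] [NormedSpace ℝ V]
    [FiniteDimensional ℝ V] {m : ℕ} (ψ : (Fin m → V) →ₗ[ℝ] ℝ) (i : Fin m) : StrongDual ℝ V :=
  LinearMap.toContinuousLinearMap (ψ ∘ₗ LinearMap.single ℝ (fun _ => V) i)

theorem sum_componentForm {V : Type*} [NormedAddCommGroup V] [NormedSpace ℝ V]
    [FiniteDimensional ℝ V] {m : ℕ} (ψ : (Fin m → V) →ₗ[ℝ] ℝ) (x : Fin m → V) :
    ∑ i, componentForm ψ i (x i) = ψ x := by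
  conv_rhs => rw [← Finset.univ_sum_single x, map_sum]
  rfl

theorem exists_componentForm_ne_zero {V : Type*} [NormedAddCommGroup V] [NormedSpace ℝ V]
    [FiniteDimensional ℝ V] {m : ℕ} {ψ : (Fin m → V) →ₗ[ℝ] ℝ} (hψ : ψ ≠ 0) :
    ∃ i, componentForm ψ i ≠ 0 := by
  by_contra! h
  refine hψ (LinearMap.ext fun x => ?_)
  rw [← sum_componentForm]
  simp [h]

/-- Main theorem: large sets avoiding countably many linear patterns. -/
theorem stmt_5 (d : ℕ) (hd : 0 < d) (h : ℝ → ℝ) (hdim : IsDimFun h)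
    (hprec : Prec h (fun x : ℝ => x ^ d))
    (m : ℕ → ℕ) (hm : ∀ k, 2 ≤ m k)
    (ψ : ∀ k, ((Fin (m k) → EuclideanSpace ℝ (Fin d)) →ₗ[ℝ] ℝ))
    (hψ : ∀ k, ψ k ≠ 0) :
    ∃ E : Set (EuclideanSpace ℝ (Fin d)), IsCompact E ∧ 0 < gaugeMeasure h E ∧
      ∀ k, ∀ x : Fin (m k) → EuclideanSpace ℝ (Fin d),
        (∀ i, x i ∈ E) → Function.Injective x → ψ k x ≠ 0 := by
  let V := EuclideanSpace ℝ (Fin d)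
  let τ := Σ k, Fin (m k) → TopologicalSpace.countableBasis V
  have : Countable (TopologicalSpace.countableBasis V) :=
    (TopologicalSpace.countable_countableBasis V).to_subtype
  have : Nonempty τ := by
    obtain ⟨U, hU, -⟩ := (TopologicalSpace.isBasis_countableBasis V).exists_subset_of_mem_open
      (mem_univ (0 : V)) isOpen_univ
    exact ⟨⟨0, fun _ => ⟨U, hU⟩⟩⟩
  obtain ⟨task, htask⟩ := exists_surjective_nat τ
  let A : ℕ → Set V → Prop := fun n F =>
    (Pairwise fun i j => Disjoint ((task n).2 i : Set V) ((task n).2 j)) →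
      ∀ x : Fin (m (task n).1) → V, (∀ i, x i ∈ ((task n).2 i : Set V)) → (∀ i, x i ∈ F) →
        ψ (task n).1 x ≠ 0
  have hprec' : Prec h (fun x : ℝ => x ^ Module.finrank ℝ V) := by
    rwa [finrank_euclideanSpace_fin]
  obtain ⟨E, hEc, hEpos, hE⟩ := exists_isCompact_gaugeMeasure_pos (volume : Measure V) hdim
    hprec' A (by
      intro n T B hB H b hH hBb hBf hbH g hg hg0 hgM ε hε
      by_cases hQ : Pairwise fun i j => Disjoint ((task n).2 i : Set V) ((task n).2 j)
      · obtain ⟨i₀, hi₀⟩ := exists_componentForm_ne_zero (hψ (task n).1)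
        obtain ⟨M, hM⟩ := hgM
        obtain ⟨F, g', h1, h2, h3, h4, h5, h6, h7⟩ := exists_density_avoiding volume hQ
          (fun i => TopologicalSpace.isOpen_of_mem_countableBasis ((task n).2 i).2) hi₀ T B hB
          H b hH hBb hBf hbH hg hg0 hM hε
        refine ⟨F, g', h1, h2, h3, h4, h5, fun _ x hxQ hxF => ?_, h7⟩
        rw [← sum_componentForm]
        exact h6 x hxQ hxF
      · refine ⟨univ, g, isClosed_univ, hg, hg0, hgM, fun y hy => ⟨hy, mem_univ y⟩,
          fun h => absurd h hQ, fun j z _ => ?_, by linarith⟩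
        have := mul_pos hε (hH j)
        linarith)
  refine ⟨E, hEc, hEpos, fun k x hxE hx => ?_⟩
  obtain ⟨Q, hxQ, hQ⟩ := exists_countableBasis_disjoint hx
  obtain ⟨n, hn⟩ := htask ⟨k, Q⟩
  obtain ⟨F, hF, hEF⟩ := hE n
  have hF' : ∀ t : τ, t = ⟨k, Q⟩ → ((Pairwise fun i j => Disjoint (t.2 i : Set V) (t.2 j)) →
      ∀ x : Fin (m t.1) → V, (∀ i, x i ∈ (t.2 i : Set V)) → (∀ i, x i ∈ F) → ψ t.1 x ≠ 0) →
      ψ k x ≠ 0 := by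
    rintro t rfl ht
    exact ht hQ x hxQ fun i => hEF (hxE i)
  exact hF' _ hn hF
end

section
/- For every d ∈ ℕ there exists a compact set E ⊆ ℝ^d of Hausdorff dimension d that does not contain any nontrivial solution of any of countably many given non-zero linear equations; more precisely, given non-zero linear maps ψ_k : (ℝ^d)^{m_k} → ℝ with m_k ≥ 2, there is a compact E ⊆ ℝ^d with dim_H E = d and ψ_k(x₁,…,x_{m_k}) ≠ 0 for all k and all distinct x₁,…,x_{m_k} ∈ E. -/
open MeasureTheory Filter Set

open scoped Topology

section WeakLimit

variable {V : Type*} [NormedAddCommGroup V] [NormedSpace ℝ V] [FiniteDimensional ℝ V]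
  [MeasurableSpace V] [BorelSpace V] (μ : Measure V) [μ.IsAddHaarMeasure]

/-- Translation is continuous in `L¹`. -/
theorem tendsto_integral_abs_translate_sub {g : V → ℝ} (hg : Integrable g μ) :
    Tendsto (fun v => ∫ x, |g (x + v) - g x| ∂μ) (𝓝 0) (𝓝 0) := by
  have hmem : MemLp g 1 μ := memLp_one_iff_integrable.2 hg
  let T : C(V, C(V, V)) := (ContinuousMap.mk (fun a : V × V => a.2 + a.1) (by fun_prop)).curry
  have hT : ∀ v, MeasurePreserving (T v) μ μ := fun v => measurePreserving_add_right μ v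
  have h1 : Continuous fun v => Lp.compMeasurePreserving (T v) (hT v) (hmem.toLp g) :=
    continuous_const.compMeasurePreservingLp T.continuous hT ENNReal.one_ne_top
  have h2 : Tendsto (fun v => ‖Lp.compMeasurePreserving (T v) (hT v) (hmem.toLp g)
      - hmem.toLp g‖) (𝓝 0) (𝓝 0) := by
    have h3 := ((h1.sub continuous_const).norm (E := Lp ℝ 1 μ)).tendsto (0 : V)
      (f := fun v => ‖Lp.compMeasurePreserving (T v) (hT v) (hmem.toLp g) - hmem.toLp g‖)
    have h4 : Lp.compMeasurePreserving (T 0) (hT 0) (hmem.toLp g) = hmem.toLp g := by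
      rw [Lp.toLp_compMeasurePreserving]
      congr 1
      ext x
      simp [T]
    simpa [h4] using h3
  refine h2.congr fun v => ?_
  rw [Lp.toLp_compMeasurePreserving, ← MemLp.toLp_sub, L1.norm_eq_integral_norm]
  refine integral_congr_ae ?_
  filter_upwards [MemLp.coeFn_toLp ((hmem.comp_measurePreserving (hT v)).sub hmem)] with x hx
  rw [hx]
  simp [T, Real.norm_eq_abs]

/-- Rapidly oscillating weights with constant average along an arithmetic progression converge
weakly to `1`. -/
theorem tendsto_integral_mul_comp_smul {g : V → ℝ} (hg : Integrable g μ) {c : V →L[ℝ] ℝ}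
    (hc : c ≠ 0) {q : ℕ} (hq : 0 < q) {w : ℝ → ℝ} (hw : Measurable w) {M : ℝ}
    (hM : ∀ u, |w u| ≤ M) (hsum : ∀ u, ∑ p ∈ Finset.range q, w (u + p / q) = q) :
    Tendsto (fun N : ℕ => ∫ x, g x * w (N * c x) ∂μ) atTop (𝓝 (∫ x, g x ∂μ)) := by
  obtain ⟨e, he⟩ : ∃ e, c e = 1 := by
    obtain ⟨y, hy⟩ : ∃ y, c y ≠ 0 := by
      by_contra! h
      exact hc (ContinuousLinearMap.ext h)
    exact ⟨(c y)⁻¹ • y, by simp [hy]⟩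
  have hq' : (q : ℝ) ≠ 0 := by positivity
  have hint : ∀ {f : V → ℝ}, Integrable f μ → ∀ (N a : ℝ),
      Integrable (fun x => f x * w (N * c x + a)) μ := by
    intro f hf N a
    refine hf.mul_bdd (c := M) ?_ ?_
    · exact (hw.comp (by fun_prop)).aestronglyMeasurable
    · exact Eventually.of_forall fun x => by simpa using hM _
  let v : ℕ → ℕ → V := fun p N => ((p : ℝ) / q / N) • e
  have hv : ∀ p, Tendsto (v p) atTop (𝓝 0) := by
    intro p
    have : Tendsto (fun N : ℕ => (p : ℝ) / q / N) atTop (𝓝 0) :=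
      tendsto_const_div_atTop_nhds_zero_nat _
    simpa using this.smul_const e
  have hbound : ∀ᶠ N : ℕ in atTop, |(∫ x, g x * w (N * c x) ∂μ) - ∫ x, g x ∂μ| ≤
      (q : ℝ)⁻¹ * ∑ p ∈ Finset.range q, M * ∫ x, |g (x + v p N) - g x| ∂μ := by
    filter_upwards [eventually_gt_atTop 0] with N hN
    have hN' : (N : ℝ) ≠ 0 := by positivity
    have hshift : ∀ p : ℕ, ∫ x, g x * w (N * c x) ∂μ =
        ∫ x, g (x + v p N) * w (N * c x + p / q) ∂μ := by
      intro p
      rw [← integral_add_right_eq_self (μ := μ) (fun x => g x * w (N * c x)) (v p N)]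
      congr 1
      ext x
      congr 2
      simp only [map_add, v, map_smul, he, smul_eq_mul]
      field_simp
    have hone : ∫ x, g x ∂μ =
        (q : ℝ)⁻¹ * ∑ p ∈ Finset.range q, ∫ x, g x * w (N * c x + p / q) ∂μ := by
      rw [← integral_finsetSum _ fun p _ => hint hg _ _, ← integral_const_mul]
      congr 1
      ext x
      rw [← Finset.mul_sum, hsum]
      field_simp
    have hgv : ∀ p, Integrable (fun x => g (x + v p N)) μ := fun p => hg.comp_add_right _
    have heq : (∫ x, g x * w (N * c x) ∂μ) - ∫ x, g x ∂μ = (q : ℝ)⁻¹ * ∑ p ∈ Finset.range q,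
        ∫ x, (g (x + v p N) - g x) * w (N * c x + p / q) ∂μ := by
      have h1 : ∫ x, g x * w (N * c x) ∂μ = (q : ℝ)⁻¹ * ∑ p ∈ Finset.range q,
          ∫ x, g (x + v p N) * w (N * c x + p / q) ∂μ := by
        rw [Finset.sum_congr rfl fun p _ => (hshift p).symm]
        simp [hq']
      rw [h1, hone, ← mul_sub, ← Finset.sum_sub_distrib]
      congr 1
      refine Finset.sum_congr rfl fun p _ => ?_
      rw [← integral_sub (hint (hgv p) _ _) (hint hg _ _)]
      simp only [sub_mul]
    rw [heq, abs_mul, abs_of_nonneg (by positivity)]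
    gcongr
    refine (Finset.abs_sum_le_sum_abs _ _).trans (Finset.sum_le_sum fun p _ => ?_)
    rw [← integral_const_mul]
    refine (abs_integral_le_integral_abs).trans ?_
    refine integral_mono (hint ((hgv p).sub hg) _ _).abs (((hgv p).sub hg).abs.const_mul _) ?_
    intro x
    simp only [abs_mul]
    rw [mul_comm]
    exact mul_le_mul_of_nonneg_right (hM _) (abs_nonneg _)
  have hlim : Tendsto (fun N => (q : ℝ)⁻¹ * ∑ p ∈ Finset.range q,
      M * ∫ x, |g (x + v p N) - g x| ∂μ) atTop (𝓝 0) := by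
    have : Tendsto (fun N => (q : ℝ)⁻¹ * ∑ p ∈ Finset.range q,
        M * ∫ x, |g (x + v p N) - g x| ∂μ) atTop
        (𝓝 ((q : ℝ)⁻¹ * ∑ p ∈ Finset.range q, M * 0)) :=
      (tendsto_finsetSum _ fun p _ =>
        ((tendsto_integral_abs_translate_sub μ hg).comp (hv p)).const_mul M).const_mul _
    simpa using this
  rw [tendsto_iff_norm_sub_tendsto_zero]
  exact squeeze_zero' (Eventually.of_forall fun _ => norm_nonneg _) hbound hlim

end WeakLimit

section Dimension

open scoped ENNReal NNReal

/-- The gauge `x ↦ -x ^ d * log x` at dyadic scales is dominated by `x ↦ x ^ s` if `s < d`. -/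
theorem exists_dyadic_gauge_le {d : ℕ} {s : ℝ} (hs0 : 0 ≤ s) (hs : s < d) :
    ∃ C : ℝ, 0 ≤ C ∧ ∀ D : ℝ, 0 ≤ D → D ≤ 1 → ∀ η : ℝ, 0 < η →
      ∃ k : ℕ, D ≤ (1 / 2) ^ k ∧ ((k : ℝ) + 1) * ((1 / 2) ^ k) ^ d ≤ C * D ^ s + η := by
  have hlim : ∀ r : ℝ, 0 < r →
      Tendsto (fun k : ℕ => ((k : ℝ) + 1) * (((1 : ℝ) / 2) ^ r) ^ k) atTop (𝓝 0) := by
    intro r hr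
    have h0 : (0 : ℝ) ≤ (1 / 2) ^ r := by positivity
    have h1 : ((1 : ℝ) / 2) ^ r < 1 := Real.rpow_lt_one (by norm_num) (by norm_num) hr
    have := (tendsto_self_mul_const_pow_of_lt_one h0 h1).add
      (tendsto_pow_atTop_nhds_zero_of_lt_one h0 h1)
    simpa [add_mul] using this
  obtain ⟨C, hC⟩ := (hlim (d - s) (by linarith)).bddAbove_range
  have hC' : ∀ k : ℕ, ((k : ℝ) + 1) * (((1 : ℝ) / 2) ^ ((d : ℝ) - s)) ^ k ≤ C :=
    fun k => hC ⟨k, rfl⟩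
  have hC0 : 0 ≤ C := le_trans (by positivity) (hC' 0)
  refine ⟨C * 2 ^ s, by positivity, fun D hD0 hD1 η hη => ?_⟩
  rcases hD0.eq_or_lt with rfl | hD
  · have hd : (0 : ℝ) < d := hs0.trans_lt hs
    obtain ⟨k, hk⟩ := ((hlim d hd).eventually (ge_mem_nhds hη)).exists
    refine ⟨k, by positivity, ?_⟩
    have h2 : (0 : ℝ) ≤ C * 2 ^ s * 0 ^ s := by positivity
    rw [Real.rpow_natCast, pow_right_comm] at hk
    linarith
  · obtain ⟨k, hk1, hk2⟩ := exists_nat_pow_near_of_lt_one hD hD1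
      (by norm_num : (0 : ℝ) < 1 / 2) (by norm_num)
    refine ⟨k, hk2, ?_⟩
    have h3 : ((1 : ℝ) / 2) ^ k ≤ 2 * D := by
      rw [pow_succ] at hk1
      linarith
    have h4 : (((1 : ℝ) / 2) ^ k) ^ d =
        (((1 : ℝ) / 2) ^ ((d : ℝ) - s)) ^ k * (((1 : ℝ) / 2) ^ k) ^ s := by
      rw [← Real.rpow_natCast _ d, ← Real.rpow_natCast _ k, ← Real.rpow_natCast _ k,
        ← Real.rpow_mul (by norm_num), ← Real.rpow_mul (by norm_num),
        ← Real.rpow_mul (by norm_num), ← Real.rpow_add (by norm_num)]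
      ring_nf
    calc ((k : ℝ) + 1) * (((1 : ℝ) / 2) ^ k) ^ d
        = (((k : ℝ) + 1) * (((1 : ℝ) / 2) ^ ((d : ℝ) - s)) ^ k) * (((1 : ℝ) / 2) ^ k) ^ s := by
          rw [h4]; ring
      _ ≤ C * (2 * D) ^ s := by
          gcongr
          exact hC' k
      _ = C * 2 ^ s * D ^ s := by
          rw [Real.mul_rpow (by norm_num) hD0]; ring
      _ ≤ C * 2 ^ s * D ^ s + η := by linarith

/-- A mass distribution principle for decreasing sequences of compact sets, each one carrying
its own measure. -/
theorem le_dimH_iInter_of_measure_ball_le {X : Type*} [MetricSpace X] [MeasurableSpace X]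
    [BorelSpace X] {d : ℕ} {K : Set X} {t : ℕ → Set X}
    (ht : ∀ k, K ⊆ ⋃ y ∈ t k, Metric.ball y ((1 / 2) ^ k)) {E : ℕ → Set X} (hE : Antitone E)
    (hEc : ∀ n, IsCompact (E n)) (hEK : E 0 ⊆ K) (ν : ℕ → Measure X) {c : ℝ≥0∞} (hc : c ≠ 0)
    (hν : ∀ n, c ≤ ν n (E n)) {A : ℝ} (hA : 0 ≤ A)
    (hball : ∀ n k, ∀ y ∈ t k, ν n (Metric.ball y (2 * (1 / 2) ^ k)) ≤
      ENNReal.ofReal (A * (((k : ℝ) + 1) * ((1 / 2) ^ k) ^ d))) :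
    (d : ℝ≥0∞) ≤ dimH (⋂ n, E n) := by
  by_contra! hlt
  obtain ⟨s, hs1, hs2⟩ := ENNReal.lt_iff_exists_nnreal_btwn.1 hlt
  have hsd : (s : ℝ) < d := by exact_mod_cast hs2
  obtain ⟨C, hC0, hC⟩ := exists_dyadic_gauge_le s.coe_nonneg hsd
  have hzero := hausdorffMeasure_of_dimH_lt hs1
  obtain ⟨ε, hε0, hε⟩ := ENNReal.exists_nnreal_pos_mul_lt
    (a := ENNReal.ofReal A * (ENNReal.ofReal C + 1)) (by finiteness) hc
  have hε' : (ε : ℝ≥0∞) ≠ 0 := by exact_mod_cast hε0.ne'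
  obtain ⟨u, hu, hu1, husum⟩ : ∃ u : ℕ → Set X, (⋂ n, E n) ⊆ ⋃ n, u n ∧
      (∀ n, Metric.ediam (u n) ≤ 1) ∧
      ∑' n, ⨆ _ : (u n).Nonempty, Metric.ediam (u n) ^ (s : ℝ) < ε := by
    rw [Measure.hausdorffMeasure_apply] at hzero
    have h1 := (iSup₂_le_iff.1 hzero.le) 1 one_pos
    have h2 := h1.trans_lt (pos_iff_ne_zero.2 hε')
    simpa only [iInf_lt_iff, exists_prop] using h2
  obtain ⟨η, hη, hηsum⟩ := ENNReal.exists_pos_sum_of_countable hε' ℕ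
  have hU : ∀ n, ∃ U : Set X, IsOpen U ∧ (⋂ i, E i) ∩ u n ⊆ U ∧ ∀ i, ν i U ≤
      ENNReal.ofReal A * (ENNReal.ofReal C * (⨆ _ : (u n).Nonempty,
        Metric.ediam (u n) ^ (s : ℝ)) + η n) := by
    intro n
    rcases ((⋂ i, E i) ∩ u n).eq_empty_or_nonempty with h | ⟨p, hp, hpu⟩
    · exact ⟨∅, isOpen_empty, h.subset, fun i => by simp⟩
    · have hfin : Metric.ediam (u n) ≠ ⊤ := ((hu1 n).trans_lt ENNReal.one_lt_top).ne
      obtain ⟨k, hk1, hk2⟩ := hC (Metric.ediam (u n)).toReal ENNReal.toReal_nonneg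
        (ENNReal.toReal_le_of_le_ofReal zero_le_one (by simpa using hu1 n)) (η n) (hη n)
      obtain ⟨y, hy, hyp⟩ := mem_iUnion₂.1 (ht k (hEK (mem_iInter.1 hp 0)))
      refine ⟨Metric.ball y (2 * (1 / 2) ^ k), Metric.isOpen_ball, ?_, fun i => ?_⟩
      · rintro x ⟨-, hx⟩
        have h1 : dist x p ≤ (Metric.ediam (u n)).toReal :=
          Metric.dist_le_diam_of_mem' hfin hx hpu
        have h2 := dist_triangle x p y
        rw [Metric.mem_ball] at hyp ⊢
        linarith
      · refine (hball i k y hy).trans ?_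
        rw [ENNReal.ofReal_mul hA]
        gcongr
        refine (ENNReal.ofReal_le_ofReal hk2).trans ?_
        rw [ENNReal.ofReal_add (by positivity) (by positivity), ENNReal.ofReal_mul hC0,
          ← ENNReal.ofReal_rpow_of_nonneg ENNReal.toReal_nonneg s.coe_nonneg,
          ENNReal.ofReal_toReal hfin, ENNReal.ofReal_coe_nnreal, iSup_pos ⟨p, hpu⟩]
  choose U hUo hUsub hUν using hU
  obtain ⟨n, hn⟩ := exists_subset_nhds_of_isCompact (V := E) (U := ⋃ n, U n)
    (hE.directed_ge) hEc fun x hx => by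
      refine (isOpen_iUnion hUo).mem_nhds ?_
      obtain ⟨i, hi⟩ := mem_iUnion.1 (hu hx)
      exact mem_iUnion.2 ⟨i, hUsub i ⟨hx, hi⟩⟩
  have : c < c := calc
    c ≤ ν n (E n) := hν n
    _ ≤ ν n (⋃ i, U i) := measure_mono hn
    _ ≤ ∑' i, ν n (U i) := measure_iUnion_le _
    _ ≤ ∑' i, ENNReal.ofReal A * (ENNReal.ofReal C * (⨆ _ : (u i).Nonempty,
        Metric.ediam (u i) ^ (s : ℝ)) + η i) := ENNReal.tsum_le_tsum fun i => hUν i n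
    _ = ENNReal.ofReal A * (ENNReal.ofReal C * (∑' i, ⨆ _ : (u i).Nonempty,
        Metric.ediam (u i) ^ (s : ℝ)) + ∑' i, (η i : ℝ≥0∞)) := by
      rw [ENNReal.tsum_mul_left, ENNReal.tsum_add, ENNReal.tsum_mul_left]
    _ ≤ ENNReal.ofReal A * (ENNReal.ofReal C * ε + ε) := by gcongr
    _ = ε * (ENNReal.ofReal A * (ENNReal.ofReal C + 1)) := by ring
    _ < c := hε
  exact this.false

end Dimension

section Thinning

open scoped ENNReal NNReal

/-- Closed sets `G N` carrying uniformly bounded weights `W N` that converge weakly to `1`. -/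
structure IsThinning {V : Type*} [TopologicalSpace V] [MeasurableSpace V] (μ : Measure V)
    (G : ℕ → Set V) (W : ℕ → V → ℝ) : Prop where
  isClosed : ∀ N, IsClosed (G N)
  measurable : ∀ N, Measurable (W N)
  nonneg : ∀ N x, 0 ≤ W N x
  bounded : ∃ M, ∀ N x, W N x ≤ M
  eq_zero : ∀ N x, x ∉ G N → W N x = 0
  tendsto : ∀ g : V → ℝ, Integrable g μ →
    Tendsto (fun N => ∫ x, g x * W N x ∂μ) atTop (𝓝 (∫ x, g x ∂μ))

/-- A bounded density with mass more than `c` and mass less than `b i` on the test set `B i`. -/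
structure IsSpreadDensity {V : Type*} [MeasurableSpace V] (μ : Measure V) {ι : Type*}
    (B : ι → Set V) (b : ι → ℝ) (c : ℝ) (ρ : V → ℝ) : Prop where
  integrable : Integrable ρ μ
  nonneg : ∀ x, 0 ≤ ρ x
  bounded : ∃ M, ∀ x, ρ x ≤ M
  lt_integral : c < ∫ x, ρ x ∂μ
  setIntegral_lt : ∀ i, ∫ x in B i, ρ x ∂μ < b i

variable {V : Type*} [TopologicalSpace V] [MeasurableSpace V] {μ : Measure V}

theorem IsSpreadDensity.exists_mul {ι : Type*} {B : ι → Set V} {b : ι → ℝ} {c : ℝ} {ρ : V → ℝ}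
    (hρ : IsSpreadDensity μ B b c ρ) (hB : ∀ i, MeasurableSet (B i)) (hBfin : ∀ i, μ (B i) ≠ ∞)
    (hfin : ∀ L : ℝ, {i | b i ≤ L * μ.real (B i)}.Finite) {G : ℕ → Set V} {W : ℕ → V → ℝ}
    (hW : IsThinning μ G W) :
    ∃ N, IsSpreadDensity μ B b c fun x => ρ x * W N x := by
  obtain ⟨M, hM⟩ := hρ.bounded
  obtain ⟨L, hL⟩ := hW.bounded
  have hWint : ∀ {g : V → ℝ}, Integrable g μ → ∀ N, Integrable (fun x => g x * W N x) μ :=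
    fun hg N => hg.mul_bdd (c := L) (hW.measurable N).aestronglyMeasurable
      (Eventually.of_forall fun x => by
        rw [Real.norm_of_nonneg (hW.nonneg N x)]
        exact hL N x)
  have hbd : ∀ N x, ρ x * W N x ≤ M * L := fun N x =>
    mul_le_mul (hM x) (hL N x) (hW.nonneg N x) ((hρ.nonneg x).trans (hM x))
  have hset : ∀ i N, ∫ x in B i, ρ x * W N x ∂μ = ∫ x, (B i).indicator ρ x * W N x ∂μ := by
    intro i N
    rw [← integral_indicator (hB i)]
    congr 1
    ext x
    by_cases hx : x ∈ B i <;> simp [hx]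
  have hev : ∀ i ∈ {i | b i ≤ M * L * μ.real (B i)}, ∀ᶠ N in atTop,
      ∫ x in B i, ρ x * W N x ∂μ < b i := by
    intro i _
    simp only [hset]
    refine (hW.tendsto _ (hρ.integrable.indicator (hB i))).eventually_lt_const ?_
    rw [integral_indicator (hB i)]
    exact hρ.setIntegral_lt i
  obtain ⟨N, hN1, hN2⟩ := (((hW.tendsto ρ hρ.integrable).eventually_const_lt
    hρ.lt_integral).and ((hfin (M * L)).eventually_all.2 hev)).exists
  refine ⟨N, hWint hρ.integrable N, fun x => mul_nonneg (hρ.nonneg x) (hW.nonneg N x),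
    ⟨M * L, hbd N⟩, hN1, fun i => ?_⟩
  by_cases hi : b i ≤ M * L * μ.real (B i)
  · exact hN2 i hi
  · refine lt_of_le_of_lt ?_ (not_le.1 hi)
    calc ∫ x in B i, ρ x * W N x ∂μ ≤ ∫ _ in B i, M * L ∂μ :=
          integral_mono (hWint hρ.integrable N).integrableOn
            (integrableOn_const (hBfin i)) (hbd N)
      _ = M * L * μ.real (B i) := by simp [mul_comm]

theorem IsSpreadDensity.exists_seq {ι : Type*} {B : ι → Set V} {b : ι → ℝ} {c : ℝ} {ρ : V → ℝ}
    (hρ : IsSpreadDensity μ B b c ρ) (hB : ∀ i, MeasurableSet (B i)) (hBfin : ∀ i, μ (B i) ≠ ∞)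
    (hfin : ∀ L : ℝ, {i | b i ≤ L * μ.real (B i)}.Finite) {G : ℕ → ℕ → Set V}
    {W : ℕ → ℕ → V → ℝ} (hW : ∀ n, IsThinning μ (G n) (W n)) :
    ∃ (N : ℕ → ℕ) (σ : ℕ → V → ℝ), σ 0 = ρ ∧ (∀ n x, σ (n + 1) x = σ n x * W n (N n) x) ∧
      ∀ n, IsSpreadDensity μ B b c (σ n) := by
  choose F hF using fun (n : ℕ) (τ : {τ // IsSpreadDensity μ B b c τ}) =>
    τ.2.exists_mul hB hBfin hfin (hW n)
  let σ : ℕ → {τ // IsSpreadDensity μ B b c τ} :=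
    fun n => Nat.rec ⟨ρ, hρ⟩ (fun n τ => ⟨_, hF n τ⟩) n
  exact ⟨fun n => F n (σ n), fun n => (σ n).1, rfl, fun n x => rfl, fun n => (σ n).2⟩

end Thinning

section FullDimension

open scoped ENNReal NNReal

variable {V : Type*} [NormedAddCommGroup V] [NormedSpace ℝ V] [FiniteDimensional ℝ V]
  [MeasurableSpace V] [BorelSpace V] (μ : Measure V) [μ.IsAddHaarMeasure]

/-- Countably many thinnings can be performed on the unit ball, each one at a suitable scale,
without losing dimension. -/
theorem IsThinning.exists_dimH_eq {G : ℕ → ℕ → Set V} {W : ℕ → ℕ → V → ℝ}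
    (hW : ∀ n, IsThinning μ (G n) (W n)) :
    ∃ N : ℕ → ℕ, dimH (Metric.closedBall (0 : V) 1 ∩ ⋂ n, G n (N n)) =
      Module.finrank ℝ V := by
  set d := Module.finrank ℝ V with hd
  set K := Metric.closedBall (0 : V) 1 with hK
  have hKc : IsCompact K := isCompact_closedBall _ _
  have hfinite : ∀ k : ℕ, ∃ t ⊆ K, t.Finite ∧ K ⊆ ⋃ y ∈ t, Metric.ball y ((1 / 2) ^ k) :=
    fun k => hKc.finite_cover_balls (by positivity)
  choose t _ htfin ht using hfinite
  let B : (Σ k, t k) → Set V := fun i => Metric.ball i.2 (2 * (1 / 2) ^ i.1)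
  set v := μ.real (Metric.ball (0 : V) 1) with hv
  have hv0 : 0 < v := ENNReal.toReal_pos (Metric.measure_ball_pos μ _ one_pos).ne'
    measure_ball_lt_top.ne
  have hvol : ∀ i, μ.real (B i) = 2 ^ d * ((1 / 2) ^ i.1) ^ d * v := by
    intro i
    rw [Measure.real, Measure.addHaar_ball_of_pos μ _ (by positivity), ENNReal.toReal_mul,
      ENNReal.toReal_ofReal (by positivity), mul_pow]
    rfl
  set A : ℝ := 2 ^ d * v + 1 with hA
  have hA0 : 0 < A := by positivity
  let b : (Σ k, t k) → ℝ := fun i => A * (((i.1 : ℝ) + 1) * ((1 / 2) ^ i.1) ^ d)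
  have hBfin : ∀ i, μ (B i) ≠ ∞ := fun i => measure_ball_lt_top.ne
  have hBm : ∀ i, MeasurableSet (B i) := fun i => measurableSet_ball
  have hfin : ∀ L : ℝ, {i | b i ≤ L * μ.real (B i)}.Finite := by
    intro L
    obtain ⟨k₀, hk₀⟩ := exists_nat_gt (L * (2 ^ d * v) / A)
    have : {i | b i ≤ L * μ.real (B i)} ⊆
        ⋃ k ∈ Finset.range k₀, range fun y : t k => (⟨k, y⟩ : Σ k, t k) := by
      rintro ⟨k, y⟩ hi
      simp only [mem_ofPred_eq, hvol, b] at hi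
      have h1 : A * ((k : ℝ) + 1) ≤ L * (2 ^ d * v) := by
        have h2 : (0 : ℝ) < ((1 / 2) ^ k) ^ d := by positivity
        refine le_of_mul_le_mul_right ?_ h2
        linarith
      have h3 : (k : ℝ) < k₀ := by
        rw [div_lt_iff₀ hA0] at hk₀
        nlinarith
      exact mem_iUnion₂.2 ⟨k, Finset.mem_range.2 (by exact_mod_cast h3), y, rfl⟩
    refine Finite.subset (Finset.finite_toSet _ |>.biUnion fun k _ => ?_) this
    have := (htfin k).to_subtype
    exact finite_range _
  have hρ : IsSpreadDensity μ B b (μ.real K / 2) (K.indicator 1) := by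
    have hKpos : 0 < μ.real K := ENNReal.toReal_pos
      (Metric.measure_closedBall_pos μ _ one_pos).ne' hKc.measure_lt_top.ne
    have hKm : MeasurableSet K := hKc.measurableSet
    have hle : ∀ x, K.indicator (1 : V → ℝ) x ≤ 1 := fun x =>
      indicator_le_self' (fun _ _ => zero_le_one) x
    have hint : Integrable (K.indicator (1 : V → ℝ)) μ :=
      (integrable_indicator_iff hKm).2 (integrableOn_const hKc.measure_lt_top.ne)
    refine ⟨hint, fun x => indicator_nonneg (fun _ _ => zero_le_one) x, ⟨1, hle⟩, ?_, fun i => ?_⟩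
    · rw [integral_indicator_one hKm]
      linarith
    · calc ∫ x in B i, K.indicator (1 : V → ℝ) x ∂μ ≤ ∫ _ in B i, (1 : ℝ) ∂μ :=
            integral_mono hint.integrableOn (integrableOn_const (hBfin i)) hle
        _ = 2 ^ d * v * ((1 / 2) ^ i.1) ^ d := by
            simp only [integral_const, MeasurableSet.univ, measureReal_restrict_apply, univ_inter,
              hvol, smul_eq_mul, mul_one]
            ring
        _ < A * ((1 / 2) ^ i.1) ^ d := by
            gcongr
            linarith
        _ ≤ b i := by
            have h1 : (0 : ℝ) ≤ A * ((1 / 2) ^ i.1) ^ d := by positivity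
            have h2 : (0 : ℝ) ≤ i.1 := by positivity
            simp only [b]
            nlinarith
  obtain ⟨N, σ, hσ0, hσs, hσ⟩ := hρ.exists_seq hBm hBfin hfin hW
  refine ⟨N, le_antisymm ((dimH_mono (subset_univ _)).trans
    (Real.dimH_univ_eq_finrank V).le) ?_⟩
  let E : ℕ → Set V := fun n => K ∩ ⋂ i < n, G i (N i)
  have hsupp : ∀ n x, x ∉ E n → σ n x = 0 := by
    intro n
    induction n with
    | zero =>
      intro x hx
      rw [hσ0]
      exact indicator_of_notMem (by simpa [E] using hx) _
    | succ n ih =>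
      intro x hx
      rw [hσs]
      by_cases h : x ∈ E n
      · rw [(hW n).eq_zero _ _ fun h' => hx ⟨h.1, ?_⟩, mul_zero]
        rw [biInter_lt_succ]
        exact ⟨h.2, h'⟩
      · rw [ih x h, zero_mul]
  have hEclosed : ∀ n, IsClosed (⋂ i < n, G i (N i)) := fun n =>
    isClosed_biInter fun i _ => (hW i).isClosed _
  have hEeq : K ∩ ⋂ n, G n (N n) = ⋂ n, E n := by
    ext x
    simp only [E, mem_inter_iff, mem_iInter]
    exact ⟨fun h n => ⟨h.1, fun i _ => h.2 i⟩, fun h =>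
      ⟨(h 0).1, fun n => (h (n + 1)).2 n n.lt_succ_self⟩⟩
  rw [hEeq]
  have hν : ∀ n (S : Set V), MeasurableSet S →
      (μ.withDensity fun x => ENNReal.ofReal (σ n x)) S = ENNReal.ofReal (∫ x in S, σ n x ∂μ) := by
    intro n S hS
    rw [withDensity_apply _ hS, ofReal_integral_eq_lintegral_ofReal (hσ n).integrable.integrableOn
      (Eventually.of_forall (hσ n).nonneg)]
  refine le_dimH_iInter_of_measure_ball_le (K := K) (t := t) ht (E := E) ?_
    (fun n => hKc.inter_right (hEclosed n)) inter_subset_left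
    (fun n => μ.withDensity fun x => ENNReal.ofReal (σ n x)) (c := ENNReal.ofReal (μ.real K / 2))
    ?_ ?_ hA0.le ?_
  · intro m n hmn
    exact inter_subset_inter_right _ (biInter_mono (fun i hi => lt_of_lt_of_le hi hmn)
      fun _ _ => subset_rfl)
  · have hKpos : 0 < μ.real K := ENNReal.toReal_pos
      (Metric.measure_closedBall_pos μ _ one_pos).ne' hKc.measure_lt_top.ne
    simpa using hKpos
  · intro n
    rw [hν n _ (hKc.inter_right (hEclosed n)).measurableSet,
      setIntegral_eq_integral_of_forall_compl_eq_zero (hsupp n)]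
    exact ENNReal.ofReal_le_ofReal (hσ n).lt_integral.le
  · intro n k y hy
    rw [hν n _ measurableSet_ball]
    exact ENNReal.ofReal_le_ofReal ((hσ n).setIntegral_lt ⟨k, y, hy⟩).le

end FullDimension

section Slabs

/-- The real numbers close to `θ` modulo `1`, with a weight supported on them. -/
theorem exists_slab_weight {q : ℕ} (hq : 0 < q) (θ : ℝ) :
    ∃ (S : Set ℝ) (w : ℝ → ℝ), IsClosed S ∧ Measurable w ∧ (∀ u, 0 ≤ w u) ∧ (∀ u, w u ≤ q) ∧
      (∀ u ∉ S, w u = 0) ∧ (∀ u, ∑ p ∈ Finset.range q, w (u + p / q) = q) ∧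
      ∀ u ∈ S, ∃ z : ℤ, |u - θ - z| ≤ 1 / q := by
  have hq1 : (1 : ℝ) ≤ q := by exact_mod_cast hq
  have hq0 : (0 : ℝ) < 1 / q := by positivity
  have hq2 : (1 : ℝ) / q ≤ 1 := (div_le_one (by positivity)).2 hq1
  have hmono : ∀ u : ℝ, ⌊u - θ - 1 / q⌋ ≤ ⌊u - θ⌋ := fun u => Int.floor_mono (by linarith)
  have hstep : ∀ u : ℝ, ⌊u - θ⌋ ≤ ⌊u - θ - 1 / q⌋ + 1 := fun u => by
    rw [← Int.floor_add_one]
    exact Int.floor_mono (by linarith)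
  refine ⟨{u | ‖((u - θ : ℝ) : UnitAddCircle)‖ ≤ 1 / q},
    fun u => q * ((⌊u - θ⌋ - ⌊u - θ - 1 / q⌋ : ℤ) : ℝ), ?_, ?_, fun u => ?_, fun u => ?_,
    fun u hu => ?_, fun u => ?_, fun u hu => ?_⟩
  · refine isClosed_le (continuous_norm.comp ?_) continuous_const
    exact (AddCircle.continuous_mk' (1 : ℝ)).comp (by fun_prop)
  · push_cast
    fun_prop
  · have h : (0 : ℤ) ≤ ⌊u - θ⌋ - ⌊u - θ - 1 / q⌋ := by linarith [hmono u]
    have h' : (0 : ℝ) ≤ ((⌊u - θ⌋ - ⌊u - θ - 1 / q⌋ : ℤ) : ℝ) := by exact_mod_cast h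
    positivity
  · have h : ⌊u - θ⌋ - ⌊u - θ - 1 / q⌋ ≤ (1 : ℤ) := by linarith [hstep u]
    have h' : ((⌊u - θ⌋ - ⌊u - θ - 1 / q⌋ : ℤ) : ℝ) ≤ 1 := by exact_mod_cast h
    nlinarith
  · have h : ⌊u - θ⌋ = ⌊u - θ - 1 / q⌋ := by
      by_contra hne
      have hlt : ⌊u - θ - 1 / q⌋ < ⌊u - θ⌋ := lt_of_le_of_ne (hmono u) (Ne.symm hne)
      have h1 := Int.floor_lt.1 hlt
      have h2 := Int.floor_le (u - θ)
      refine hu ?_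
      rw [mem_ofPred_eq, UnitAddCircle.norm_eq]
      refine (round_le _ ⌊u - θ⌋).trans ?_
      rw [abs_le]
      constructor <;> linarith
    simp [h]
  · have htel : ∀ n : ℕ, ∑ p ∈ Finset.range n,
        ((⌊u + p / q - θ⌋ - ⌊u + p / q - θ - 1 / q⌋ : ℤ) : ℝ) =
          ⌊u + n / q - θ - 1 / q⌋ - ⌊u - θ - 1 / q⌋ := by
      intro n
      induction n with
      | zero => simp
      | succ n ih =>
        have : u + ((n + 1 : ℕ) : ℝ) / q - θ - 1 / q = u + n / q - θ := by
          push_cast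
          ring
        rw [Finset.sum_range_succ, ih, this]
        push_cast
        ring
    have hlast : u + (q : ℝ) / q - θ - 1 / q = u - θ - 1 / q + 1 := by
      rw [div_self (by positivity)]
      ring
    rw [← Finset.mul_sum, htel, hlast, Int.floor_add_one]
    push_cast
    ring
  · rw [mem_ofPred_eq, UnitAddCircle.norm_eq] at hu
    exact ⟨_, hu⟩

variable {V : Type*} [NormedAddCommGroup V] [NormedSpace ℝ V] [FiniteDimensional ℝ V]
  [MeasurableSpace V] [BorelSpace V] (μ : Measure V) [μ.IsAddHaarMeasure]

theorem exists_slab_weight_of_functional (c : V →L[ℝ] ℝ) {q : ℕ} (hq : 0 < q) {θ : ℝ}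
    (hθ : c = 0 → θ = 0) :
    ∃ (S : Set ℝ) (w : ℝ → ℝ), IsClosed S ∧ Measurable w ∧ (∀ u, 0 ≤ w u) ∧ (∀ u, w u ≤ q) ∧
      (∀ u ∉ S, w u = 0) ∧
      (∀ g : V → ℝ, Integrable g μ →
        Tendsto (fun N : ℕ => ∫ x, g x * w (N * c x) ∂μ) atTop (𝓝 (∫ x, g x ∂μ))) ∧
      ∀ (N : ℕ) (x : V), N * c x ∈ S → ∃ z : ℤ, |N * c x - θ - z| ≤ 1 / q := by
  by_cases hc : c = 0
  · have hq1 : (1 : ℝ) ≤ q := by exact_mod_cast hq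
    refine ⟨univ, fun _ => 1, isClosed_univ, measurable_const, fun _ => zero_le_one,
      fun _ => hq1, fun u hu => absurd (mem_univ u) hu, fun g _ => by simp, fun N x _ => ⟨0, ?_⟩⟩
    simp [hc, hθ hc]
  · obtain ⟨S, w, hS, hw, hw0, hwq, hwS, hsum, hz⟩ := exists_slab_weight hq θ
    exact ⟨S, w, hS, hw, hw0, hwq, hwS, fun g hg => tendsto_integral_mul_comp_smul μ hg hc hq hw
      (fun u => (abs_of_nonneg (hw0 u)).trans_le (hwq u)) hsum, fun N x hx => hz _ hx⟩

/-- A thinning that destroys the solutions of a linear equation whose variables lie in prescribed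
disjoint open sets. -/
theorem exists_isThinning_sum_ne_zero {J : Type*} [Fintype J] (c : J → V →L[ℝ] ℝ) {i : J}
    (hi : c i ≠ 0) {U : J → Set V} (hU : ∀ j, IsOpen (U j)) :
    ∃ (G : ℕ → Set V) (W : ℕ → V → ℝ), IsThinning μ G W ∧
      (Pairwise (fun j k => Disjoint (U j) (U k)) → ∀ (N : ℕ) (x : J → V), (∀ j, x j ∈ U j) →
        (∀ j, x j ∈ G N) → ∑ j, c j (x j) ≠ 0) := by
  classical
  by_cases hdisj : Pairwise fun j k => Disjoint (U j) (U k)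
  swap
  · exact ⟨fun _ => univ, fun _ _ => 1, ⟨fun _ => isClosed_univ, fun _ => measurable_const,
      fun _ _ => zero_le_one, ⟨1, fun _ _ => le_rfl⟩, fun _ x hx => absurd (mem_univ x) hx,
      fun g _ => by simp⟩, fun h => absurd h hdisj⟩
  set q : ℕ := 4 * Fintype.card J with hq
  have hJ : 0 < Fintype.card J := Fintype.card_pos_iff.2 ⟨i⟩
  have hq0 : 0 < q := by positivity
  have hq1 : (1 : ℝ) ≤ q := by exact_mod_cast hq0
  let θ : J → ℝ := fun j => if j = i then 1 / 2 else 0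
  have hθ : ∀ j, c j = 0 → θ j = 0 := by
    intro j hj
    refine if_neg ?_
    rintro rfl
    exact hi hj
  choose S w hS hw hw0 hwq hwS hwt hz using fun j =>
    exists_slab_weight_of_functional μ (c j) hq0 (hθ j)
  let W : ℕ → V → ℝ := fun N x => 1 + ∑ j, (U j).indicator (fun x => w j (N * c j x) - 1) x
  have hWmem : ∀ N x j, x ∈ U j → W N x = w j (N * c j x) := by
    intro N x j hx
    simp only [W]
    rw [Finset.sum_eq_single j, indicator_of_mem hx]
    · ring
    · exact fun k _ hk => indicator_of_notMem (disjoint_left.1 (hdisj hk.symm) hx) _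
    · exact fun h => absurd (Finset.mem_univ j) h
  have hWnot : ∀ N x, (∀ j, x ∉ U j) → W N x = 1 := by
    intro N x hx
    simp [W, indicator_of_notMem (hx _)]
  have hmeas : ∀ j (N : ℕ), Measurable fun x => w j (N * c j x) := fun j N =>
    (hw j).comp (by fun_prop)
  have hint : ∀ j {g : V → ℝ}, Integrable g μ → ∀ N : ℕ,
      Integrable (fun x => g x * w j (N * c j x)) μ := fun j g hg N =>
    hg.mul_bdd (c := q) (hmeas j N).aestronglyMeasurable (Eventually.of_forall fun x => by
      rw [Real.norm_of_nonneg (hw0 j _)]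
      exact hwq j _)
  refine ⟨fun N => {x | ∀ j, x ∈ U j → N * c j x ∈ S j}, W,
    ⟨fun N => ?_, fun N => ?_, fun N x => ?_, ⟨q, fun N x => ?_⟩, fun N x hx => ?_,
      fun g hg => ?_⟩, fun _ N x hxU hxG hzero => ?_⟩
  · simp only [ofPred_forall, imp_iff_not_or, ofPred_or]
    exact isClosed_iInter fun j => (hU j).isClosed_compl.union ((hS j).preimage (by fun_prop))
  · exact measurable_const.add (Finset.measurable_sum _ fun j _ =>
      ((hmeas j N).sub measurable_const).indicator (hU j).measurableSet)
  · by_cases h : ∃ j, x ∈ U j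
    · obtain ⟨j, hj⟩ := h
      rw [hWmem N x j hj]
      exact hw0 j _
    · rw [hWnot N x (not_exists.1 h)]
      exact zero_le_one
  · by_cases h : ∃ j, x ∈ U j
    · obtain ⟨j, hj⟩ := h
      rw [hWmem N x j hj]
      exact hwq j _
    · rw [hWnot N x (not_exists.1 h)]
      exact hq1
  · simp only [mem_ofPred_eq, not_forall] at hx
    obtain ⟨j, hj, hjS⟩ := hx
    rw [hWmem N x j hj]
    exact hwS j _ hjS
  · have hgU : ∀ j, Integrable ((U j).indicator g) μ := fun j =>
      hg.indicator (hU j).measurableSet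
    have heq : ∀ N : ℕ, ∫ x, g x * W N x ∂μ = ∫ x, g x ∂μ +
        ∑ j, (∫ x, (U j).indicator g x * w j (N * c j x) ∂μ - ∫ x, (U j).indicator g x ∂μ) := by
      intro N
      have hI : ∀ j, Integrable (fun x => (U j).indicator g x * w j (N * c j x) -
          (U j).indicator g x) μ := fun j => (hint j (hgU j) N).sub (hgU j)
      rw [Finset.sum_congr rfl fun j _ => (integral_sub (hint j (hgU j) N) (hgU j)).symm,
        ← integral_finsetSum _ fun j _ => hI j,
        ← integral_add hg (integrable_finsetSum _ fun j _ => hI j)]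
      congr 1
      ext x
      simp only [W, mul_add, mul_one, Finset.mul_sum]
      congr 1
      refine Finset.sum_congr rfl fun j _ => ?_
      by_cases hx : x ∈ U j
      · simp only [indicator_of_mem hx]
        ring
      · simp [indicator_of_notMem hx]
    simp only [heq]
    have := (tendsto_const_nhds (x := ∫ x, g x ∂μ)).add (tendsto_finsetSum Finset.univ
      fun j _ => (hwt j _ (hgU j)).sub_const (∫ x, (U j).indicator g x ∂μ))
    simpa using this
  · choose z hz' using fun j => hz j N (x j) (hxG j j (hxU j))
    have h1 : ∑ j, (N * c j (x j) - θ j - z j) = -(1 / 2) - ((∑ j, z j : ℤ) : ℝ) := by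
      rw [Finset.sum_sub_distrib, Finset.sum_sub_distrib, ← Finset.mul_sum, hzero]
      simp [θ]
    have h2 : |∑ j, (N * c j (x j) - θ j - z j)| ≤ 1 / 4 := by
      refine (Finset.abs_sum_le_sum_abs _ _).trans
        ((Finset.sum_le_sum fun j _ => hz' j).trans_eq ?_)
      have : (Fintype.card J : ℝ) ≠ 0 := by positivity
      simp only [Finset.sum_const, Finset.card_univ, nsmul_eq_mul, hq]
      push_cast
      field_simp
    rw [h1, abs_le] at h2
    generalize ∑ j, z j = Z at h2
    have h3 : (-1 : ℝ) < Z := by linarith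
    have h4 : (Z : ℝ) < 0 := by linarith
    have h5 : (-1 : ℤ) < Z := by exact_mod_cast h3
    have h6 : Z < (0 : ℤ) := by exact_mod_cast h4
    omega

end Slabs

/-- Distinct points can be separated by members of a fixed sequence of open sets. -/
theorem exists_seq_open_separating (X : Type*) [TopologicalSpace X] [T2Space X]
    [SecondCountableTopology X] :
    ∃ B : ℕ → Set X, (∀ n, IsOpen (B n)) ∧ ∀ {J : Type} [Finite J] (x : J → X),
      Function.Injective x → ∃ p : J → ℕ, (∀ j, x j ∈ B (p j)) ∧
        Pairwise fun j k => Disjoint (B (p j)) (B (p k)) := by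
  have hne : (insert univ (TopologicalSpace.countableBasis X)).Nonempty := insert_nonempty _ _
  obtain ⟨B, hB⟩ := ((TopologicalSpace.countable_countableBasis X).insert univ).exists_eq_range hne
  refine ⟨B, fun n => ?_, fun {J} _ x hx => ?_⟩
  · rcases hB.symm ▸ mem_range_self n with h | h
    · rw [h]
      exact isOpen_univ
    · exact TopologicalSpace.isOpen_of_mem_countableBasis h
  · obtain ⟨U, hU, hdisj⟩ := (finite_range x).t2_separation
    have h1 : ∀ j, ∃ n, x j ∈ B n ∧ B n ⊆ U (x j) := by
      intro j
      obtain ⟨b, hb, hxb, hbU⟩ :=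
        (TopologicalSpace.isBasis_countableBasis X).exists_subset_of_mem_open (hU (x j)).1
          (hU (x j)).2
      obtain ⟨n, rfl⟩ := hB ▸ mem_insert_of_mem univ hb
      exact ⟨n, hxb, hbU⟩
    choose p hp hpU using h1
    exact ⟨p, hp, fun j k hjk => (hdisj (mem_range_self j) (mem_range_self k)
      (hx.ne hjk)).mono (hpU j) (hpU k)⟩

theorem stmt_6 (d : ℕ) (hd : 0 < d)
    (m : ℕ → ℕ) (hm : ∀ k, 2 ≤ m k)
    (ψ : ∀ k, ((Fin (m k) → EuclideanSpace ℝ (Fin d)) →ₗ[ℝ] ℝ))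
    (hψ : ∀ k, ψ k ≠ 0) :
    ∃ E : Set (EuclideanSpace ℝ (Fin d)), IsCompact E ∧ dimH E = d ∧
      ∀ k, ∀ x : Fin (m k) → EuclideanSpace ℝ (Fin d),
        (∀ i, x i ∈ E) → Function.Injective x → ψ k x ≠ 0 := by
  let c : ∀ k, Fin (m k) → EuclideanSpace ℝ (Fin d) →L[ℝ] ℝ := fun k j =>
    LinearMap.toContinuousLinearMap
      (ψ k ∘ₗ LinearMap.single ℝ (fun _ => EuclideanSpace ℝ (Fin d)) j)
  have hsum : ∀ k x, ψ k x = ∑ j, c k j (x j) := fun k x =>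
    (LinearMap.sum_single_apply _ x).symm ▸ by simp [c]
  have hc : ∀ k, ∃ i, c k i ≠ 0 := by
    intro k
    by_contra! h
    exact hψ k (LinearMap.ext fun x => by simp [hsum, h])
  choose i hi using hc
  obtain ⟨B, hB, hsep⟩ := exists_seq_open_separating (EuclideanSpace ℝ (Fin d))
  choose G W hGW hG using fun a : Σ k, Fin (m k) → ℕ =>
    exists_isThinning_sum_ne_zero volume (c a.1) (hi a.1) fun j => hB (a.2 j)
  obtain ⟨f, hf⟩ := exists_surjective_nat (Σ k, Fin (m k) → ℕ)
  obtain ⟨N, hN⟩ := IsThinning.exists_dimH_eq volume fun n => hGW (f n)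
  refine ⟨_, (isCompact_closedBall _ _).inter_right
    (isClosed_iInter fun n => (hGW (f n)).isClosed (N n)), by simpa using hN, ?_⟩
  intro k x hxE hx
  obtain ⟨p, hp, hdisj⟩ := hsep x hx
  obtain ⟨n, hn⟩ := hf ⟨k, p⟩
  rw [hsum]
  exact hG ⟨k, p⟩ hdisj (N n) x hp fun j => hn ▸ mem_iInter.1 (hxE j).2 n
end

section
/- Given a dimension function h with h ≺ x and a countable set A ⊆ ℝ \ {1}, there exists a compact set E ⊆ [1,2] with ℋ^h(E) > 0 such that the quotient set E/E = { y/x : x, y ∈ E } contains no element of A; equivalently, a·x ≠ y for all a ∈ A and all distinct x, y ∈ E. -/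
open MeasureTheory Filter Set

/-- The union of the cells `[n * δ, (n + 1) * δ)` with `n` even. -/
def evenCells (δ : ℝ) : Set ℝ := {x | Even ⌊x / δ⌋}

lemma measurableSet_evenCells (δ : ℝ) : MeasurableSet (evenCells δ) :=
  (Int.measurable_floor.comp (measurable_id.div_const δ))
    (MeasurableSet.of_discrete (s := {n | Even n}))

lemma add_odd_mul_mem_evenCells {δ : ℝ} (hδ : δ ≠ 0) {m : ℤ} (hm : Odd m) (x : ℝ) :
    x + m * δ ∈ evenCells δ ↔ x ∉ evenCells δ := by
  have : (x + m * δ) / δ = x / δ + m := by field_simp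
  simp only [evenCells, mem_ofPred_eq, this, Int.floor_add_intCast, Int.even_add]
  rw [← Int.not_even_iff_odd] at hm
  tauto

/-- If translation by `δ` maps `G` into `H`, then `T ∩ G` is at most as large as `T ∩ H`, up to
the part of the translate of `T` lying outside `T`. -/
lemma volume_real_inter_le_of_translate {T G H R : Set ℝ} {δ : ℝ}
    (hGH : ∀ x ∈ G, x + δ ∈ H) (hT : volume T ≠ ⊤) (hR : volume R ≠ ⊤)
    (hTR : ∀ x ∈ T, x + δ ∈ T ∪ R) :
    volume.real (T ∩ G) ≤ volume.real (T ∩ H) + volume.real R := by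
  have h1 : volume.real (T ∩ G) = volume.real ((fun x => x + δ) '' (T ∩ G)) := by
    rw [image_add_right, Measure.real, Measure.real, measure_preimage_add_right]
  rw [h1]
  have hTH : volume (T ∩ H) ≠ ⊤ := measure_ne_top_of_subset inter_subset_left hT
  refine (measureReal_mono ?_ (measure_union_ne_top hTH hR)).trans (measureReal_union_le _ _)
  rintro _ ⟨x, ⟨hx, hxG⟩, rfl⟩
  rcases hTR x hx with h | h
  · exact Or.inl ⟨h, hGH x hxG⟩
  · exact Or.inr h

/-- The Frostman-type condition used to bound gauge measures from below. -/
def FrostmanOn (h : ℝ → ℝ) (c : ℝ) (S : Set ℝ) : Prop :=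
  ∀ u v : ℝ, u ≤ v → volume.real (S ∩ Icc u v) ≤ c * h (v - u) * volume.real S

lemma exists_forall_le_mul_of_prec {h : ℝ → ℝ} (hdim : IsDimFun h)
    (hprec : Prec h (fun x : ℝ => x)) {ε : ℝ} (hε : 0 < ε) :
    ∃ ρ > 0, ∀ r, 0 ≤ r → r < ρ → r ≤ ε * h r := by
  have h1 : ∀ᶠ x in nhdsWithin 0 (Ioi (0 : ℝ)), x / h x < ε := hprec.eventually_lt_const hε
  obtain ⟨ρ, hρ, hsub⟩ := mem_nhdsGT_iff_exists_Ioo_subset.1 h1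
  refine ⟨ρ, hρ, fun r h0 hr => ?_⟩
  rcases h0.eq_or_lt with rfl | h0
  · simp [hdim.1]
  · have : r / h r < ε := hsub ⟨h0, hr⟩
    exact ((div_lt_iff₀ (hdim.2.1 r h0)).1 this).le

lemma volume_real_inter_Icc_le (S : Set ℝ) {u v : ℝ} (huv : u ≤ v) :
    volume.real (S ∩ Icc u v) ≤ v - u := by
  refine (measureReal_mono inter_subset_right (by simp)).trans ?_
  simp [Real.volume_real_Icc_of_le huv]

lemma exists_frostmanOn_Icc {h : ℝ → ℝ} (hdim : IsDimFun h)
    (hprec : Prec h (fun x : ℝ => x)) {l : ℝ} (hl : 0 < l) :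
    ∃ c > 0, FrostmanOn h c (Icc 0 l) := by
  obtain ⟨ρ, hρ, hs⟩ := exists_forall_le_mul_of_prec hdim hprec hl
  have hη := hdim.2.1 ρ hρ
  refine ⟨1 + 1 / h ρ, by positivity, fun u v huv => ?_⟩
  have hV : volume.real (Icc 0 l) = l := by simp [Real.volume_real_Icc_of_le hl.le]
  rw [hV]
  have hh : 0 ≤ h (v - u) := by
    rw [← hdim.1]; exact hdim.2.2.1 self_mem_Ici (sub_nonneg.2 huv) (sub_nonneg.2 huv)
  have e1 : 0 ≤ 1 / h ρ * (h (v - u) * l) := by positivity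
  rcases lt_or_ge (v - u) ρ with hr | hr
  · have := volume_real_inter_Icc_le (Icc 0 l) huv
    have h2 := hs _ (sub_nonneg.2 huv) hr
    nlinarith
  · have h1 : h ρ ≤ h (v - u) := hdim.2.2.1 hρ.le (sub_nonneg.2 huv) hr
    have h2 : volume.real (Icc 0 l ∩ Icc u v) ≤ l :=
      (measureReal_mono inter_subset_left (by simp)).trans hV.le
    have h3 : 1 ≤ 1 / h ρ * h (v - u) := by
      rw [one_div, ← div_eq_inv_mul, le_div_iff₀ hη]; linarith
    nlinarith [mul_nonneg hh hl.le]

/-- Some odd fraction `δ` of `b` is so small that the boundary layer of width `δ` around a given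
compact set has small volume. -/
lemma exists_odd_fraction_volume_cthickening_lt {S : Set ℝ} (hS : IsCompact S) {b e : ℝ}
    (hb : 0 < b) (he : 0 < e) :
    ∃ δ > 0, ∃ m : ℤ, Odd m ∧ b = m * δ ∧
      volume.real (Metric.cthickening δ S \ S) + δ < e := by
  have h1 : Tendsto (fun δ => volume.real (Metric.cthickening δ S) - volume.real S + δ)
      (nhds 0) (nhds 0) := by
    have := (ENNReal.tendsto_toReal hS.measure_lt_top.ne).comp
      (tendsto_measure_cthickening_of_isCompact (μ := volume) hS)
    have h2 := (this.sub_const (volume.real S)).add (tendsto_id (x := nhds (0 : ℝ)))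
    simpa [Measure.real] using h2
  have h2 : Tendsto (fun n : ℕ => b / (2 * n + 1)) atTop (nhds 0) := by
    refine tendsto_const_nhds.div_atTop (tendsto_atTop_add_const_right _ _ ?_)
    exact tendsto_natCast_atTop_atTop.const_mul_atTop two_pos
  obtain ⟨n, hn⟩ := ((h1.comp h2).eventually_lt_const he).exists
  refine ⟨b / (2 * n + 1), by positivity, 2 * n + 1, ⟨n, rfl⟩, ?_, ?_⟩
  · push_cast; field_simp
  · rw [measureReal_sdiff (Metric.self_subset_cthickening S) hS.measurableSet
      hS.cthickening.measure_lt_top.ne]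
    exact hn

lemma FrostmanOn.exists_subset_forall_add_notMem {h : ℝ → ℝ} (hdim : IsDimFun h)
    (hprec : Prec h (fun x : ℝ => x)) {S : Set ℝ} (hS : IsCompact S)
    (hV : 0 < volume.real S) {c c' : ℝ} (hc : 0 < c) (hcc' : c < c') (hF : FrostmanOn h c S)
    {b : ℝ} (hb : b ≠ 0) :
    ∃ S' ⊆ S, IsCompact S' ∧ 0 < volume.real S' ∧ FrostmanOn h c' S' ∧
      ∀ x ∈ S', x + b ∉ S' := by
  wlog hb0 : 0 < b generalizing b
  · obtain ⟨S', h1, h2, h3, h4, h5⟩ := this (neg_ne_zero.2 hb)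
      (neg_pos.2 (lt_of_le_of_ne (not_lt.1 hb0) hb))
    exact ⟨S', h1, h2, h3, h4, fun x hx hxb => h5 _ hxb (by simpa using hx)⟩
  set V := volume.real S
  have hc' : 0 < c' := hc.trans hcc'
  obtain ⟨ρ, hρ, hs⟩ := exists_forall_le_mul_of_prec hdim hprec
    (show 0 < c' * (V / 4) by positivity)
  have hη := hdim.2.1 ρ hρ
  obtain ⟨e, he, heV, heη⟩ : ∃ e > 0, e ≤ V / 6 ∧ e * (1 + 3 * c' * h ρ) ≤ (c' - c) * h ρ * V := by
    have hd : 0 < c' - c := sub_pos.2 hcc'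
    have hp : 0 < 1 + 3 * c' * h ρ := by positivity
    refine ⟨min (V / 6) ((c' - c) * h ρ * V / (1 + 3 * c' * h ρ)), by positivity,
      min_le_left _ _, ?_⟩
    rw [← le_div_iff₀ hp]
    exact min_le_right _ _
  obtain ⟨δ, hδ, m, hm, hbm, hlt⟩ := exists_odd_fraction_volume_cthickening_lt hS hb0 he
  set G := evenCells δ
  have hG : MeasurableSet G := measurableSet_evenCells δ
  have hSt : volume S ≠ ⊤ := hS.measure_lt_top.ne
  have hGδ : ∀ x, x + δ ∈ G ↔ x ∉ G := by
    simpa using add_odd_mul_mem_evenCells hδ.ne' odd_one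
  have hRt : volume (Metric.cthickening δ S \ S) ≠ ⊤ :=
    measure_ne_top_of_subset sdiff_subset hS.cthickening.measure_lt_top.ne
  have hSR : ∀ x ∈ S, x + δ ∈ S ∪ (Metric.cthickening δ S \ S) := fun x hx => by
    by_cases h : x + δ ∈ S
    · exact Or.inl h
    · exact Or.inr ⟨Metric.mem_cthickening_of_dist_le _ x _ _ hx (by simp [abs_of_pos hδ]), h⟩
  have hlow : V - e ≤ 2 * volume.real (S ∩ G) := by
    have h1 := volume_real_inter_le_of_translate (G := Gᶜ) (H := G)
      (fun x hx => (hGδ x).2 hx) hSt hRt hSR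
    have h2 := measureReal_inter_add_sdiff (μ := volume) (s := S) hG hSt
    rw [sdiff_eq] at h2
    linarith
  have hup : ∀ u v, u ≤ v →
      2 * volume.real (S ∩ Icc u v ∩ G) ≤ volume.real (S ∩ Icc u v) + e := by
    intro u v huv
    have hTt : volume (S ∩ Icc u v) ≠ ⊤ := measure_ne_top_of_subset inter_subset_left hSt
    have hIt : volume (Icc v (v + δ)) ≠ ⊤ := by simp
    have h1 := volume_real_inter_le_of_translate (G := G) (H := Gᶜ) (T := S ∩ Icc u v)
      (R := (Metric.cthickening δ S \ S) ∪ Icc v (v + δ))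
      (δ := δ) (fun x hx hx' => (hGδ x).1 hx' hx) hTt (measure_union_ne_top hRt hIt) ?_
    · have h2 := measureReal_inter_add_sdiff (μ := volume) (s := S ∩ Icc u v) hG hTt
      have h3 := measureReal_union_le (μ := volume) (Metric.cthickening δ S \ S) (Icc v (v + δ))
      rw [Real.volume_real_Icc_of_le (by linarith)] at h3
      rw [sdiff_eq] at h2
      linarith
    · rintro x ⟨hx, hxu, hxv⟩
      rcases hSR x hx with h | h
      · rcases le_or_gt (x + δ) v with h' | h'
        · exact Or.inl ⟨h, by linarith, h'⟩
        · exact Or.inr (Or.inr ⟨h'.le, by linarith⟩)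
      · exact Or.inr (Or.inl h)
  have hSGt : volume (S ∩ G) ≠ ⊤ := measure_ne_top_of_subset inter_subset_left hSt
  obtain ⟨S', hS'G, hS'c, hS'lt⟩ := (hS.measurableSet.inter hG).exists_isCompact_lt_add hSGt
    (ENNReal.ofReal_pos.2 he).ne'
  have hS't : volume S' ≠ ⊤ := hS'c.measure_lt_top.ne
  have hS'low : volume.real (S ∩ G) ≤ volume.real S' + e := by
    have := ENNReal.toReal_mono (by simp [hS't]) hS'lt.le
    rwa [ENNReal.toReal_add hS't (by simp), ENNReal.toReal_ofReal he.le] at this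
  refine ⟨S', hS'G.trans inter_subset_left, hS'c, by linarith, fun u v huv => ?_,
    fun x hx hxb => ?_⟩
  · have h0 := sub_nonneg.2 huv
    have hh : 0 ≤ h (v - u) := by rw [← hdim.1]; exact hdim.2.2.1 self_mem_Ici h0 h0
    have hch : 0 ≤ c' * h (v - u) := by positivity
    rcases lt_or_ge (v - u) ρ with hr | hr
    · calc volume.real (S' ∩ Icc u v) ≤ v - u := volume_real_inter_Icc_le _ huv
        _ ≤ c' * (V / 4) * h (v - u) := hs _ h0 hr
        _ = c' * h (v - u) * (V / 4) := by ring
        _ ≤ _ := mul_le_mul_of_nonneg_left (by linarith) hch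
    · have h1 : h ρ ≤ h (v - u) := hdim.2.2.1 hρ.le h0 hr
      have h2 : volume.real (S' ∩ Icc u v) ≤ volume.real (S ∩ Icc u v ∩ G) :=
        measureReal_mono (fun x hx => ⟨⟨(hS'G hx.1).1, hx.2⟩, (hS'G hx.1).2⟩)
          (measure_ne_top_of_subset (inter_subset_left.trans inter_subset_left) hSt)
      have h3 := hup u v huv
      have h4 := hF u v huv
      have h5 : c' * h (v - u) * (V / 2 - 3 / 2 * e) ≤ c' * h (v - u) * volume.real S' :=
        mul_le_mul_of_nonneg_left (by linarith) hch
      have h6 : e * (1 + 3 * c' * h (v - u)) ≤ (c' - c) * h (v - u) * V := by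
        have h7 : 3 * c' * e ≤ (c' - c) * V := by
          by_contra! h8
          nlinarith
        nlinarith
      nlinarith
  · exact (add_odd_mul_mem_evenCells hδ.ne' hm x).1 (hbm ▸ (hS'G hxb).2) (hS'G hx).2

/-- The points of `F` whose exponential lies in `t` are contained in an open interval whose gauge
is at most that of `t`, up to an arbitrarily small error. -/
lemma exists_Ioo_of_ediam_ne_top {h : ℝ → ℝ} (hdim : IsDimFun h) {F t : Set ℝ}
    (hF0 : ∀ x ∈ F, 0 ≤ x) (ht : Metric.ediam t ≠ ⊤) {ε : ℝ} (hε : 0 < ε) :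
    ∃ u v : ℝ, u ≤ v ∧ (∀ x ∈ F, Real.exp x ∈ t → x ∈ Ioo u v) ∧
      ENNReal.ofReal (h (v - u)) ≤
        (⨆ _ : t.Nonempty, ENNReal.ofReal (h (Metric.ediam t).toReal)) + ENNReal.ofReal ε := by
  set W := {x ∈ F | Real.exp x ∈ t}
  rcases W.eq_empty_or_nonempty with hW | ⟨y, hyF, hyt⟩
  · refine ⟨0, 0, le_rfl, fun x hx hxt => ?_, by simp [hdim.1]⟩
    have : x ∈ W := ⟨hx, hxt⟩
    simp [hW] at this
  set d := (Metric.ediam t).toReal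
  have hd : 0 ≤ d := ENNReal.toReal_nonneg
  have hbdd : BddBelow W := ⟨0, fun x hx => hF0 x hx.1⟩
  have hdist : ∀ x ∈ W, ∀ z ∈ W, x - z ≤ d := by
    intro x hx z hz
    rcases le_total x z with hxz | hxz
    · linarith
    have h1 : Real.exp x - Real.exp z ≤ d := by
      have := Metric.dist_le_diam_of_mem' ht hx.2 hz.2
      exact (le_abs_self _).trans this
    have h2 : Real.exp x = Real.exp z * Real.exp (x - z) := by rw [← Real.exp_add]; ring_nf
    have h3 := Real.add_one_le_exp (x - z)
    have h4 := Real.one_le_exp (hF0 z hz.1)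
    nlinarith
  have hcont := hdim.2.2.2 d hd
  have h1 : ∀ᶠ x in nhdsWithin d (Ici d), h x < h d + ε :=
    hcont.eventually_lt_const (by linarith)
  obtain ⟨w, hw, hwsub⟩ := mem_nhdsGE_iff_exists_Ico_subset.1 h1
  have hw : d < w := hw
  refine ⟨sInf W - (w - d) / 4, sInf W + d + (w - d) / 4, by linarith, fun x hx hxt => ?_, ?_⟩
  · have hxW : x ∈ W := ⟨hx, hxt⟩
    have h2 := csInf_le hbdd hxW
    have h3 : x - d ≤ sInf W := le_csInf ⟨y, hyF, hyt⟩ fun z hz => by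
      have := hdist x hxW z hz; linarith
    exact ⟨by linarith, by linarith⟩
  · have h2 := hwsub (show d + (w - d) / 2 ∈ Ico d w from ⟨by linarith, by linarith⟩)
    rw [mem_ofPred_eq] at h2
    have h3 : sInf W + d + (w - d) / 4 - (sInf W - (w - d) / 4) = d + (w - d) / 2 := by ring
    rw [h3, iSup_pos ⟨_, hyt⟩]
    exact (ENNReal.ofReal_le_ofReal h2.le).trans ENNReal.ofReal_add_le

lemma gaugeMeasure_exp_image_iInter_pos {h : ℝ → ℝ} (hdim : IsDimFun h) {S : ℕ → Set ℝ}
    (hS : ∀ k, IsCompact (S k)) (hanti : Antitone S) (h0 : ∀ k, ∀ x ∈ S k, 0 ≤ x)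
    (hV : ∀ k, 0 < volume.real (S k)) {c : ℝ} (hc : 0 < c) (hF : ∀ k, FrostmanOn h c (S k)) :
    0 < gaugeMeasure h (Real.exp '' ⋂ k, S k) := by
  refine (ENNReal.ofReal_pos.2 (inv_pos.2 hc)).trans_le ?_
  rw [gaugeMeasure, Measure.mkMetric_apply]
  refine le_trans ?_ (le_iSup₂ (1 : ENNReal) one_pos)
  refine le_iInf fun t => le_iInf fun ht => le_iInf fun hd => ?_
  refine ENNReal.le_of_forall_pos_le_add fun ε hε _ => ?_
  obtain ⟨ε', hε', hsum⟩ := ENNReal.exists_pos_sum_of_countable' (ENNReal.coe_pos.2 hε).ne' ℕ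
  have hε't : ∀ n, ε' n ≠ ⊤ := fun n =>
    ((ENNReal.le_tsum n).trans_lt (hsum.trans ENNReal.coe_lt_top)).ne
  choose u v huv hmem hle using fun n => exists_Ioo_of_ediam_ne_top hdim (F := ⋂ k, S k)
    (fun x hx => h0 0 x (mem_iInter.1 hx 0)) ((hd n).trans_lt ENNReal.one_lt_top).ne
    (ENNReal.toReal_pos (hε' n).ne' (hε't n))
  have hcov : ⋂ k, S k ⊆ ⋃ n, Ioo (u n) (v n) := fun x hx => by
    obtain ⟨n, hn⟩ := mem_iUnion.1 (ht (mem_image_of_mem _ hx))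
    exact mem_iUnion.2 ⟨n, hmem n x hx hn⟩
  obtain ⟨k, hk⟩ := exists_subset_nhds_of_isCompact hanti.directed_ge hS
    (fun x hx => (isOpen_iUnion fun n => isOpen_Ioo).mem_nhds (hcov hx))
  have hSt : volume (S k) ≠ ⊤ := (hS k).measure_lt_top.ne
  have hpos : volume (S k) ≠ 0 := fun h => by simpa [Measure.real, h] using hV k
  have hbound : ∀ n, volume (S k ∩ Ioo (u n) (v n)) ≤
      ENNReal.ofReal c * ENNReal.ofReal (h (v n - u n)) * volume (S k) := fun n => by
    have h1 := hF k (u n) (v n) (huv n)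
    have h2 : volume (S k ∩ Icc (u n) (v n)) ≠ ⊤ := measure_ne_top_of_subset inter_subset_left hSt
    calc volume (S k ∩ Ioo (u n) (v n)) ≤ volume (S k ∩ Icc (u n) (v n)) :=
          measure_mono (inter_subset_inter_right _ Ioo_subset_Icc_self)
      _ = ENNReal.ofReal (volume.real (S k ∩ Icc (u n) (v n))) := (ENNReal.ofReal_toReal h2).symm
      _ ≤ ENNReal.ofReal (c * h (v n - u n) * volume.real (S k)) := ENNReal.ofReal_le_ofReal h1
      _ = _ := by
        rw [ENNReal.ofReal_mul' measureReal_nonneg, ENNReal.ofReal_mul hc.le, Measure.real,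
          ENNReal.ofReal_toReal hSt]
  have hone : 1 ≤ ENNReal.ofReal c * ∑' n, ENNReal.ofReal (h (v n - u n)) := by
    rw [← ENNReal.mul_le_mul_iff_left hpos hSt, one_mul]
    calc volume (S k) ≤ volume (⋃ n, S k ∩ Ioo (u n) (v n)) := by
          rw [← inter_iUnion]; exact measure_mono (subset_inter subset_rfl hk)
      _ ≤ ∑' n, volume (S k ∩ Ioo (u n) (v n)) := measure_iUnion_le _
      _ ≤ ∑' n, ENNReal.ofReal c * ENNReal.ofReal (h (v n - u n)) * volume (S k) :=
          ENNReal.tsum_le_tsum hbound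
      _ = _ := by rw [ENNReal.tsum_mul_right, ENNReal.tsum_mul_left]
  calc ENNReal.ofReal c⁻¹ = (ENNReal.ofReal c)⁻¹ := ENNReal.ofReal_inv_of_pos hc
    _ ≤ ∑' n, ENNReal.ofReal (h (v n - u n)) := by
        rw [ENNReal.inv_le_iff_le_mul (fun _ => by simpa using hc) (by simp)]
        exact hone
    _ ≤ ∑' n, ((⨆ _ : (t n).Nonempty, ENNReal.ofReal (h (Metric.ediam (t n)).toReal)) +
          ENNReal.ofReal (ε' n).toReal) := ENNReal.tsum_le_tsum hle
    _ ≤ _ := by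
        rw [ENNReal.tsum_add]
        gcongr
        simpa only [ENNReal.ofReal_toReal (hε't _)] using hsum.le

/-- Compact sets avoiding countably many differences, nested and uniformly Frostman. -/
lemma exists_antitone_frostmanOn_forall_add_notMem {h : ℝ → ℝ} (hdim : IsDimFun h)
    (hprec : Prec h (fun x : ℝ => x)) {l : ℝ} (hl : 0 < l) {b : ℕ → ℝ} (hb : ∀ k, b k ≠ 0) :
    ∃ S : ℕ → Set ℝ, ∃ c > 0, Antitone S ∧ S 0 = Icc 0 l ∧ (∀ k, IsCompact (S k)) ∧
      (∀ k, 0 < volume.real (S k)) ∧ (∀ k, FrostmanOn h c (S k)) ∧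
      ∀ k, ∀ x ∈ S (k + 1), x + b k ∉ S (k + 1) := by
  obtain ⟨c, hc, hc0⟩ := exists_frostmanOn_Icc hdim hprec hl
  let C : ℕ → ℝ := fun k => 2 * c - c / (k + 1)
  have hC0 : C 0 = c := by simp [C]; ring
  have hClt : ∀ k, C k < C (k + 1) := fun k => by
    simp only [C]; push_cast
    gcongr
    linarith
  have hCpos : ∀ k, 0 < C k := fun k =>
    (hC0 ▸ hc).trans_le ((strictMono_nat_of_lt_succ hClt).monotone (Nat.zero_le k))
  let P : ℕ → Set ℝ → Prop := fun k S => IsCompact S ∧ 0 < volume.real S ∧ FrostmanOn h (C k) S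
  have hstep : ∀ k S, P k S → ∃ S', P (k + 1) S' ∧ S' ⊆ S ∧ ∀ x ∈ S', x + b k ∉ S' := by
    rintro k S ⟨h1, h2, h3⟩
    obtain ⟨S', h4, h5, h6, h7, h8⟩ :=
      h3.exists_subset_forall_add_notMem hdim hprec h1 h2 (hCpos k) (hClt k) (hb k)
    exact ⟨S', ⟨h5, h6, h7⟩, h4, h8⟩
  choose! f hf using hstep
  let S : ℕ → Set ℝ := fun k => Nat.rec (Icc 0 l) f k
  have hP : ∀ k, P k (S k) := by
    intro k
    induction k with
    | zero =>
      refine ⟨isCompact_Icc, ?_, hC0.symm ▸ hc0⟩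
      simpa [S, Real.volume_real_Icc_of_le hl.le] using hl
    | succ k ih => exact (hf k _ ih).1
  refine ⟨S, 2 * c, by positivity, antitone_nat_of_succ_le fun k => (hf k _ (hP k)).2.1, rfl,
    fun k => (hP k).1, fun k => (hP k).2.1, fun k u v huv => ?_, fun k => (hf k _ (hP k)).2.2⟩
  have h0 := sub_nonneg.2 huv
  have hh : 0 ≤ h (v - u) := by rw [← hdim.1]; exact hdim.2.2.1 self_mem_Ici h0 h0
  refine ((hP k).2.2 u v huv).trans ?_
  gcongr
  have : 0 ≤ c / ((k : ℝ) + 1) := by positivity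
  simp only [C]; linarith

theorem stmt_9 (h : ℝ → ℝ) (hdim : IsDimFun h) (hprec : Prec h (fun x : ℝ => x))
    (A : Set ℝ) (hA : A.Countable) (hA1 : (1 : ℝ) ∉ A) :
    ∃ E : Set ℝ, E ⊆ Set.Icc 1 2 ∧ IsCompact E ∧ 0 < gaugeMeasure h E ∧
      ∀ a ∈ A, ∀ x ∈ E, ∀ y ∈ E, x ≠ y → a * x ≠ y := by
  obtain ⟨b, hb⟩ : ∃ b : ℕ → ℝ, insert 1 (Real.log '' (A ∩ Ioi 0)) = range b :=
    (((hA.mono inter_subset_left).image _).insert 1).exists_eq_range (insert_nonempty _ _)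
  have hb0 : ∀ k, b k ≠ 0 := by
    intro k
    rcases hb.symm ▸ mem_range_self k with h1 | ⟨a, ⟨haA, ha⟩, h1⟩
    · simp [h1]
    · rw [← h1]
      exact Real.log_ne_zero_of_pos_of_ne_one ha fun h => hA1 (h ▸ haA)
  obtain ⟨S, c, hc, hanti, hS0, hS, hV, hF, hav⟩ :=
    exists_antitone_frostmanOn_forall_add_notMem hdim hprec (Real.log_pos one_lt_two) hb0
  have hsub : ∀ k, S k ⊆ Icc 0 (Real.log 2) := fun k => (hanti (Nat.zero_le k)).trans hS0.subset
  refine ⟨Real.exp '' ⋂ k, S k, ?_,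
    ((hS 0).of_isClosed_subset (isClosed_iInter fun k => (hS k).isClosed)
      (iInter_subset _ 0)).image Real.continuous_exp,
    gaugeMeasure_exp_image_iInter_pos hdim hS hanti (fun k x hx => (hsub k hx).1) hV hc hF, ?_⟩
  · rintro _ ⟨x, hx, rfl⟩
    have hx := hsub 0 (mem_iInter.1 hx 0)
    refine ⟨Real.one_le_exp hx.1, ?_⟩
    rw [← Real.le_log_iff_exp_le two_pos]
    exact hx.2
  · rintro a ha _ ⟨x, hx, rfl⟩ _ ⟨y, hy, rfl⟩ - hxy
    have ha0 : 0 < a := pos_of_mul_pos_left (hxy ▸ Real.exp_pos y) (Real.exp_pos x).le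
    obtain ⟨k, hk⟩ : Real.log a ∈ range b := hb ▸ Or.inr ⟨a, ⟨ha, ha0⟩, rfl⟩
    have hyx : x + b k = y := by
      rw [hk, ← Real.log_exp y, ← hxy, Real.log_mul ha0.ne' (Real.exp_pos x).ne', Real.log_exp,
        add_comm]
    exact hav k x (mem_iInter.1 hx _) (hyx ▸ mem_iInter.1 hy _)
end

section
/- Given a dimension function h with h ≺ x and a countable family of planes π_k through the origin in ℝ³, there exists a compact set E ⊆ ℝ with ℋ^h(E) > 0 such that for all k and all pairwise distinct x, y, z ∈ E, the point (x, y, z) does not lie on π_k. -/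
open MeasureTheory Filter Set

/-- The staircase map sending each cell `[m * p, (m + 1) * p)` affinely onto the first eighth of
that cell, followed by a translation by `p * β`. -/
noncomputable def stair (p β x : ℝ) : ℝ := p * (β + (7 * (⌊x / p⌋ : ℝ) + x / p) / 8)

theorem stair_eq (p β x : ℝ) : stair p β x = p * (β + ⌊x / p⌋ + Int.fract (x / p) / 8) := by
  rw [stair, Int.fract]; ring

theorem stair_bounds {p : ℝ} (hp : 0 < p) (β x : ℝ) :
    x + p * (β - 1) ≤ stair p β x ∧ stair p β x ≤ x + p * β := by
  have h0 := Int.fract_nonneg (x / p)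
  have h1 := (Int.fract_lt_one (x / p)).le
  have hx : p * ((⌊x / p⌋ : ℝ) + Int.fract (x / p)) = x := by
    rw [Int.floor_add_fract]; field_simp
  rw [stair_eq]
  constructor <;> nlinarith [mul_nonneg hp.le h0, mul_le_mul_of_nonneg_left h1 hp.le]

theorem sub_le_stair_sub {p : ℝ} (hp : 0 < p) (β : ℝ) {x y : ℝ} (hxy : x ≤ y) :
    y - x ≤ 8 * (stair p β y - stair p β x) := by
  have hdiv : x / p ≤ y / p := by gcongr
  have hfl : (⌊x / p⌋ : ℝ) ≤ ⌊y / p⌋ := by exact_mod_cast Int.floor_mono hdiv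
  have h1 : p * (x / p) = x := by field_simp
  have h2 : p * (y / p) = y := by field_simp
  have h3 := mul_le_mul_of_nonneg_left hfl hp.le
  unfold stair
  nlinarith

theorem exists_pos_mul_eq_int (a : ℝ) :
    ∃ s > 0, ∃ e : ℤ, a * s = e ∧ |(e : ℝ)| ≤ 1 ∧ (a ≠ 0 → e = 1 ∨ e = -1) := by
  rcases lt_trichotomy a 0 with h | h | h
  · refine ⟨-a⁻¹, by simpa using h, -1, ?_, by simp, by simp⟩
    have := h.ne
    push_cast; field_simp
  · exact ⟨1, one_pos, 0, by simp [h], by simp, by simp [h]⟩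
  · refine ⟨a⁻¹, by positivity, 1, ?_, by simp, by simp⟩
    have := h.ne'
    push_cast; field_simp

/-- Three phases whose combination with the signs `e`, `f`, `g` is a half-integer. -/
theorem exists_half_integer_phases {e f g : ℤ}
    (h : (e = 1 ∨ e = -1) ∨ (f = 1 ∨ f = -1) ∨ (g = 1 ∨ g = -1)) :
    ∃ α β γ : ℝ, (0 ≤ α ∧ α ≤ 1) ∧ (0 ≤ β ∧ β ≤ 1) ∧ (0 ≤ γ ∧ γ ≤ 1) ∧
      ∃ N : ℤ, e * α + f * β + g * γ = N + 1 / 2 := by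
  have key : ∀ m : ℤ, (m = 1 ∨ m = -1) → ∃ N : ℤ, (m : ℝ) * (1 / 2) = N + 1 / 2 := by
    rintro m (rfl | rfl)
    · exact ⟨0, by norm_num⟩
    · exact ⟨-1, by norm_num⟩
  rcases h with h | h | h <;> obtain ⟨N, hN⟩ := key _ h
  · exact ⟨1 / 2, 0, 0, by norm_num, by norm_num, by norm_num, N, by linarith⟩
  · exact ⟨0, 1 / 2, 0, by norm_num, by norm_num, by norm_num, N, by linarith⟩
  · exact ⟨0, 0, 1 / 2, by norm_num, by norm_num, by norm_num, N, by linarith⟩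

theorem half_le_abs_int_add_half (m : ℤ) : 1 / 2 ≤ |(m : ℝ) + 1 / 2| := by
  rcases le_or_gt 0 m with h | h
  · have : (0 : ℝ) ≤ m := by exact_mod_cast h
    rw [abs_of_nonneg (by linarith)]; linarith
  · have : (m : ℝ) ≤ -1 := by exact_mod_cast (by omega : m ≤ -1)
    rw [abs_of_nonpos (by linarith)]; linarith

theorem abs_int_mul_fract_div_le {e : ℤ} (he : |(e : ℝ)| ≤ 1) (r : ℝ) :
    |(e : ℝ) * (Int.fract r / 8)| ≤ 1 / 8 := by
  have h0 := Int.fract_nonneg r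
  have h1 := (Int.fract_lt_one r).le
  rw [abs_mul, abs_of_nonneg (by positivity : (0 : ℝ) ≤ Int.fract r / 8)]
  nlinarith [abs_nonneg (e : ℝ)]

/-- Points in the ranges of suitably phased staircase maps stay away from the plane. -/
theorem abs_linear_stair_ge {a b c s₀ s₁ s₂ L : ℝ} {e₀ e₁ e₂ N : ℤ} {B₁ B₂ : ℕ}
    {α β γ : ℝ}     (hL : 0 < L) (ha : a * s₀ = e₀) (hb : b * s₁ = e₁) (hc : c * s₂ = e₂)
    (he₀ : |(e₀ : ℝ)| ≤ 1) (he₁ : |(e₁ : ℝ)| ≤ 1) (he₂ : |(e₂ : ℝ)| ≤ 1)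
    (hN : e₀ * α + e₁ * β + e₂ * γ = N + 1 / 2) (x y z : ℝ) :
    L / 8 ≤ |a * stair (L * s₀) α x + b * stair (L * s₁) (B₁ + β) y +
      c * stair (L * s₂) (B₂ + γ) z| := by
  simp only [stair_eq]
  set i := ⌊x / (L * s₀)⌋
  set j := ⌊y / (L * s₁)⌋
  set k := ⌊z / (L * s₂)⌋
  have hx := abs_int_mul_fract_div_le he₀ (x / (L * s₀))
  have hy := abs_int_mul_fract_div_le he₁ (y / (L * s₁))
  have hz := abs_int_mul_fract_div_le he₂ (z / (L * s₂))
  set u := (e₀ : ℝ) * (Int.fract (x / (L * s₀)) / 8) with hu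
  set v := (e₁ : ℝ) * (Int.fract (y / (L * s₁)) / 8) with hv
  set w := (e₂ : ℝ) * (Int.fract (z / (L * s₂)) / 8) with hw
  have hm := half_le_abs_int_add_half (N + e₀ * i + e₁ * (B₁ + j) + e₂ * (B₂ + k))
  push_cast at hm
  set M : ℝ := N + e₀ * i + e₁ * (B₁ + j) + e₂ * (B₂ + k) with hM
  have heq : a * (L * s₀ * (α + i + Int.fract (x / (L * s₀)) / 8)) +
      b * (L * s₁ * (B₁ + β + j + Int.fract (y / (L * s₁)) / 8)) +
      c * (L * s₂ * (B₂ + γ + k + Int.fract (z / (L * s₂)) / 8)) =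
      L * (M + 1 / 2 + (u + v + w)) := by
    rw [hM, hu, hv, hw]
    linear_combination
      (L * (α + i + Int.fract (x / (L * s₀)) / 8)) * ha +
      (L * (B₁ + β + j + Int.fract (y / (L * s₁)) / 8)) * hb +
      (L * (B₂ + γ + k + Int.fract (z / (L * s₂)) / 8)) * hc + L * hN
  rw [heq, abs_mul, abs_of_pos hL]
  have h1 : |M + 1 / 2| - |u + v + w| ≤ |M + 1 / 2 + (u + v + w)| := by
    have := abs_sub_abs_le_abs_sub (M + 1 / 2) (-(u + v + w))
    rwa [abs_neg, sub_neg_eq_add] at this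
  have h2 : |u + v + w| ≤ |u| + |v| + |w| := abs_add_three u v w
  nlinarith

/-- Gluing expanding maps along two cuts keeps the expansion if the displacements increase. -/
theorem abs_sub_le_piecewise {f g k : ℝ → ℝ} (p q : ℝ)
    (hf : ∀ x y, x ≤ y → y - x ≤ 8 * (f y - f x)) (hg : ∀ x y, x ≤ y → y - x ≤ 8 * (g y - g x))
    (hk : ∀ x y, x ≤ y → y - x ≤ 8 * (k y - k x)) (hfg : ∀ x y, f x - x ≤ g y - y)
    (hgk : ∀ x y, g x - x ≤ k y - y) (x y : ℝ) :
    |x - y| ≤ 8 * |(if x < p then f x else if x < q then g x else k x) -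
      (if y < p then f y else if y < q then g y else k y)| := by
  have key : ∀ x y : ℝ, x ≤ y →
      y - x ≤ 8 * ((if y < p then f y else if y < q then g y else k y) -
        (if x < p then f x else if x < q then g x else k x)) := by
    intro x y hxy
    have h1 := hf x y hxy
    have h2 := hg x y hxy
    have h3 := hk x y hxy
    have h4 := hfg x y
    have h5 := hgk x y
    have h6 := hfg x x
    split_ifs <;> linarith
  rcases le_total x y with hxy | hxy
  · rw [abs_sub_comm, abs_of_nonneg (sub_nonneg.2 hxy), abs_sub_comm]
    exact (key x y hxy).trans (by gcongr; exact le_abs_self _)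
  · rw [abs_of_nonneg (sub_nonneg.2 hxy)]
    exact (key y x hxy).trans (by gcongr; exact le_abs_self _)

/-- Three staircase maps at scale `L`, with increasing displacements of size `O(L)`, whose combined
range stays at distance `L / 8` from a given plane. -/
theorem exists_three_stairs {a b c : ℝ} (habc : a ≠ 0 ∨ b ≠ 0 ∨ c ≠ 0) :
    ∃ K > 0, ∀ L > 0, ∃ f g k : ℝ → ℝ,
      (∀ x, |f x - x| ≤ L * K) ∧ (∀ x, |g x - x| ≤ L * K) ∧ (∀ x, |k x - x| ≤ L * K) ∧
      (∀ x y, x ≤ y → y - x ≤ 8 * (f y - f x)) ∧ (∀ x y, x ≤ y → y - x ≤ 8 * (g y - g x)) ∧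
      (∀ x y, x ≤ y → y - x ≤ 8 * (k y - k x)) ∧ (∀ x y, f x - x ≤ g y - y) ∧
      (∀ x y, g x - x ≤ k y - y) ∧ ∀ x y z, L / 8 ≤ |a * f x + b * g y + c * k z| := by
  obtain ⟨s₀, hs₀, e₀, ha, he₀, ha'⟩ := exists_pos_mul_eq_int a
  obtain ⟨s₁, hs₁, e₁, hb, he₁, hb'⟩ := exists_pos_mul_eq_int b
  obtain ⟨s₂, hs₂, e₂, hc, he₂, hc'⟩ := exists_pos_mul_eq_int c
  obtain ⟨α, β, γ, hα, hβ, hγ, N, hN⟩ := exists_half_integer_phases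
    (habc.imp ha' (Or.imp hb' hc'))
  obtain ⟨B₁, hB₁⟩ := exists_nat_ge (1 + s₀ / s₁)
  obtain ⟨B₂, hB₂⟩ := exists_nat_ge (1 + s₁ * (B₁ + 1) / s₂)
  have h01 : s₀ ≤ s₁ * (B₁ - 1) := by
    have : s₀ / s₁ ≤ B₁ - 1 := by linarith
    rwa [div_le_iff₀' hs₁] at this
  have h12 : s₁ * (B₁ + 1) ≤ s₂ * (B₂ - 1) := by
    have : s₁ * (B₁ + 1) / s₂ ≤ B₂ - 1 := by linarith
    rwa [div_le_iff₀' hs₂] at this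
  refine ⟨s₀ + s₁ * (B₁ + 1) + s₂ * (B₂ + 1), by positivity, fun L hL => ?_⟩
  have hp₀ : 0 < L * s₀ := by positivity
  have hp₁ : 0 < L * s₁ := by positivity
  have hp₂ : 0 < L * s₂ := by positivity
  have hfl : ∀ x, x - L * s₀ ≤ stair (L * s₀) α x ∧ stair (L * s₀) α x ≤ x + L * s₀ := fun x => by
    have h1 := stair_bounds hp₀ α x
    have h2 := mul_nonneg hp₀.le hα.1
    have h3 := mul_le_mul_of_nonneg_left hα.2 hp₀.le
    constructor <;> linarith
  have hgl : ∀ x, x + L * (s₁ * (B₁ - 1)) ≤ stair (L * s₁) (B₁ + β) x ∧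
      stair (L * s₁) (B₁ + β) x ≤ x + L * (s₁ * (B₁ + 1)) := fun x => by
    have h1 := stair_bounds hp₁ (B₁ + β) x
    have h2 := mul_nonneg hp₁.le hβ.1
    have h3 := mul_le_mul_of_nonneg_left hβ.2 hp₁.le
    constructor <;> linarith
  have hkl : ∀ x, x + L * (s₂ * (B₂ - 1)) ≤ stair (L * s₂) (B₂ + γ) x ∧
      stair (L * s₂) (B₂ + γ) x ≤ x + L * (s₂ * (B₂ + 1)) := fun x => by
    have h1 := stair_bounds hp₂ (B₂ + γ) x
    have h2 := mul_nonneg hp₂.le hγ.1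
    have h3 := mul_le_mul_of_nonneg_left hγ.2 hp₂.le
    constructor <;> linarith
  have m01 := mul_le_mul_of_nonneg_left h01 hL.le
  have m12 := mul_le_mul_of_nonneg_left h12 hL.le
  have m11 : 0 ≤ L * (s₁ * (B₁ + 1)) := by positivity
  have m22 : 0 ≤ L * (s₂ * (B₂ + 1)) := by positivity
  rw [mul_add, mul_add]
  refine ⟨stair (L * s₀) α, stair (L * s₁) (B₁ + β), stair (L * s₂) (B₂ + γ), fun x => ?_,
    fun x => ?_, fun x => ?_, fun _ _ => sub_le_stair_sub hp₀ _, fun _ _ => sub_le_stair_sub hp₁ _,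
    fun _ _ => sub_le_stair_sub hp₂ _, fun x y => ?_, fun x y => ?_,
    abs_linear_stair_ge hL ha hb hc he₀ he₁ he₂ hN⟩
  · exact abs_le.2 ⟨by linarith [hfl x], by linarith [hfl x]⟩
  · exact abs_le.2 ⟨by linarith [hgl x], by linarith [hgl x]⟩
  · exact abs_le.2 ⟨by linarith [hkl x], by linarith [hkl x]⟩
  · linarith [(hfl x).2, (hgl y).1]
  · linarith [(hgl x).2, (hkl y).1]

/-- A small expanding perturbation of the identity, after which triples separated by `p` and `q`
avoid a neighbourhood of a given plane. -/
theorem exists_avoiding_perturbation {a b c : ℝ} (habc : a ≠ 0 ∨ b ≠ 0 ∨ c ≠ 0) (p q : ℝ) :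
    ∃ θ : ℝ, 0 < θ ∧ θ ≤ 1 ∧ ∀ ε > 0, ∃ t : ℝ → ℝ, (∀ x, |t x - x| ≤ ε) ∧
      (∀ x y, |x - y| ≤ 8 * |t x - t y|) ∧
      ∀ x y z x' y' z', x < p → p ≤ y → y < q → p ≤ z → q ≤ z →
        |x' - t x| ≤ θ * ε → |y' - t y| ≤ θ * ε → |z' - t z| ≤ θ * ε →
        a * x' + b * y' + c * z' ≠ 0 := by
  obtain ⟨K, hK, hstairs⟩ := exists_three_stairs habc
  refine ⟨min 1 (1 / (8 * K * (|a| + |b| + |c| + 1))), by positivity, min_le_left _ _,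
    fun ε hε => ?_⟩
  obtain ⟨f, g, k, hf, hg, hk, hf', hg', hk', hfg, hgk, hge⟩ := hstairs (ε / K) (by positivity)
  rw [div_mul_cancel₀ _ hK.ne'] at hf hg hk
  have hθ : min 1 (1 / (8 * K * (|a| + |b| + |c| + 1))) * ε * (|a| + |b| + |c| + 1) ≤
      ε / K / 8 := by
    calc _ ≤ 1 / (8 * K * (|a| + |b| + |c| + 1)) * ε * (|a| + |b| + |c| + 1) := by
          gcongr; exact min_le_right _ _
      _ = ε / K / 8 := by field_simp
  have hθε : 0 < min 1 (1 / (8 * K * (|a| + |b| + |c| + 1))) * ε := by positivity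
  generalize min 1 (1 / (8 * K * (|a| + |b| + |c| + 1))) * ε = η at hθ hθε ⊢
  refine ⟨fun x => if x < p then f x else if x < q then g x else k x, fun x => ?_,
    abs_sub_le_piecewise p q hf' hg' hk' hfg hgk, ?_⟩
  · dsimp only
    split_ifs
    exacts [hf x, hg x, hk x]
  · intro x y z x' y' z' hx hy hy' hz hz' dx dy dz h0
    simp only [hx, if_true] at dx
    simp only [not_lt.2 hy, hy', if_true, if_false] at dy
    simp only [not_lt.2 hz, not_lt.2 hz', if_false] at dz
    have hge' := hge x y z
    have heq : a * f x + b * g y + c * k z =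
        -(a * (x' - f x) + b * (y' - g y) + c * (z' - k z)) := by linear_combination h0
    rw [heq, abs_neg] at hge'
    have h3 := abs_add_three (a * (x' - f x)) (b * (y' - g y)) (c * (z' - k z))
    rw [abs_mul, abs_mul, abs_mul] at h3
    have h4 := mul_le_mul_of_nonneg_left dx (abs_nonneg a)
    have h5 := mul_le_mul_of_nonneg_left dy (abs_nonneg b)
    have h6 := mul_le_mul_of_nonneg_left dz (abs_nonneg c)
    linarith

theorem exists_scales {ρ θ : ℕ → ℝ} (hρ : ∀ n, 0 < ρ n) (hθ : ∀ n, 0 < θ n) :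
    ∃ ε : ℕ → ℝ, ∀ n, 0 < ε n ∧ 2 * ε n ≤ ρ (n + 1) ∧ 4 * ε (n + 1) ≤ θ n * ε n := by
  let ε : ℕ → ℝ := fun n => Nat.rec (ρ 1 / 2) (fun n e => min (ρ (n + 2)) (θ n * e) / 4) n
  have hs : ∀ n, ε (n + 1) = min (ρ (n + 2)) (θ n * ε n) / 4 := fun _ => rfl
  have hpos : ∀ n, 0 < ε n := by
    intro n
    induction n with
    | zero => exact half_pos (hρ 1)
    | succ n ih =>
      rw [hs]
      have := hρ (n + 2)
      have := hθ n
      positivity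
  refine ⟨ε, fun n => ⟨hpos n, ?_, ?_⟩⟩
  · cases n with
    | zero => exact (by ring : 2 * (ρ 1 / 2) = ρ 1).le
    | succ n =>
      rw [hs]
      linarith [min_le_left (ρ (n + 2)) (θ n * ε n), hρ (n + 2)]
  · rw [hs]
    linarith [min_le_right (ρ (n + 2)) (θ n * ε n)]

theorem exists_limit_of_abs_sub_le {ε : ℕ → ℝ} (hε : ∀ n, 2 * ε (n + 1) ≤ ε n)
    (hε0 : ∀ n, 0 ≤ ε n) {x : ℕ → ℝ} (hx : ∀ n, |x (n + 1) - x n| ≤ ε n) :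
    ∃ y, ∀ n, |y - x n| ≤ 2 * ε n := by
  have hanti : Antitone fun n => Icc (x n - 2 * ε n) (x n + 2 * ε n) := by
    refine antitone_nat_of_succ_le fun n => ?_
    have h1 := abs_le.1 (hx n)
    have h2 := hε n
    exact Icc_subset_Icc (by linarith) (by linarith)
  refine ⟨⨆ n, (x n - 2 * ε n), fun n => ?_⟩
  have := mem_iInter.1 (ciSup_mem_iInter_Icc_of_antitone_Icc hanti fun n => by linarith [hε0 n]) n
  rw [abs_le]
  exact ⟨by linarith [this.1], by linarith [this.2]⟩

theorem Prec.exists_thresholds {h : ℝ → ℝ} (hpos : ∀ t > 0, 0 < h t)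
    (hprec : Prec h (fun x : ℝ => x)) :
    ∃ ρ : ℕ → ℝ, (∀ n, 0 < ρ n ∧ ρ n ≤ (1 / 16) ^ n) ∧
      ∀ n r, 0 < r → r < ρ n → 3 * 8 ^ n * r ≤ h r := by
  have key : ∀ n : ℕ, ∃ ρ > 0, ∀ r, 0 < r → r < ρ → 3 * 8 ^ n * r ≤ h r := by
    intro n
    have h1 : ∀ᶠ x in nhdsWithin (0 : ℝ) (Ioi 0), x / h x < 1 / (3 * 8 ^ n) :=
      hprec.eventually (gt_mem_nhds (by positivity))
    obtain ⟨ρ, hρ, hsub⟩ := mem_nhdsGT_iff_exists_Ioo_subset.1 h1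
    refine ⟨ρ, hρ, fun r hr0 hr => ?_⟩
    have h2 : r / h r < 1 / (3 * 8 ^ n) := hsub ⟨hr0, hr⟩
    rw [div_lt_div_iff₀ (hpos r hr0) (by positivity)] at h2
    linarith
  choose ρ hρ hr using key
  refine ⟨fun n => min (ρ n) ((1 / 16) ^ n), fun n => ⟨?_, min_le_right _ _⟩, fun n r h0 h1 => ?_⟩
  · have := hρ n
    positivity
  · exact hr n r h0 (h1.trans_le (min_le_left _ _))

/-- If `X` admits an inverse with modulus of continuity `C * h`, its image of the unit interval
has positive `h`-measure. -/
theorem gaugeMeasure_image_pos {h : ℝ → ℝ} (hmono : MonotoneOn h (Ici 0)) {C : ℝ} (hC : 0 ≤ C)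
    {X : ℝ → ℝ}
    (hX : ∀ u ∈ Icc (0 : ℝ) 1, ∀ v ∈ Icc (0 : ℝ) 1, |u - v| ≤ C * h |X u - X v|) :
    0 < gaugeMeasure h (X '' Icc 0 1) := by
  have key : ∀ t : ℕ → Set ℝ, X '' Icc 0 1 ⊆ ⋃ n, t n → (∀ n, Metric.ediam (t n) ≤ 1) →
      1 ≤ ENNReal.ofReal C *
        ∑' n, ⨆ _ : (t n).Nonempty, ENNReal.ofReal (h (Metric.ediam (t n)).toReal) := by
    intro t hcov hdiam
    have hsub : Icc (0 : ℝ) 1 ⊆ ⋃ n, Icc 0 1 ∩ X ⁻¹' t n := fun u hu => by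
      obtain ⟨n, hn⟩ := mem_iUnion.1 (hcov (mem_image_of_mem X hu))
      exact mem_iUnion.2 ⟨n, hu, hn⟩
    calc (1 : ENNReal) = volume (Icc (0 : ℝ) 1) := by simp
      _ ≤ ∑' n, volume (Icc 0 1 ∩ X ⁻¹' t n) := (measure_mono hsub).trans (measure_iUnion_le _)
      _ ≤ ∑' n, ENNReal.ofReal C *
          ⨆ _ : (t n).Nonempty, ENNReal.ofReal (h (Metric.ediam (t n)).toReal) := by
        refine ENNReal.tsum_le_tsum fun n => (Real.volume_le_diam _).trans ?_
        refine Metric.ediam_le fun u hu v hv => ?_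
        have hne : (t n).Nonempty := ⟨X u, hu.2⟩
        rw [iSup_pos hne, ← ENNReal.ofReal_mul hC, edist_dist, Real.dist_eq]
        refine ENNReal.ofReal_le_ofReal ((hX u hu.1 v hv.1).trans ?_)
        refine mul_le_mul_of_nonneg_left (hmono (mem_Ici.2 (abs_nonneg _)) ENNReal.toReal_nonneg ?_) hC
        have htop : Metric.ediam (t n) ≠ ⊤ := ((hdiam n).trans_lt ENNReal.one_lt_top).ne
        have := ENNReal.toReal_mono htop (Metric.edist_le_ediam_of_mem hu.2 hv.2)
        rwa [edist_dist, Real.dist_eq, ENNReal.toReal_ofReal (abs_nonneg _)] at this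
      _ = _ := ENNReal.tsum_mul_left
  refine lt_of_lt_of_le (b := (ENNReal.ofReal C)⁻¹) (by simp) ?_
  rw [gaugeMeasure, Measure.mkMetric_apply]
  refine le_iSup₂_of_le (1 : ENNReal) one_pos (le_iInf₂ fun t hcov => le_iInf fun hdiam => ?_)
  rw [ENNReal.inv_le_iff_le_mul]
  · exact key t hcov hdiam
  · intro hS h0
    simpa [h0, hS] using key t hcov hdiam
  · simp

theorem exists_modulus {h : ℝ → ℝ} (hdim : IsDimFun h) {ρ ε : ℕ → ℝ}
    (hρ : ∀ n, 0 < ρ n ∧ ρ n ≤ (1 / 16) ^ n)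
    (hρh : ∀ n r, 0 < r → r < ρ n → 3 * 8 ^ n * r ≤ h r)
    (hε : ∀ n, 2 * ε n ≤ ρ (n + 1)) {X : ℝ → ℝ}
    (hX : ∀ n u v, |u - v| ≤ 8 ^ n * (|X u - X v| + 4 * ε n)) :
    ∃ C ≥ 0, ∀ u ∈ Icc (0 : ℝ) 1, ∀ v ∈ Icc (0 : ℝ) 1, |u - v| ≤ C * h |X u - X v| := by
  obtain ⟨h0, hpos, hmono, -⟩ := hdim
  have hρlim : Tendsto (fun n : ℕ => (1 / 16 : ℝ) ^ n) atTop (nhds 0) :=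
    tendsto_pow_atTop_nhds_zero_of_lt_one (by norm_num) (by norm_num)
  have hρ0 := hpos _ (hρ 0).1
  refine ⟨max 1 (1 / h (ρ 0)), by positivity, fun u hu v hv => ?_⟩
  set r := |X u - X v| with hr
  rcases (abs_nonneg (X u - X v)).eq_or_lt with hr0 | hr0
  · have hr0' : r = 0 := hr0.symm
    have hlim : Tendsto (fun n : ℕ => (1 / 2 : ℝ) ^ n) atTop (nhds 0) :=
      tendsto_pow_atTop_nhds_zero_of_lt_one (by norm_num) (by norm_num)
    rw [hr0', h0, mul_zero]
    refine ge_of_tendsto' hlim fun n => (hX n u v).trans ?_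
    rw [← hr, hr0']
    have h1 := (hε n).trans (hρ (n + 1)).2
    have h2 : (8 : ℝ) ^ n * (1 / 16) ^ n = (1 / 2) ^ n := by rw [← mul_pow]; norm_num
    have h3 := mul_le_mul_of_nonneg_left h1 (by positivity : (0 : ℝ) ≤ 8 ^ n)
    have h4 : (0 : ℝ) ≤ (1 / 2) ^ n := by positivity
    rw [pow_succ, ← mul_assoc (8 ^ n) ((1 / 16) ^ n), h2] at h3
    linarith
  · have hhr := hpos r hr0
    rcases lt_or_ge r (ρ 0) with hlt | hge
    · have hex : ∃ m, ρ m ≤ r := by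
        obtain ⟨m, hm⟩ := (hρlim.eventually (gt_mem_nhds hr0)).exists
        exact ⟨m, (hρ m).2.trans hm.le⟩
      classical
      obtain ⟨n, hn⟩ : ∃ n, Nat.find hex = n + 1 := by
        refine Nat.exists_eq_succ_of_ne_zero fun hz => ?_
        have := Nat.find_spec hex
        rw [hz] at this
        linarith
      have h1 : ρ (n + 1) ≤ r := hn ▸ Nat.find_spec hex
      have h2 : r < ρ n := not_le.1 (Nat.find_min hex (by omega))
      calc |u - v| ≤ 8 ^ n * (r + 4 * ε n) := hX n u v
        _ ≤ 8 ^ n * (3 * r) := by gcongr; linarith [hε n]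
        _ ≤ 1 * h r := by linarith [hρh n r hr0 h2]
        _ ≤ _ := by gcongr; exact le_max_left _ _
    · calc |u - v| ≤ 1 := abs_le.2 ⟨by linarith [hu.1, hv.2], by linarith [hu.2, hv.1]⟩
        _ = 1 / h (ρ 0) * h (ρ 0) := by field_simp
        _ ≤ 1 / h (ρ 0) * h r := by
          gcongr
          exact hmono (hρ 0).1.le hr0.le hge
        _ ≤ _ := by gcongr; exact le_max_right _ _

/-- Avoidance of countably many planes by increasing triples. -/
theorem exists_compact_avoiding_increasing_triples {h : ℝ → ℝ} (hdim : IsDimFun h)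
    (hprec : Prec h (fun x : ℝ => x)) {ι : Type*} [Countable ι] [Nonempty ι]
    {c : ι → Fin 3 → ℝ} (hc : ∀ i, c i ≠ 0) :
    ∃ E : Set ℝ, IsCompact E ∧ 0 < gaugeMeasure h E ∧
      ∀ i, ∀ x ∈ E, ∀ y ∈ E, ∀ z ∈ E, x < y → y < z →
        c i 0 * x + c i 1 * y + c i 2 * z ≠ 0 := by
  obtain ⟨ρ, hρ, hρh⟩ := hprec.exists_thresholds hdim.2.1
  obtain ⟨F, hF⟩ := exists_surjective_nat (ι × ℚ × ℚ)
  let task : ℕ → ι × ℚ × ℚ := fun n => F n.unpair.1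
  have hne : ∀ n, c (task n).1 0 ≠ 0 ∨ c (task n).1 1 ≠ 0 ∨ c (task n).1 2 ≠ 0 := by
    intro n
    by_contra! h0
    exact hc (task n).1 (funext fun j => by fin_cases j <;> simp [h0])
  choose θ hθ hθ1 hT using fun n =>
    exists_avoiding_perturbation (hne n) ((task n).2.1 : ℝ) ((task n).2.2 : ℝ)
  obtain ⟨ε, hε⟩ := exists_scales (fun n => (hρ n).1) hθ
  have hεpos n : 0 < ε n := (hε n).1
  choose t ht hexp havoid using fun n => hT n (ε n) (hεpos n)
  let x : ℕ → ℝ → ℝ := fun n u => Nat.rec u (fun n y => t n y) n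
  have hx : ∀ n u, x (n + 1) u = t n (x n u) := fun _ _ => rfl
  have hεhalf : ∀ n, 2 * ε (n + 1) ≤ ε n := fun n => by
    nlinarith [(hε n).2.2, hθ1 n, hεpos n, hεpos (n + 1)]
  choose X hX using fun u => exists_limit_of_abs_sub_le hεhalf (fun n => (hεpos n).le)
    (x := fun n => x n u) fun n => by rw [hx]; exact ht n _
  have hxexp : ∀ n u v, |u - v| ≤ 8 ^ n * |x n u - x n v| := by
    intro n u v
    induction n with
    | zero => simp [x]
    | succ n ih =>
      refine ih.trans ?_
      rw [hx, hx, pow_succ, mul_assoc]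
      gcongr
      exact hexp n _ _
  have hXexp : ∀ n u v, |u - v| ≤ 8 ^ n * (|X u - X v| + 4 * ε n) := by
    intro n u v
    refine (hxexp n u v).trans ?_
    gcongr
    have h1 := hX u n
    have h2 := hX v n
    have h3 := abs_add_three (x n u - X u) (X u - X v) (X v - x n v)
    rw [abs_sub_comm (x n u) (X u)] at h3
    rw [show x n u - x n v = x n u - X u + (X u - X v) + (X v - x n v) by ring]
    linarith
  obtain ⟨C, hC, hmod⟩ := exists_modulus hdim hρ hρh (fun n => (hε n).2.1) hXexp
  refine ⟨closure (X '' Icc 0 1), ?_, ?_, ?_⟩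
  · refine (Bornology.IsBounded.subset (Metric.isBounded_Icc (-2 * ε 0) (1 + 2 * ε 0))
      ?_).isCompact_closure
    rintro _ ⟨u, hu, rfl⟩
    have h1 := abs_le.1 (hX u 0)
    have h2 : x 0 u = u := rfl
    rw [h2] at h1
    exact ⟨by linarith [hu.1], by linarith [hu.2]⟩
  · exact (gaugeMeasure_image_pos hdim.2.2.1 hC hmod).trans_le (measure_mono subset_closure)
  · intro i v₀ hv₀ v₁ hv₁ v₂ hv₂ h01 h12
    obtain ⟨p, hp₀, hp₁⟩ := exists_rat_btwn h01
    obtain ⟨q, hq₁, hq₂⟩ := exists_rat_btwn h12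
    obtain ⟨j, hj⟩ := hF (i, p, q)
    have hεlim : Tendsto ε atTop (nhds 0) := by
      refine squeeze_zero (fun n => (hεpos n).le) (g := fun n => (1 / 16 : ℝ) ^ n) (fun n => ?_)
        (tendsto_pow_atTop_nhds_zero_of_lt_one (by norm_num) (by norm_num))
      have h1 := (hε n).2.1.trans (hρ (n + 1)).2
      have h2 : (0 : ℝ) ≤ (1 / 16) ^ n := by positivity
      rw [pow_succ] at h1
      linarith
    have hd : 0 < min (min (p - v₀) (v₁ - p)) (min (q - v₁) (v₂ - q)) / 4 := by
      have := sub_pos.2 hp₀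
      have := sub_pos.2 hp₁
      have := sub_pos.2 hq₁
      have := sub_pos.2 hq₂
      positivity
    obtain ⟨M, hM⟩ := eventually_atTop.1 (hεlim.eventually (gt_mem_nhds hd))
    set n := Nat.pair j M with hn
    have hεn := hM n (Nat.right_le_pair j M)
    have htask : task n = (i, p, q) := by simp [task, hn, hj]
    have hav := havoid n
    rw [htask] at hav
    rw [lt_div_iff₀ (by norm_num : (0 : ℝ) < 4), lt_min_iff, lt_min_iff, lt_min_iff] at hεn
    obtain ⟨⟨g1, g2⟩, g3, g4⟩ := hεn
    have happrox : ∀ v ∈ closure (X '' Icc 0 1), ∃ u,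
        |v - t n (x n u)| ≤ θ n * ε n ∧ |v - x n u| ≤ 3 * ε n := by
      intro v hv
      have hη : 0 < θ n * ε n / 2 := half_pos (mul_pos (hθ n) (hεpos n))
      obtain ⟨_, ⟨u, -, rfl⟩, hu⟩ := Metric.mem_closure_iff.1 hv _ hη
      rw [Real.dist_eq] at hu
      have h1 := hX u (n + 1)
      have h2 := hX u n
      rw [hx] at h1
      refine ⟨u, (abs_sub_le v (X u) _).trans ?_, (abs_sub_le v (X u) _).trans ?_⟩
      · linarith [(hε n).2.2]
      · nlinarith [hθ1 n, hεpos n]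
    obtain ⟨u₀, a₀, b₀⟩ := happrox v₀ hv₀
    obtain ⟨u₁, a₁, b₁⟩ := happrox v₁ hv₁
    obtain ⟨u₂, a₂, b₂⟩ := happrox v₂ hv₂
    rw [abs_le] at b₀ b₁ b₂
    have := hεpos n
    exact hav (x n u₀) (x n u₁) (x n u₂) v₀ v₁ v₂ (by dsimp only; linarith)
      (by dsimp only; linarith) (by dsimp only; linarith) (by dsimp only; linarith)
      (by dsimp only; linarith) a₀ a₁ a₂

theorem stmt_13 (h : ℝ → ℝ) (hdim : IsDimFun h) (hprec : Prec h (fun x : ℝ => x))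
    (φ : ℕ → ((Fin 3 → ℝ) →ₗ[ℝ] ℝ)) (hφ : ∀ k, φ k ≠ 0) :
    ∃ E : Set ℝ, IsCompact E ∧ 0 < gaugeMeasure h E ∧
      ∀ k, ∀ x ∈ E, ∀ y ∈ E, ∀ z ∈ E,
        x ≠ y → y ≠ z → x ≠ z → φ k ![x, y, z] ≠ 0 := by
  let a : ℕ → Fin 3 → ℝ := fun k i => φ k (Pi.single i 1)
  have hφa : ∀ k v, φ k v = ∑ i, a k i * v i := fun k v => by
    rw [LinearMap.pi_apply_eq_sum_univ (φ k) v]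
    refine Finset.sum_congr rfl fun i _ => ?_
    rw [smul_eq_mul, mul_comm]
    congr 2
    ext j
    simp [Pi.single_apply, eq_comm]
  have hc : ∀ i : ℕ × Equiv.Perm (Fin 3), (fun j => a i.1 (i.2 j)) ≠ 0 := fun i h0 => by
    refine hφ i.1 (LinearMap.ext fun v => ?_)
    rw [hφa]
    refine Finset.sum_eq_zero fun j _ => ?_
    have := congrFun h0 (i.2.symm j)
    simp only [Equiv.apply_symm_apply, Pi.zero_apply] at this
    rw [this, zero_mul]
  obtain ⟨E, hE, hpos, hav⟩ := exists_compact_avoiding_increasing_triples hdim hprec hc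
  refine ⟨E, hE, hpos, fun k x hx y hy z hz hxy hyz hxz h0 => ?_⟩
  set v : Fin 3 → ℝ := ![x, y, z] with hv
  have hvE : ∀ i, v i ∈ E := fun i => by fin_cases i <;> simpa [hv]
  have hinj : Function.Injective v := by
    intro i j hij
    fin_cases i <;> fin_cases j <;> simp_all [eq_comm]
  have hmono : StrictMono (v ∘ Tuple.sort v) :=
    (Tuple.monotone_sort v).strictMono_of_injective (hinj.comp (Tuple.sort v).injective)
  refine hav (k, Tuple.sort v) _ (hvE (Tuple.sort v 0)) _ (hvE (Tuple.sort v 1)) _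
    (hvE (Tuple.sort v 2)) (hmono (by decide)) (hmono (by decide)) ?_
  rw [hφa, ← Equiv.sum_comp (Tuple.sort v), Fin.sum_univ_three] at h0
  exact h0
end

section
/- Given a dimension function h with h ≺ x and a countable set A ⊆ (1, ∞), there exists a compact set E ⊆ ℝ with ℋ^h(E) > 0 such that for all x < y < z in E, the ratio (z − x)/(z − y) does not belong to A. -/
open MeasureTheory Filter Set

/-- A set which, up to null sets, is a finite disjoint union of closed intervals. -/
def IsStepSet (S : Set ℝ) : Prop :=
  ∃ (ι : Type) (_ : Fintype ι) (a b : ι → ℝ), ∀ X : Set ℝ, MeasurableSet X →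
    volume (S ∩ X) = ∑ i, volume (Icc (a i) (b i) ∩ X)

namespace IsStepSet

theorem icc (a b : ℝ) : IsStepSet (Icc a b) :=
  ⟨Unit, inferInstance, fun _ => a, fun _ => b, fun X _ => by simp⟩

theorem inter {S T : Set ℝ} (hS : IsStepSet S) (hT : IsStepSet T) (hTm : MeasurableSet T) :
    IsStepSet (S ∩ T) := by
  obtain ⟨ι, _, a, b, h⟩ := hS
  obtain ⟨κ, _, c, d, h'⟩ := hT
  refine ⟨ι × κ, inferInstance, fun i => max (a i.1) (c i.2), fun i => min (b i.1) (d i.2), ?_⟩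
  intro X hX
  rw [inter_assoc, h _ (hTm.inter hX), Fintype.sum_prod_type]
  refine Finset.sum_congr rfl fun i _ => ?_
  rw [inter_left_comm, h' _ (measurableSet_Icc.inter hX)]
  refine Finset.sum_congr rfl fun j _ => ?_
  rw [← inter_assoc, inter_comm (Icc (c j) _), Icc_inter_Icc]

theorem congr_ae {S T : Set ℝ} (hS : IsStepSet S) (h : S =ᵐ[volume] T) : IsStepSet T := by
  obtain ⟨ι, _, a, b, hab⟩ := hS
  refine ⟨ι, inferInstance, a, b, fun X hX => ?_⟩
  rw [← hab X hX]
  exact measure_congr (ae_eq_set_inter h.symm (ae_eq_refl X))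

theorem of_split {S : Set ℝ} (m : ℝ) (h₁ : IsStepSet (S ∩ Iic m)) (h₂ : IsStepSet (S ∩ Ici m)) :
    IsStepSet S := by
  obtain ⟨ι, _, a, b, h⟩ := h₁
  obtain ⟨κ, _, c, d, h'⟩ :=
    h₂.congr_ae (ae_eq_set_inter (ae_eq_refl S) (Ioi_ae_eq_Ici (a := m)).symm)
  refine ⟨ι ⊕ κ, inferInstance, Sum.elim a c, Sum.elim b d, fun X hX => ?_⟩
  rw [Fintype.sum_sum_type]
  simp only [Sum.elim_inl, Sum.elim_inr]
  rw [← h X hX, ← h' X hX, ← measure_inter_add_sdiff (S ∩ X) (measurableSet_Iic (a := m))]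
  congr 2
  · exact inter_right_comm _ _ _
  · rw [sdiff_eq, compl_Iic]
    exact inter_right_comm _ _ _

theorem biUnion_icc (T : Finset ℤ) (a b : ℤ → ℝ)
    (hd : Pairwise (Function.onFun Disjoint fun n => Icc (a n) (b n))) :
    IsStepSet (⋃ n ∈ T, Icc (a n) (b n)) := by
  refine ⟨T, inferInstance, fun n => a n, fun n => b n, fun X hX => ?_⟩
  rw [iUnion₂_inter, measure_biUnion_finset]
  · exact (Finset.sum_coe_sort T (fun n => volume (Icc (a n) (b n) ∩ X))).symm
  · intro i _ j _ hij
    exact (hd hij).mono inter_subset_left inter_subset_left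
  · exact fun n _ => measurableSet_Icc.inter hX

end IsStepSet

/-- The `s / 8`-neighbourhood of the shifted lattice `s * (ℤ + θ)`. -/
def latticeNhd (s θ : ℝ) : Set ℝ :=
  {x | ‖((x / s - θ : ℝ) : UnitAddCircle)‖ ≤ 1 / 8}

theorem isClosed_latticeNhd (s θ : ℝ) : IsClosed (latticeNhd s θ) := by
  refine isClosed_le ?_ continuous_const
  exact ((AddCircle.continuous_mk' (1 : ℝ)).comp (by fun_prop)).norm

theorem latticeNhd_eq {s : ℝ} (hs : 0 < s) (θ : ℝ) :
    latticeNhd s θ = ⋃ n : ℤ, Icc (s * (n + θ - 1 / 8)) (s * (n + θ + 1 / 8)) := by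
  ext x
  simp only [latticeNhd, mem_ofPred_eq, mem_iUnion, mem_Icc, UnitAddCircle.norm_eq]
  have key : ∀ n : ℤ, |x / s - θ - n| ≤ 1 / 8 ↔
      s * (n + θ - 1 / 8) ≤ x ∧ x ≤ s * (n + θ + 1 / 8) := by
    intro n
    rw [abs_le, ← le_div_iff₀' hs, ← div_le_iff₀' hs]
    constructor <;> rintro ⟨h₁, h₂⟩ <;> constructor <;> linarith
  constructor
  · intro h
    exact ⟨_, (key _).1 h⟩
  · rintro ⟨n, hn⟩
    exact (round_le _ n).trans ((key n).2 hn)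

theorem pairwise_disjoint_lattice_icc {s : ℝ} (hs : 0 < s) (θ : ℝ) :
    Pairwise (Function.onFun Disjoint fun n : ℤ =>
      Icc (s * (n + θ - 1 / 8)) (s * (n + θ + 1 / 8))) := by
  intro m n hmn
  refine disjoint_left.2 fun x hm hn => hmn ?_
  have h₁ := le_of_mul_le_mul_left (hm.1.trans hn.2) hs
  have h₂ := le_of_mul_le_mul_left (hn.1.trans hm.2) hs
  have h₃ : (m : ℝ) < n + 1 := by linarith
  have h₄ : (n : ℝ) < m + 1 := by linarith
  have h₅ : m < n + 1 := by exact_mod_cast h₃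
  have h₆ : n < m + 1 := by exact_mod_cast h₄
  omega

theorem latticeNhd_inter_icc_subset {s : ℝ} (hs : 0 < s) (θ a b : ℝ) :
    latticeNhd s θ ∩ Icc a b ⊆ ⋃ n ∈ Finset.Icc ⌈a / s - θ - 1 / 8⌉ ⌊b / s - θ + 1 / 8⌋,
      Icc (s * (n + θ - 1 / 8)) (s * (n + θ + 1 / 8)) := by
  rintro x ⟨hx, hxa, hxb⟩
  rw [latticeNhd_eq hs] at hx
  obtain ⟨n, hn⟩ := mem_iUnion.1 hx
  refine mem_iUnion₂.2 ⟨n, ?_, hn⟩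
  rw [Finset.mem_Icc, Int.ceil_le, Int.le_floor]
  have h₁ := (div_le_iff₀' hs).2 (hxa.trans hn.2)
  have h₂ := (le_div_iff₀' hs).2 (hn.1.trans hxb)
  constructor <;> linarith

theorem isStepSet_latticeNhd_inter_icc {s : ℝ} (hs : 0 < s) (θ a b : ℝ) :
    IsStepSet (latticeNhd s θ ∩ Icc a b) := by
  have h := (IsStepSet.biUnion_icc (Finset.Icc ⌈a / s - θ - 1 / 8⌉ ⌊b / s - θ + 1 / 8⌋) _ _
    (pairwise_disjoint_lattice_icc hs θ)).inter (IsStepSet.icc a b) measurableSet_Icc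
  refine (congrArg IsStepSet ?_).mp h
  refine subset_antisymm (inter_subset_inter_left _ ?_)
    (subset_inter (latticeNhd_inter_icc_subset hs θ a b) inter_subset_right)
  rw [latticeNhd_eq hs]
  exact iUnion₂_subset fun n _ => subset_iUnion_of_subset n subset_rfl

theorem volume_real_biUnion_lattice_icc {s : ℝ} (hs : 0 < s) (θ : ℝ) (T : Finset ℤ) :
    volume.real (⋃ n ∈ T, Icc (s * ((n : ℝ) + θ - 1 / 8)) (s * (n + θ + 1 / 8))) =
      T.card * (s / 4) := by
  rw [measureReal_biUnion_finset (fun i _ j _ hij => pairwise_disjoint_lattice_icc hs θ hij)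
    (fun _ _ => measurableSet_Icc) (fun _ _ => measure_Icc_lt_top.ne)]
  rw [Finset.sum_congr rfl (g := fun _ => s / 4), Finset.sum_const, nsmul_eq_mul]
  intro n _
  rw [Real.volume_real_Icc_of_le (by gcongr; linarith)]
  ring

theorem abs_volume_latticeNhd_inter_icc_sub_le {s : ℝ} (hs : 0 < s) (θ a b : ℝ) :
    |volume.real (latticeNhd s θ ∩ Icc a b) - 1 / 4 * volume.real (Icc a b)| ≤ s := by
  rcases lt_or_ge b a with hba | hab
  · simpa [Icc_eq_empty_of_lt hba] using hs.le
  have hfin : volume (latticeNhd s θ ∩ Icc a b) ≠ ⊤ :=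
    (measure_mono inter_subset_right).trans_lt (measure_Icc_lt_top (a := a) (b := b)) |>.ne
  rw [Real.volume_real_Icc_of_le hab, abs_sub_le_iff]
  have hdiv : b / s * s - a / s * s = b - a := by field_simp
  have hdiv0 : a / s ≤ b / s := by gcongr
  constructor
  · set T := Finset.Icc ⌈a / s - θ - 1 / 8⌉ ⌊b / s - θ + 1 / 8⌋ with hT
    have h := measureReal_mono (μ := volume) (latticeNhd_inter_icc_subset hs θ a b)
      ((measure_biUnion_lt_top T.finite_toSet fun n _ => measure_Icc_lt_top).ne)
    rw [volume_real_biUnion_lattice_icc hs] at h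
    have hc : (T.card : ℝ) ≤ b / s - a / s + 5 / 4 := by
      have h₁ := Int.floor_le (b / s - θ + 1 / 8)
      have h₂ := Int.le_ceil (a / s - θ - 1 / 8)
      rw [hT, Int.card_Icc]
      have h₃ : (((⌊b / s - θ + 1 / 8⌋ + 1 - ⌈a / s - θ - 1 / 8⌉).toNat : ℤ) : ℝ) ≤
          b / s - a / s + 5 / 4 := by
        rw [Int.toNat_eq_max]
        push_cast
        exact max_le (by linarith) (by linarith)
      exact_mod_cast h₃
    have := mul_le_mul_of_nonneg_right hc (by positivity : 0 ≤ s / 4)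
    linarith
  · set T := Finset.Icc ⌈a / s - θ + 1 / 8⌉ ⌊b / s - θ - 1 / 8⌋ with hT
    have hsub : (⋃ n ∈ T, Icc (s * ((n : ℝ) + θ - 1 / 8)) (s * (n + θ + 1 / 8))) ⊆
        latticeNhd s θ ∩ Icc a b := by
      refine iUnion₂_subset fun n hn => subset_inter ?_ ?_
      · rw [latticeNhd_eq hs]
        exact subset_iUnion_of_subset n subset_rfl
      · rw [hT, Finset.mem_Icc, Int.ceil_le, Int.le_floor] at hn
        refine Icc_subset_Icc ?_ ?_
        · rw [← div_le_iff₀' hs]; linarith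
        · rw [← le_div_iff₀' hs]; linarith
    have h := measureReal_mono (μ := volume) hsub hfin
    rw [volume_real_biUnion_lattice_icc hs] at h
    have hc : b / s - a / s - 5 / 4 ≤ (T.card : ℝ) := by
      have h₁ := Int.lt_floor_add_one (b / s - θ - 1 / 8)
      have h₂ := Int.ceil_lt_add_one (a / s - θ + 1 / 8)
      rw [hT, Int.card_Icc]
      have h₃ : b / s - a / s - 5 / 4 ≤
          (((⌊b / s - θ - 1 / 8⌋ + 1 - ⌈a / s - θ + 1 / 8⌉).toNat : ℤ) : ℝ) := by
        rw [Int.toNat_eq_max]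
        push_cast
        exact le_max_of_le_left (by linarith)
      exact_mod_cast h₃
    have := mul_le_mul_of_nonneg_right hc (by positivity : 0 ≤ s / 4)
    linarith

/-- On every closed interval inside `[u, v]`, the set `F` has density `1 / 4` up to an additive
error `η`; moreover `F ∩ [u, v]` is a step set. -/
def EquidistributedOn (F : Set ℝ) (η u v : ℝ) : Prop :=
  IsStepSet (F ∩ Icc u v) ∧ ∀ a b, u ≤ a → b ≤ v →
    |volume.real (F ∩ Icc a b) - 1 / 4 * volume.real (Icc a b)| ≤ η

theorem volume_inter_icc_ne_top (F : Set ℝ) (a b : ℝ) : volume (F ∩ Icc a b) ≠ ⊤ :=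
  ((measure_mono inter_subset_right).trans_lt (measure_Icc_lt_top (a := a) (b := b))).ne

theorem volume_real_inter_icc_split (F : Set ℝ) (a b m : ℝ) :
    volume.real (F ∩ Icc a b) =
      volume.real (F ∩ Icc a (min b m)) + volume.real (F ∩ Icc (max a m) b) := by
  rw [← measureReal_inter_add_sdiff (μ := volume) (s := F ∩ Icc a b)
    (measurableSet_Iic (a := m)) (volume_inter_icc_ne_top F a b)]
  congr 1
  · congr 1
    ext x
    simp only [mem_inter_iff, mem_Icc, mem_Iic, le_min_iff]
    tauto
  · rw [sdiff_eq, compl_Iic]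
    have e : (F ∩ Icc a b ∩ Ioi m : Set ℝ) =ᵐ[volume] (F ∩ Icc a b ∩ Ici m : Set ℝ) :=
      ae_eq_set_inter (ae_eq_refl _) Ioi_ae_eq_Ici
    rw [measureReal_congr e]
    congr 1
    ext x
    simp only [mem_inter_iff, mem_Icc, mem_Ici, max_le_iff]
    tauto

namespace EquidistributedOn

theorem glue {F : Set ℝ} {η₁ η₂ u m v : ℝ} (hum : u ≤ m) (hmv : m ≤ v)
    (h₁ : EquidistributedOn F η₁ u m) (h₂ : EquidistributedOn F η₂ m v) :
    EquidistributedOn F (η₁ + η₂) u v := by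
  refine ⟨IsStepSet.of_split m ?_ ?_, fun a b ha hb => ?_⟩
  · refine (congrArg IsStepSet ?_).mp h₁.1
    ext x
    simp only [mem_inter_iff, mem_Icc, mem_Iic]
    exact ⟨fun h => ⟨⟨h.1, h.2.1, h.2.2.trans hmv⟩, h.2.2⟩, fun h => ⟨h.1.1, h.1.2.1, h.2⟩⟩
  · refine (congrArg IsStepSet ?_).mp h₂.1
    ext x
    simp only [mem_inter_iff, mem_Icc, mem_Ici]
    exact ⟨fun h => ⟨⟨h.1, hum.trans h.2.1, h.2.2⟩, h.2.1⟩, fun h => ⟨h.1.1, h.2, h.1.2.2⟩⟩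
  · have e₁ := h₁.2 a (min b m) ha (min_le_right _ _)
    have e₂ := h₂.2 (max a m) b (le_max_right _ _) hb
    have e₃ := volume_real_inter_icc_split univ a b m
    simp only [univ_inter] at e₃
    rw [volume_real_inter_icc_split F a b m, e₃]
    rw [abs_le] at *
    constructor <;> linarith [e₁.1, e₁.2, e₂.1, e₂.2]

theorem of_eq_latticeNhd {F : Set ℝ} {s θ u v : ℝ} (hs : 0 < s)
    (h : F ∩ Ioo u v = latticeNhd s θ ∩ Ioo u v) : EquidistributedOn F s u v := by
  have hae : (latticeNhd s θ ∩ Icc u v : Set ℝ) =ᵐ[volume] (F ∩ Icc u v : Set ℝ) := by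
    refine (ae_eq_set_inter (ae_eq_refl _) Ioo_ae_eq_Icc.symm).trans ?_
    rw [← h]
    exact ae_eq_set_inter (ae_eq_refl _) Ioo_ae_eq_Icc
  refine ⟨(isStepSet_latticeNhd_inter_icc hs θ u v).congr_ae hae, fun a b ha hb => ?_⟩
  have hsub : ∀ G : Set ℝ, G ∩ Icc a b = (G ∩ Icc u v) ∩ Icc a b := fun G => by
    rw [inter_assoc, inter_eq_right.2 (Icc_subset_Icc ha hb)]
  rw [hsub F, ← measureReal_congr (ae_eq_set_inter hae (ae_eq_refl (Icc a b))), ← hsub]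
  exact abs_volume_latticeNhd_inter_icc_sub_le hs θ a b

end EquidistributedOn

theorem ratio_ne_of_mem_latticeNhd {α s x y z : ℝ} (hs : 0 < s) (hα : 1 < α) (hyz : y < z)
    (hx : x ∈ latticeNhd s (1 / 2)) (hy : y ∈ latticeNhd (s / α) 0)
    (hz : z ∈ latticeNhd (s / (α - 1)) 0) : (z - x) / (z - y) ≠ α := by
  intro h
  rw [div_eq_iff (sub_pos.2 hyz).ne'] at h
  have hα' : α - 1 ≠ 0 := (sub_pos.2 hα).ne'
  have hα₀ : α ≠ 0 := by positivity
  have key : (1 / 2 : ℝ) = (y / (s / α) - 0) - (z / (s / (α - 1)) - 0) - (x / s - 1 / 2) := by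
    have : x = α * y - (α - 1) * z := by linarith
    rw [this]
    field_simp
    ring
  have hnorm : ‖((1 / 2 : ℝ) : UnitAddCircle)‖ = 1 / 2 := by
    have := AddCircle.norm_half_period_eq (1 : ℝ)
    rwa [abs_one] at this
  rw [key, AddCircle.coe_sub, AddCircle.coe_sub] at hnorm
  have h₁ := norm_sub_le (((y / (s / α) - 0 : ℝ) : UnitAddCircle) -
    ((z / (s / (α - 1)) - 0 : ℝ) : UnitAddCircle)) ((x / s - 1 / 2 : ℝ) : UnitAddCircle)
  have h₂ := norm_sub_le ((y / (s / α) - 0 : ℝ) : UnitAddCircle)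
    ((z / (s / (α - 1)) - 0 : ℝ) : UnitAddCircle)
  have hx' : ‖((x / s - 1 / 2 : ℝ) : UnitAddCircle)‖ ≤ 1 / 8 := hx
  have hy' : ‖((y / (s / α) - 0 : ℝ) : UnitAddCircle)‖ ≤ 1 / 8 := hy
  have hz' : ‖((z / (s / (α - 1)) - 0 : ℝ) : UnitAddCircle)‖ ≤ 1 / 8 := hz
  linarith

/-- `F` contains no `x < p < y < q < z` with `(z - x) / (z - y) = α`. -/
def AvoidsRatio (α p q : ℝ) (F : Set ℝ) : Prop :=
  ∀ x ∈ F, ∀ y ∈ F, ∀ z ∈ F, x < p → p < y → y < q → q < z → (z - x) / (z - y) ≠ α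

theorem exists_equidistributedOn_avoidsRatio {α p q η : ℝ} (hα : 1 < α) (hp : 0 ≤ p) (hpq : p ≤ q)
    (hq : q ≤ 1) (hη : 0 < η) :
    ∃ F : Set ℝ, IsClosed F ∧ EquidistributedOn F η 0 1 ∧ AvoidsRatio α p q F := by
  have hα' : 0 < α - 1 := sub_pos.2 hα
  have hα₀ : 0 < α := by linarith
  set s := η / (1 + 1 / α + 1 / (α - 1)) with hs_def
  have hs : 0 < s := by positivity
  have hsum : s + s / α + s / (α - 1) = η := by
    have : s + s / α + s / (α - 1) = s * (1 + 1 / α + 1 / (α - 1)) := by ring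
    rw [this, hs_def, div_mul_cancel₀ _ (by positivity)]
  let F : Set ℝ := (latticeNhd s (1 / 2) ∪ Ici p) ∩
    (latticeNhd (s / α) 0 ∪ (Iic p ∪ Ici q)) ∩ (latticeNhd (s / (α - 1)) 0 ∪ Iic q)
  have hF : ∀ x, x ∈ F ↔ ((x ∈ latticeNhd s (1 / 2) ∨ p ≤ x) ∧
      (x ∈ latticeNhd (s / α) 0 ∨ x ≤ p ∨ q ≤ x)) ∧
      (x ∈ latticeNhd (s / (α - 1)) 0 ∨ x ≤ q) := fun x => Iff.rfl
  refine ⟨F, ?_, ?_, ?_⟩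
  · exact (((isClosed_latticeNhd _ _).union isClosed_Ici).inter
      ((isClosed_latticeNhd _ _).union (isClosed_Iic.union isClosed_Ici))).inter
      ((isClosed_latticeNhd _ _).union isClosed_Iic)
  · rw [← hsum]
    refine EquidistributedOn.glue (hp.trans hpq) hq (EquidistributedOn.glue hp hpq
      (EquidistributedOn.of_eq_latticeNhd (θ := 1 / 2) hs ?_)
      (EquidistributedOn.of_eq_latticeNhd (θ := 0) (by positivity) ?_))
      (EquidistributedOn.of_eq_latticeNhd (θ := 0) (by positivity) ?_)
    all_goals
      ext x
      simp only [mem_inter_iff, mem_Ioo, hF]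
      refine and_congr_left fun hx => ?_
    · have h₁ := hx.2.not_ge
      have h₂ := hx.2.le
      have h₃ := h₂.trans hpq
      tauto
    · have h₁ := hx.2.not_ge
      have h₂ := hx.1.not_ge
      have h₃ := hx.1.le
      have h₄ := hx.2.le
      tauto
    · have h₁ := hx.1.not_ge
      have h₂ := hx.1.le
      have h₃ := hpq.trans h₂
      tauto
  · intro x hx y hy z hz hxp hpy hyq hqz
    refine ratio_ne_of_mem_latticeNhd hs hα (hyq.trans hqz) ?_ ?_ ?_
    · exact ((hF x).1 hx).1.1.resolve_right hxp.not_ge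
    · exact ((hF y).1 hy).1.2.resolve_right (not_or.2 ⟨hpy.not_ge, hyq.not_ge⟩)
    · exact ((hF z).1 hz).2.resolve_right hqz.not_ge

/-- Intersecting a step set with a sufficiently equidistributed set multiplies the measure of
every trace on an interval by about `1 / 4`. -/
theorem IsStepSet.exists_abs_volume_inter_sub_le {S : Set ℝ} (hS : IsStepSet S)
    (hS01 : S ⊆ Icc 0 1) {η : ℝ} (hη : 0 < η) :
    ∃ δ > 0, ∀ F, IsClosed F → EquidistributedOn F δ 0 1 → ∀ a b,
      |volume.real (S ∩ F ∩ Icc a b) - 1 / 4 * volume.real (S ∩ Icc a b)| ≤ η := by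
  obtain ⟨ι, _, c, d, h⟩ := hS
  refine ⟨η / (Fintype.card ι + 1), by positivity, fun F hF hFe a b => ?_⟩
  have hreal : ∀ G : Set ℝ, IsClosed G → volume.real (S ∩ G ∩ Icc a b) =
      ∑ i, volume.real (G ∩ Icc (max (max 0 a) (c i)) (min (min 1 b) (d i))) := by
    intro G hG
    have e : S ∩ G ∩ Icc a b = S ∩ (G ∩ (Icc 0 1 ∩ Icc a b)) := by
      ext x
      simp only [mem_inter_iff]
      have := @hS01 x
      tauto
    rw [e, measureReal_def,
      h _ (hG.measurableSet.inter (measurableSet_Icc.inter measurableSet_Icc)), ENNReal.toReal_sum]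
    · refine Finset.sum_congr rfl fun i _ => ?_
      rw [measureReal_def, inter_left_comm, inter_comm (Icc (c i) (d i)), Icc_inter_Icc,
        Icc_inter_Icc]
    · intro i _
      rw [inter_comm]
      exact volume_inter_icc_ne_top _ _ _
  have h₁ := hreal F hF
  have h₂ := hreal univ isClosed_univ
  simp only [inter_univ, univ_inter] at h₂
  rw [h₁, h₂, Finset.mul_sum, ← Finset.sum_sub_distrib]
  refine (Finset.abs_sum_le_sum_abs _ _).trans ((Finset.sum_le_card_nsmul _ _ _ fun i _ =>
    hFe.2 _ _ (le_max_of_le_left (le_max_left _ _)) (min_le_of_left_le (min_le_left _ _))).trans ?_)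
  rw [nsmul_eq_mul, mul_div_assoc', div_le_iff₀ (by positivity), Finset.card_univ]
  nlinarith

/-- A decreasing sequence of compact sets, along which the renormalised measures
`4 ^ k * volume (S k ∩ ·)` of intervals vary by at most `η k`. -/
theorem exists_antitone_compact_seq {P : ℕ → Set ℝ → Prop}
    (hP : ∀ k, ∀ δ > 0, ∃ F, IsClosed F ∧ EquidistributedOn F δ 0 1 ∧ P k F)
    {η : ℕ → ℝ} (hη : ∀ k, 0 < η k) :
    ∃ S : ℕ → Set ℝ, S 0 = Icc 0 1 ∧ (∀ k, IsCompact (S k)) ∧ Antitone S ∧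
      (∀ k, ∃ F, S (k + 1) ⊆ F ∧ P k F) ∧
      ∀ k a b, |4 ^ (k + 1) * volume.real (S (k + 1) ∩ Icc a b) -
        4 ^ k * volume.real (S k ∩ Icc a b)| ≤ η k := by
  have step : ∀ (k : ℕ) (S : {S : Set ℝ // IsClosed S ∧ S ⊆ Icc 0 1 ∧ IsStepSet S}),
      ∃ T : {S : Set ℝ // IsClosed S ∧ S ⊆ Icc 0 1 ∧ IsStepSet S}, T.1 ⊆ S.1 ∧
        (∃ F, T.1 ⊆ F ∧ P k F) ∧
        ∀ a b, |4 ^ (k + 1) * volume.real (T.1 ∩ Icc a b) -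
          4 ^ k * volume.real (S.1 ∩ Icc a b)| ≤ η k := by
    rintro k ⟨S, hSc, hS01, hS⟩
    obtain ⟨δ, hδ, H⟩ := hS.exists_abs_volume_inter_sub_le hS01
      (div_pos (hη k) (by positivity : (0 : ℝ) < 4 ^ (k + 1)))
    obtain ⟨F, hF, hFe, hFP⟩ := hP k δ hδ
    have hstep : IsStepSet (S ∩ F) := by
      refine (congrArg IsStepSet ?_).mp (hS.inter hFe.1 (hF.measurableSet.inter measurableSet_Icc))
      rw [inter_left_comm, inter_eq_left.2 hS01, inter_comm]
    refine ⟨⟨S ∩ F, hSc.inter hF, inter_subset_left.trans hS01, hstep⟩, inter_subset_left,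
      ⟨F, inter_subset_right, hFP⟩, fun a b => ?_⟩
    have h := H F hF hFe a b
    rw [le_div_iff₀ (by positivity), mul_comm, ← abs_of_pos (by positivity : (0 : ℝ) < 4 ^ (k + 1)),
      ← abs_mul] at h
    refine le_of_eq_of_le (congrArg _ ?_) h
    ring
  choose next hsub hnP hest using step
  let S : ℕ → {S : Set ℝ // IsClosed S ∧ S ⊆ Icc 0 1 ∧ IsStepSet S} := fun k =>
    Nat.rec ⟨Icc 0 1, isClosed_Icc, subset_rfl, IsStepSet.icc 0 1⟩ next k
  refine ⟨fun k => (S k).1, rfl, fun k => ?_, antitone_nat_of_succ_le fun k => hsub k (S k),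
    fun k => hnP k (S k), fun k => hest k (S k)⟩
  exact isCompact_Icc.of_isClosed_subset (S k).2.1 (S k).2.2.1

/-- Scales below which `h` dominates `4 ^ (k + 1) * t`. -/
theorem exists_scale_seq {h : ℝ → ℝ} (hpos : ∀ t > 0, 0 < h t)
    (hprec : Prec h (fun x : ℝ => x)) :
    ∃ η : ℕ → ℝ, (∀ k, 0 < η k) ∧ η 0 ≤ 1 / 4 ∧ (∀ k, η (k + 1) ≤ η k / 2) ∧
      ∀ k t, 0 < t → t ≤ η k → 4 ^ (k + 1) * t ≤ h t := by
  have hg : ∀ k : ℕ, ∃ g > (0 : ℝ), ∀ t, 0 < t → t ≤ g → 4 ^ (k + 1) * t ≤ h t := by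
    intro k
    have hev : ∀ᶠ t in nhdsWithin (0 : ℝ) (Ioi 0), t / h t < (4 ^ (k + 1))⁻¹ :=
      hprec.eventually (gt_mem_nhds (by positivity))
    obtain ⟨g, hg, H⟩ := mem_nhdsGT_iff_exists_Ioc_subset.1 hev
    refine ⟨g, hg, fun t ht htg => ?_⟩
    have h₁ : t / h t < (4 ^ (k + 1))⁻¹ := H ⟨ht, htg⟩
    rw [div_lt_iff₀ (hpos t ht), lt_inv_mul_iff₀ (by positivity)] at h₁
    exact h₁.le
  choose g hg₀ hg using hg
  let η : ℕ → ℝ := fun k =>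
    Nat.rec (min (g 0) (1 / 4)) (fun k r => min (g (k + 1)) (r / 2)) k
  have hη₀ : ∀ k, 0 < η k := by
    intro k
    induction k with
    | zero => exact lt_min (hg₀ 0) (by norm_num)
    | succ k ih => exact lt_min (hg₀ _) (half_pos ih)
  refine ⟨η, hη₀, min_le_right _ _, fun k => min_le_right _ _, fun k t ht htk => ?_⟩
  refine hg k t ht (htk.trans ?_)
  cases k with
  | zero => exact min_le_left _ _
  | succ k => exact min_le_left _ _

theorem abs_sub_le_two_mul_of_step {m η : ℕ → ℝ} (hη : ∀ k, 0 < η k)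
    (hη' : ∀ k, η (k + 1) ≤ η k / 2) (hm : ∀ k, |m (k + 1) - m k| ≤ η k) {j k : ℕ} (hjk : j ≤ k) :
    |m k - m j| ≤ 2 * η j := by
  suffices h : |m k - m j| ≤ 2 * η j - 2 * η k by linarith [hη k]
  induction k, hjk using Nat.le_induction with
  | base => simp
  | succ k _ ih =>
    have := abs_sub_le (m (k + 1)) (m k) (m j)
    linarith [hη' k, hm k]

/-- The renormalised measure of an interval of length `ρ` is at most `3 * h ρ`. -/
theorem four_pow_mul_volume_le {h : ℝ → ℝ} {η : ℕ → ℝ} {S : ℕ → Set ℝ} (hη : ∀ k, 0 < η k)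
    (hη' : ∀ k, η (k + 1) ≤ η k / 2) (hηh : ∀ k t, 0 < t → t ≤ η k → 4 ^ (k + 1) * t ≤ h t)
    (hS : ∀ k a b, |4 ^ (k + 1) * volume.real (S (k + 1) ∩ Icc a b) -
        4 ^ k * volume.real (S k ∩ Icc a b)| ≤ η k) {ρ : ℝ} (hρ : 0 < ρ) (hρη : ρ ≤ η 0)
    (k : ℕ) (a : ℝ) : 4 ^ k * volume.real (S k ∩ Icc a (a + ρ)) ≤ 3 * h ρ := by
  have hlim : ∃ j, η j < ρ := by
    have hle : ∀ j : ℕ, η j ≤ η 0 * (1 / 2) ^ j := by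
      intro j
      induction j with
      | zero => simp
      | succ j ih => rw [pow_succ]; linarith [hη' j]
    obtain ⟨j, hj⟩ := exists_pow_lt_of_lt_one (div_pos hρ (hη 0)) (by norm_num : (1 / 2 : ℝ) < 1)
    exact ⟨j, (hle j).trans_lt (by rwa [lt_div_iff₀' (hη 0)] at hj)⟩
  classical
  obtain ⟨i, hi⟩ : ∃ i, Nat.find hlim = i + 1 := by
    refine Nat.exists_eq_succ_of_ne_zero fun h0 => ?_
    have := Nat.find_spec hlim
    rw [h0] at this
    linarith
  have hlt : η (i + 1) < ρ := hi ▸ Nat.find_spec hlim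
  have hge : ρ ≤ η i := not_lt.1 (Nat.find_min hlim (by omega))
  have hh := hηh i ρ hρ hge
  have hvol : ∀ l, 4 ^ l * volume.real (S l ∩ Icc a (a + ρ)) ≤ 4 ^ l * ρ := by
    intro l
    have : volume.real (S l ∩ Icc a (a + ρ)) ≤ volume.real (Icc a (a + ρ)) :=
      measureReal_mono inter_subset_right (measure_Icc_lt_top).ne
    rw [Real.volume_real_Icc_of_le (by linarith)] at this
    have h' : volume.real (S l ∩ Icc a (a + ρ)) ≤ ρ := by linarith
    gcongr
  have hpow : ∀ l : ℕ, (1 : ℝ) ≤ 4 ^ l := fun l => one_le_pow₀ (by norm_num)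
  rcases le_total k (i + 1) with hk | hk
  · have h₁ : (4 : ℝ) ^ k * ρ ≤ 4 ^ (i + 1) * ρ := by
      gcongr
      norm_num
    have h₂ : 0 < (4 : ℝ) ^ (i + 1) * ρ := by positivity
    linarith [hvol k]
  · have h₁ := abs_sub_le_two_mul_of_step (m := fun k => 4 ^ k * volume.real (S k ∩ Icc a (a + ρ)))
      hη hη' (fun k => hS k a (a + ρ)) hk
    have h₂ := (abs_le.1 h₁).2
    have h₃ := hvol (i + 1)
    have h₄ : ρ ≤ 4 ^ (i + 1) * ρ := le_mul_of_one_le_left hρ.le (hpow _)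
    linarith

/-- Small sets are contained in open sets whose renormalised measure is controlled by `h`. -/
theorem exists_open_superset_four_pow_mul_volume_le {h : ℝ → ℝ} (hdim : IsDimFun h) {r : ℝ}
    (hr : 0 < r) {S : ℕ → Set ℝ} (hS : ∀ k, IsCompact (S k))
    (hup : ∀ ρ, 0 < ρ → ρ ≤ r → ∀ k a, 4 ^ k * volume.real (S k ∩ Icc a (a + ρ)) ≤ 3 * h ρ)
    {t : Set ℝ} (ht : Metric.ediam t ≤ ENNReal.ofReal (r / 2)) {δ : NNReal} (hδ : 0 < δ) :
    ∃ U, IsOpen U ∧ t ⊆ U ∧ ∀ k, ENNReal.ofReal (4 ^ k) * volume (S k ∩ U) ≤ ENNReal.ofReal 6 *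
      ((⨆ _ : t.Nonempty, ENNReal.ofReal (h (Metric.ediam t).toReal)) + δ) := by
  obtain ⟨hzero, hpos, -, hcont⟩ := hdim
  rcases t.eq_empty_or_nonempty with rfl | ⟨x, hx⟩
  · exact ⟨∅, isOpen_empty, subset_rfl, fun k => by simp⟩
  have htop : Metric.ediam t ≠ ⊤ := (ht.trans_lt ENNReal.ofReal_lt_top).ne
  set D := (Metric.ediam t).toReal with hD
  have hD0 : 0 ≤ D := ENNReal.toReal_nonneg
  have hDr : D ≤ r / 2 := ENNReal.toReal_le_of_le_ofReal (by positivity) ht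
  obtain ⟨ρ, hDρ, hρr, hhρ⟩ : ∃ ρ, D < ρ ∧ ρ ≤ r ∧ h ρ ≤ h D + δ := by
    have hev : ∀ᶠ s in nhdsWithin D (Ici D), h s < h D + δ :=
      (hcont D hD0).eventually (gt_mem_nhds (by simpa using hδ))
    obtain ⟨u, hu, H⟩ := mem_nhdsGE_iff_exists_Icc_subset.1 hev
    have hlt : D < min u r := lt_min hu (by linarith)
    exact ⟨min u r, hlt, min_le_right _ _, (show h (min u r) < h D + δ from
      H ⟨hlt.le, min_le_left _ _⟩).le⟩
  have hρ : 0 < ρ := hD0.trans_lt hDρ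
  refine ⟨Ioo (x - ρ) (x + ρ), isOpen_Ioo, fun y hy => ?_, fun k => ?_⟩
  · have hxy : dist y x ≤ D := by
      rw [hD, dist_edist]
      exact ENNReal.toReal_mono htop (Metric.edist_le_ediam_of_mem hy hx)
    rw [← Real.ball_eq_Ioo, Metric.mem_ball]
    exact hxy.trans_lt hDρ
  · have hfin : ∀ a b, volume (S k ∩ Icc a b) ≠ ⊤ := fun a b =>
      ((measure_mono inter_subset_left).trans_lt (hS k).measure_lt_top).ne
    have hpiece : ∀ a, ENNReal.ofReal (4 ^ k) * volume (S k ∩ Icc a (a + ρ)) ≤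
        ENNReal.ofReal (3 * (h D + δ)) := by
      intro a
      rw [← ofReal_measureReal (hfin _ _), ← ENNReal.ofReal_mul (by positivity)]
      exact ENNReal.ofReal_le_ofReal ((hup ρ hρ hρr k a).trans (by linarith))
    have hcov : S k ∩ Ioo (x - ρ) (x + ρ) ⊆
        (S k ∩ Icc (x - ρ) (x - ρ + ρ)) ∪ (S k ∩ Icc x (x + ρ)) := by
      rintro y ⟨hy, hy₁, hy₂⟩
      rcases le_total y x with hyx | hyx
      · exact Or.inl ⟨hy, hy₁.le, by linarith⟩
      · exact Or.inr ⟨hy, hyx, hy₂.le⟩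
    have hhD : 0 ≤ h D := by
      rcases hD0.eq_or_lt with h0 | h0
      · rw [← h0, hzero]
      · exact (hpos D h0).le
    calc ENNReal.ofReal (4 ^ k) * volume (S k ∩ Ioo (x - ρ) (x + ρ))
        ≤ ENNReal.ofReal (4 ^ k) *
          (volume (S k ∩ Icc (x - ρ) (x - ρ + ρ)) + volume (S k ∩ Icc x (x + ρ))) := by
          gcongr
          exact (measure_mono hcov).trans (measure_union_le _ _)
      _ ≤ ENNReal.ofReal (3 * (h D + δ)) + ENNReal.ofReal (3 * (h D + δ)) := by
          rw [mul_add]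
          exact add_le_add (hpiece _) (hpiece _)
      _ = ENNReal.ofReal 6 * (ENNReal.ofReal (h D) + δ) := by
          rw [← ENNReal.ofReal_add (by positivity) (by positivity),
            ← ENNReal.ofReal_coe_nnreal (p := δ), ← ENNReal.ofReal_add hhD (by positivity),
            ← ENNReal.ofReal_mul (by norm_num)]
          congr 1
          ring
      _ = _ := by rw [ciSup_pos ⟨x, hx⟩]

theorem gaugeMeasure_iInter_pos_s14 {h : ℝ → ℝ} (hdim : IsDimFun h) {r : ℝ} (hr : 0 < r)
    {S : ℕ → Set ℝ} (hS : ∀ k, IsCompact (S k)) (hanti : Antitone S)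
    (hup : ∀ ρ, 0 < ρ → ρ ≤ r → ∀ k a, 4 ^ k * volume.real (S k ∩ Icc a (a + ρ)) ≤ 3 * h ρ)
    (hlow : ∀ k, 1 / 2 ≤ 4 ^ k * volume.real (S k)) :
    0 < gaugeMeasure h (⋂ k, S k) := by
  rw [gaugeMeasure, Measure.mkMetric_apply]
  have hc : (0 : ENNReal) < ENNReal.ofReal (1 / 24) := ENNReal.ofReal_pos.2 (by norm_num)
  refine hc.trans_le (le_iSup₂_of_le (ENNReal.ofReal (r / 2)) (ENNReal.ofReal_pos.2 (half_pos hr))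
    (le_iInf fun t => le_iInf fun ht => le_iInf fun hd => ?_))
  obtain ⟨δ, hδ, hδsum⟩ := ENNReal.exists_pos_sum_of_countable hc.ne' ℕ
  choose U hUo htU hU using fun n =>
    exists_open_superset_four_pow_mul_volume_le hdim hr hS hup (hd n) (hδ n)
  obtain ⟨k, hk⟩ := exists_subset_nhds_of_isCompact (V := S) hanti.directed_ge hS
    (U := ⋃ n, U n) fun x hx => (isOpen_iUnion hUo).mem_nhds
      ((ht.trans (iUnion_mono htU)) hx)
  by_contra! hlt
  have hmass : ENNReal.ofReal (1 / 2) ≤ ENNReal.ofReal 6 *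
      ((∑' n, ⨆ _ : (t n).Nonempty, ENNReal.ofReal (h (Metric.ediam (t n)).toReal)) +
        ∑' n, (δ n : ENNReal)) := by
    calc ENNReal.ofReal (1 / 2) ≤ ENNReal.ofReal (4 ^ k * volume.real (S k)) :=
          ENNReal.ofReal_le_ofReal (hlow k)
      _ = ENNReal.ofReal (4 ^ k) * volume (S k) := by
          rw [ENNReal.ofReal_mul (by positivity), ofReal_measureReal (hS k).measure_lt_top.ne]
      _ ≤ ENNReal.ofReal (4 ^ k) * ∑' n, volume (S k ∩ U n) := by
          gcongr
          refine le_trans (measure_mono ?_) (measure_iUnion_le _)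
          rw [← inter_iUnion]
          exact subset_inter subset_rfl hk
      _ ≤ _ := by
          rw [← ENNReal.tsum_mul_left, ← ENNReal.tsum_add, ← ENNReal.tsum_mul_left]
          exact ENNReal.tsum_le_tsum fun n => hU n k
  have hsmall := ENNReal.mul_lt_mul_right (a := ENNReal.ofReal 6) (by simp)
    ENNReal.ofReal_ne_top (ENNReal.add_lt_add hlt hδsum)
  rw [← ENNReal.ofReal_add (by norm_num) (by norm_num), ← ENNReal.ofReal_mul (by norm_num)]
    at hsmall
  norm_num at hsmall hmass
  exact absurd hmass hsmall.not_ge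

theorem stmt_14 (h : ℝ → ℝ) (hdim : IsDimFun h) (hprec : Prec h (fun x : ℝ => x))
    (A : Set ℝ) (hA : A.Countable) (hA1 : A ⊆ Set.Ioi 1) :
    ∃ E : Set ℝ, IsCompact E ∧ 0 < gaugeMeasure h E ∧
      ∀ x ∈ E, ∀ y ∈ E, ∀ z ∈ E, x < y → y < z → (z - x) / (z - y) ∉ A := by
  let ι := {i : ℝ × ℚ × ℚ // i.1 ∈ insert 2 A ∧ 0 ≤ i.2.1 ∧ i.2.1 ≤ i.2.2 ∧ i.2.2 ≤ 1}
  have : Countable ι := by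
    have hc : {i : ℝ × ℚ × ℚ | i.1 ∈ insert 2 A ∧ 0 ≤ i.2.1 ∧ i.2.1 ≤ i.2.2 ∧
        i.2.2 ≤ 1}.Countable :=
      ((hA.insert 2).prod (countable_univ (α := ℚ × ℚ))).mono fun i hi => mk_mem_prod hi.1 (mem_univ i.2)
    exact hc.to_subtype
  have : Nonempty ι := ⟨⟨(2, 0, 0), by simp⟩⟩
  obtain ⟨f, hf⟩ := exists_surjective_nat ι
  obtain ⟨η, hη, hη₀, hη', hηh⟩ := exists_scale_seq hdim.2.1 hprec
  obtain ⟨S, hS₀, hSc, hanti, havoid, hS⟩ := exists_antitone_compact_seq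
    (P := fun k F => AvoidsRatio (f k).1.1 (f k).1.2.1 (f k).1.2.2 F) (η := η)
    (fun k δ hδ => by
      obtain ⟨⟨α, p, q⟩, hα, hp, hpq, hq⟩ := f k
      refine exists_equidistributedOn_avoidsRatio ?_ (by exact_mod_cast hp)
        (by exact_mod_cast hpq) (by exact_mod_cast hq) hδ
      rcases hα with h2 | hα
      · exact one_lt_two.trans_eq h2.symm
      · exact hA1 hα) hη
  have hS01 : ∀ k, S k ⊆ Icc 0 1 := fun k => hS₀ ▸ hanti (Nat.zero_le k)
  refine ⟨⋂ k, S k, (hSc 0).of_isClosed_subset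
    (isClosed_iInter fun k => (hSc k).isClosed) (iInter_subset _ 0), ?_, ?_⟩
  · refine gaugeMeasure_iInter_pos_s14 hdim (hη 0) hSc hanti
      (fun ρ hρ hρη k a => four_pow_mul_volume_le hη hη' hηh hS hρ hρη k a) fun k => ?_
    have hk := abs_sub_le_two_mul_of_step (m := fun k => 4 ^ k * volume.real (S k ∩ Icc 0 1))
      hη hη' (fun k => hS k 0 1) (Nat.zero_le k)
    simp only [inter_eq_left.2 (hS01 _)] at hk
    rw [hS₀, Real.volume_real_Icc_of_le zero_le_one] at hk
    have := (abs_le.1 hk).1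
    norm_num at this
    linarith
  · intro x hx y hy z hz hxy hyz hmem
    obtain ⟨p, hxp, hpy⟩ := exists_rat_btwn hxy
    obtain ⟨q, hyq, hqz⟩ := exists_rat_btwn hyz
    have hx0 := (hS01 0 (mem_iInter.1 hx 0)).1
    have hz1 := (hS01 0 (mem_iInter.1 hz 0)).2
    have hp0 : (0 : ℝ) ≤ p := (hx0.trans_lt hxp).le
    have hpq : (p : ℝ) ≤ q := (hpy.trans hyq).le
    have hq1 : (q : ℝ) ≤ 1 := (hqz.trans_le hz1).le
    obtain ⟨k, hk⟩ := hf ⟨((z - x) / (z - y), p, q), mem_insert_of_mem _ hmem,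
      by exact_mod_cast hp0, by exact_mod_cast hpq, by exact_mod_cast hq1⟩
    obtain ⟨F, hF, hav⟩ := havoid k
    rw [hk] at hav
    exact hav x (hF (mem_iInter.1 hx _)) y (hF (mem_iInter.1 hy _)) z (hF (mem_iInter.1 hz _))
      hxp hpy hyq hqz rfl
end
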